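/- Let N = 1, m > 1, 0 < p < 1, σ > 0 with m + p ≥ 2. Let u₀ : ℝ → [0,∞) be continuous, bounded, not identically zero, with supp u₀ = [r₀, R₀], and let r > 0. Then there exist T > 0 and a weak solution u to the Cauchy problem for ∂_t u = Δ(u^m) + (1+|x|)^σ u^p on ℝ × (0,T) with initial datum u₀ such that u(x,t) > 0 for every x ∈ (R₀, R₀ + r) and every t ∈ (0,T); that is, the right interface of the support performs an instantaneous jump from R₀ to at least R₀ + r at time t = 0. -/

import Mathlib

open MeasureTheory Set Filter

noncomputable section

/-- Test functions: smooth, compactly supported in `ℝ × (0,T)`. -/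
def IsTestFn1 (T : ℝ) (η : ℝ → ℝ → ℝ) : Prop :=
  ContDiff ℝ (⊤ : ℕ∞) (Function.uncurry η) ∧ HasCompactSupport (Function.uncurry η) ∧
    ∀ x t : ℝ, t ∉ Ioo 0 T → η x t = 0

/-- Weak solution of `∂ₜ u = ∂ₓₓ(u^m) + (1+|x|)^σ u^p` on `ℝ × (0,T)` with datum `u₀`. -/
structure IsWeakSolution1 (m p σ T : ℝ) (u : ℝ → ℝ → ℝ) (u₀ : ℝ → ℝ) : Prop where
  nonneg : ∀ x, ∀ t ∈ Ioo 0 T, 0 ≤ u x t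
  timeContL1 : ∀ K : Set ℝ, IsCompact K → ∀ s ∈ Ioo 0 T,
    Tendsto (fun t => ∫ x in K, |u x t - u x s|) (nhdsWithin s (Ioo 0 T)) (nhds 0)
  locBdd : ∀ K : Set ℝ, IsCompact K → ∀ a b : ℝ, 0 < a → b < T →
    ∃ C : ℝ, ∀ x ∈ K, ∀ t ∈ Icc a b, u x t ≤ C
  weakForm : ∀ η : ℝ → ℝ → ℝ, IsTestFn1 T η → ∀ t ∈ Ioo 0 T,
    ((∫ x, u x t * η x t) +
      ∫ τ in Ioo (0:ℝ) t, ∫ x,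
        (-(u x τ * deriv (η x) τ) - u x τ ^ m * deriv (deriv (fun y => η y τ)) x)) =
    ∫ τ in Ioo (0:ℝ) t, ∫ x, (1 + |x|) ^ σ * u x τ ^ p * η x τ
  initL1 : ∀ K : Set ℝ, IsCompact K →
    Tendsto (fun t => ∫ x in K, |u x t - u₀ x|) (nhdsWithin 0 (Ioi 0)) (nhds 0)

open scoped Topology

/-! ### An explicit monotone finite difference scheme -/

/-- One step of the explicit scheme for `∂ₜ u = ∂ₓₓ φ(u) + G`, truncated from below at zero. -/
def fdStep (lam k : ℝ) (φ : ℝ → ℝ) (G : ℤ → ℝ → ℝ) (U : ℤ → ℝ) (j : ℤ) : ℝ :=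
  max 0 (U j + lam * (φ (U (j + 1)) - 2 * φ (U j) + φ (U (j - 1))) + k * G j (U j))

/-- The iterates of the explicit scheme, with source `F n` in the `n`-th step. -/
def fdSol (lam k : ℝ) (φ : ℝ → ℝ) (F : ℕ → ℤ → ℝ → ℝ) (U₀ : ℤ → ℝ) : ℕ → ℤ → ℝ
  | 0 => U₀
  | n + 1 => fdStep lam k φ (F n) (fdSol lam k φ F U₀ n)

section Scheme

variable {lam k Λ : ℝ} {φ : ℝ → ℝ} {G G' : ℤ → ℝ → ℝ} {U U' : ℤ → ℝ}

lemma fdStep_nonneg (j : ℤ) : 0 ≤ fdStep lam k φ G U j := le_max_left _ _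

lemma fdStep_mono (hlam : 0 ≤ lam) (hk : 0 ≤ k) (hφ : Monotone φ)
    (hΛ : ∀ a b, a ≤ b → φ b - φ a ≤ Λ * (b - a)) (hcfl : 2 * lam * Λ ≤ 1)
    (hG : ∀ j, Monotone (G j)) (hGG' : ∀ j, G j (U' j) ≤ G' j (U' j))
    (hU : ∀ j, U j ≤ U' j) (j : ℤ) :
    fdStep lam k φ G U j ≤ fdStep lam k φ G' U' j := by
  unfold fdStep
  refine max_le_max le_rfl ?_
  have h1 := hΛ _ _ (hU j)
  have h2 := hφ (hU (j + 1))
  have h3 := hφ (hU (j - 1))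
  have h4 : k * G j (U j) ≤ k * G' j (U' j) :=
    mul_le_mul_of_nonneg_left ((hG j (hU j)).trans (hGG' j)) hk
  have h5 : 2 * lam * (φ (U' j) - φ (U j)) ≤ U' j - U j := by
    calc 2 * lam * (φ (U' j) - φ (U j)) ≤ 2 * lam * (Λ * (U' j - U j)) := by gcongr
      _ = (2 * lam * Λ) * (U' j - U j) := by ring
      _ ≤ 1 * (U' j - U j) := by
        apply mul_le_mul_of_nonneg_right hcfl; linarith [hU j]
      _ = _ := one_mul _
  have h6 := mul_le_mul_of_nonneg_left h2 hlam
  have h7 := mul_le_mul_of_nonneg_left h3 hlam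
  nlinarith

lemma abs_fdStep_sub_le {L : ℝ} (hlam : 0 ≤ lam) (hk : 0 ≤ k) (hφ : Monotone φ)
    (hΛ : ∀ a b, a ≤ b → φ b - φ a ≤ Λ * (b - a)) (hcfl : 2 * lam * Λ ≤ 1)
    (hL : ∀ j a b, |G j a - G j b| ≤ L * |a - b|) (j : ℤ) :
    |fdStep lam k φ G U j - fdStep lam k φ G' U' j| ≤
      (1 + k * L) * |U j - U' j| + lam * (|φ (U (j + 1)) - φ (U' (j + 1))|
        + |φ (U (j - 1)) - φ (U' (j - 1))| - 2 * |φ (U j) - φ (U' j)|)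
        + k * |G j (U' j) - G' j (U' j)| := by
  unfold fdStep
  have key : |U j - U' j - 2 * lam * (φ (U j) - φ (U' j))|
      = |U j - U' j| - 2 * lam * |φ (U j) - φ (U' j)| := by
    have aux : ∀ a b, a ≤ b → 2 * lam * (φ b - φ a) ≤ b - a := fun a b hab => by
      calc 2 * lam * (φ b - φ a) ≤ 2 * lam * (Λ * (b - a)) := by
            gcongr; exact hΛ a b hab
        _ = (2 * lam * Λ) * (b - a) := by ring
        _ ≤ 1 * (b - a) := by
          apply mul_le_mul_of_nonneg_right hcfl; linarith
        _ = _ := one_mul _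
    rcases le_total (U j) (U' j) with h | h
    · have h1 := aux _ _ h
      have h2 := hφ h
      rw [abs_of_nonpos (by linarith), abs_of_nonpos (by linarith),
        abs_of_nonpos (by linarith)]
      ring
    · have h1 := aux _ _ h
      have h2 := hφ h
      rw [abs_of_nonneg (by linarith), abs_of_nonneg (by linarith),
        abs_of_nonneg (by linarith)]
  have h0 : ∀ a b : ℝ, |max 0 a - max 0 b| ≤ |a - b| := fun a b => by
    rw [max_comm 0 a, max_comm 0 b]; exact abs_max_sub_max_le_abs a b 0
  have h1 : |G j (U j) - G' j (U' j)| ≤ L * |U j - U' j| + |G j (U' j) - G' j (U' j)| :=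
    (abs_sub_le _ (G j (U' j)) _).trans (add_le_add_left (hL j _ _) _)
  have h2 := mul_le_mul_of_nonneg_left h1 hk
  have e : U j + lam * (φ (U (j + 1)) - 2 * φ (U j) + φ (U (j - 1))) + k * G j (U j)
      - (U' j + lam * (φ (U' (j + 1)) - 2 * φ (U' j) + φ (U' (j - 1))) + k * G' j (U' j))
      = (U j - U' j - 2 * lam * (φ (U j) - φ (U' j)))
        + lam * (φ (U (j + 1)) - φ (U' (j + 1))) + lam * (φ (U (j - 1)) - φ (U' (j - 1)))
        + k * (G j (U j) - G' j (U' j)) := by ring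
  refine (h0 _ _).trans ?_
  rw [e]
  refine (abs_add_le _ _).trans ?_
  refine (add_le_add_left ((abs_add_le _ _).trans
    (add_le_add_left (abs_add_le _ _) _)) _).trans ?_
  rw [key, abs_mul, abs_mul, abs_mul, abs_of_nonneg hlam, abs_of_nonneg hk]
  nlinarith

lemma summable_abs_of_finite {f : ℤ → ℝ} (hf : f.support.Finite) : Summable fun j => |f j| :=
  summable_of_hasFiniteSupport (hf.subset fun j hj => by simpa using hj)

lemma finite_support_comp_add {f : ℤ → ℝ} (hf : f.support.Finite) (c : ℤ) :
    (Function.support fun j => f (j + c)).Finite :=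
  hf.preimage (f := fun j => j + c) (add_left_injective c).injOn

lemma tsum_abs_fdStep_sub_le {L : ℝ} (hlam : 0 ≤ lam) (hk : 0 ≤ k) (hφ : Monotone φ)
    (hΛ : ∀ a b, a ≤ b → φ b - φ a ≤ Λ * (b - a)) (hcfl : 2 * lam * Λ ≤ 1)
    (hL : ∀ j a b, |G j a - G j b| ≤ L * |a - b|)
    (hU : (Function.support fun j => U j - U' j).Finite)
    (hGU : (Function.support fun j => G j (U' j) - G' j (U' j)).Finite) :
    ∑' j, |fdStep lam k φ G U j - fdStep lam k φ G' U' j| ≤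
      (1 + k * L) * ∑' j, |U j - U' j| + k * ∑' j, |G j (U' j) - G' j (U' j)| := by
  have hΦ : (Function.support fun j => φ (U j) - φ (U' j)).Finite := by
    refine hU.subset fun j hj => ?_
    simp only [Function.mem_support, ne_eq, sub_eq_zero] at hj ⊢
    exact fun h => hj (by rw [h])
  have s1 := (summable_abs_of_finite hU).mul_left (1 + k * L)
  have s2 := summable_abs_of_finite hΦ
  have s3 : Summable fun j => |φ (U (j + 1)) - φ (U' (j + 1))| :=
    summable_abs_of_finite (finite_support_comp_add hΦ 1)
  have s4 : Summable fun j => |φ (U (j - 1)) - φ (U' (j - 1))| :=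
    summable_abs_of_finite (finite_support_comp_add hΦ (-1))
  have s5 := (summable_abs_of_finite hGU).mul_left k
  have s6 := ((s3.add s4).sub (s2.mul_left 2)).mul_left lam
  have s7 := (s1.add s6).add s5
  have hle := abs_fdStep_sub_le (U := U) (U' := U') (G' := G') hlam hk hφ hΛ hcfl hL
  have s8 : Summable fun j => |fdStep lam k φ G U j - fdStep lam k φ G' U' j| :=
    Summable.of_nonneg_of_le (fun _ => abs_nonneg _) hle s7
  refine (s8.tsum_le_tsum hle s7).trans (le_of_eq ?_)
  rw [(s1.add s6).tsum_add s5, s1.tsum_add s6, tsum_mul_left, tsum_mul_left, tsum_mul_left,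
    (s3.add s4).tsum_sub (s2.mul_left 2), s3.tsum_add s4, tsum_mul_left]
  have e3 : ∑' j, |φ (U (j + 1)) - φ (U' (j + 1))| = ∑' j, |φ (U j) - φ (U' j)| :=
    (Equiv.addRight (1 : ℤ)).tsum_eq fun j => |φ (U j) - φ (U' j)|
  have e4 : ∑' j, |φ (U (j - 1)) - φ (U' (j - 1))| = ∑' j, |φ (U j) - φ (U' j)| :=
    (Equiv.subRight (1 : ℤ)).tsum_eq fun j => |φ (U j) - φ (U' j)|
  rw [e3, e4]; ring

/-- A finitely supported function is bounded by its total variation. -/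
lemma abs_le_tsum_abs_diff {f : ℤ → ℝ} (hf : f.support.Finite) (j : ℤ) :
    |f j| ≤ ∑' i, |f (i + 1) - f i| := by
  obtain ⟨b, hb⟩ := hf.bddBelow
  set c := min b j - 1 with hc
  have hc0 : f c = 0 := by
    by_contra h
    have := hb (Function.mem_support.2 h)
    have h2 := min_le_left b j
    omega
  obtain ⟨n, hn⟩ : ∃ n : ℕ, j = c + n := ⟨(j - c).toNat, by
    have h2 := min_le_right b j
    omega⟩
  have htel : f j = ∑ i ∈ Finset.range n, (f (c + i + 1) - f (c + i)) := by
    have := Finset.sum_range_sub (fun i : ℕ => f (c + i)) n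
    simp only [Nat.cast_add, Nat.cast_one, Nat.cast_zero, add_zero, hc0, sub_zero] at this
    rw [hn, ← this]
    simp only [add_assoc]
  have hs : Summable fun i => |f (i + 1) - f i| := summable_abs_of_finite
    (((finite_support_comp_add hf 1).union hf).subset fun i hi => by
      by_contra h
      simp only [mem_union, Function.mem_support, not_or, not_not] at h hi
      exact hi (by rw [h.1, h.2, sub_zero]))
  rw [htel]
  refine (Finset.abs_sum_le_sum_abs _ _).trans ?_
  have hinj : Function.Injective fun i : ℕ => c + (i : ℤ) := fun a b h => by simpa using h
  have := hs.sum_le_tsum ((Finset.range n).map ⟨_, hinj⟩) (fun _ _ => abs_nonneg _)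
  simpa using this

/-- Discrete Agmon inequality. -/
lemma sq_le_of_lipschitz_of_tsum {f : ℤ → ℝ} (hf : f.support.Finite) {c : ℝ}
    (hc : ∀ i, |f (i + 1) - f i| ≤ c) (j : ℤ) : f j ^ 2 ≤ 2 * c * ∑' i, |f i| := by
  have hf2 : (Function.support fun i => f i ^ 2).Finite :=
    hf.subset fun i hi => by simpa using hi
  have h1 := abs_le_tsum_abs_diff hf2 j
  rw [abs_of_nonneg (sq_nonneg _)] at h1
  have s1 := summable_abs_of_finite hf
  have s2 : Summable fun j => |f (j + 1)| := summable_abs_of_finite (finite_support_comp_add hf 1)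
  have hle : ∀ i, |f (i + 1) ^ 2 - f i ^ 2| ≤ c * (|f (i + 1)| + |f i|) := fun i => by
    rw [sq_sub_sq, abs_mul, mul_comm]
    exact mul_le_mul (hc i) (abs_add_le _ _) (abs_nonneg _) ((abs_nonneg _).trans (hc i))
  have s3 := (s2.add s1).mul_left c
  have h2 := (Summable.of_nonneg_of_le (fun _ => abs_nonneg _) hle s3).tsum_le_tsum hle s3
  rw [tsum_mul_left, s2.tsum_add s1] at h2
  have e3 : ∑' j, |f (j + 1)| = ∑' j, |f j| :=
    (Equiv.addRight (1 : ℤ)).tsum_eq fun j => |f j|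
  rw [e3] at h2
  linarith

end Scheme

lemma le_of_le_one_add_mul_add {d : ℕ → ℝ} {a b : ℝ} (ha : 0 ≤ a) (hb : 0 ≤ b) (hd0 : 0 ≤ d 0)
    {N : ℕ}
    (h : ∀ n, n < N → d (n + 1) ≤ (1 + a) * d n + b) :
    ∀ n ≤ N, d n ≤ (d 0 + n * b) * Real.exp (a * n) := by
  intro n hn
  induction n with
  | zero => simp
  | succ n ih =>
    have h1 := ih (by omega)
    have h2 := h n (by omega)
    have e1 : Real.exp (a * (n + 1 : ℕ)) = Real.exp a * Real.exp (a * n) := by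
      rw [← Real.exp_add]; push_cast; ring_nf
    have e2 : 1 + a ≤ Real.exp a := by linarith [Real.add_one_le_exp a]
    have e3 : 1 ≤ Real.exp (a * (n + 1 : ℕ)) := Real.one_le_exp (by positivity)
    calc d (n + 1) ≤ (1 + a) * d n + b := h2
      _ ≤ (1 + a) * ((d 0 + n * b) * Real.exp (a * n)) + b := by gcongr
      _ ≤ Real.exp a * ((d 0 + n * b) * Real.exp (a * n)) + b := by gcongr
      _ = (d 0 + n * b) * Real.exp (a * (n + 1 : ℕ)) + b * 1 := by rw [e1]; ring
      _ ≤ (d 0 + n * b) * Real.exp (a * (n + 1 : ℕ)) + b * Real.exp (a * (n + 1 : ℕ)) := by gcongr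
      _ = _ := by push_cast; ring

/-! ### Travelling wave and separated-variables barriers -/

/-- Tangent line inequality for the convex function `s ↦ (s₊) ^ q`. -/
lemma posPart_rpow_tangent {q : ℝ} (hq : 1 < q) (s w : ℝ) :
    max w 0 ^ q + q * max w 0 ^ (q - 1) * (s - w) ≤ max s 0 ^ q := by
  rcases le_or_gt w 0 with hw | hw
  · rw [max_eq_right hw, Real.zero_rpow (by linarith), Real.zero_rpow (by linarith)]
    simpa using Real.rpow_nonneg (le_max_right s 0) q
  rw [max_eq_left hw.le]
  have e : w ^ q = w ^ (q - 1) * w := by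
    rw [← Real.rpow_add_one hw.ne']; ring_nf
  have hp : 0 < w ^ (q - 1) := Real.rpow_pos_of_pos hw _
  rcases le_or_gt s 0 with hs | hs
  · rw [max_eq_right hs, Real.zero_rpow (by linarith), e]
    nlinarith [mul_pos hp hw, mul_nonneg (mul_pos (by linarith : 0 < q) hp).le (neg_nonneg.2 hs)]
  · rw [max_eq_left hs.le]
    have h := one_add_mul_self_le_rpow_one_add (s := s / w - 1)
      (by have := div_pos hs hw; linarith) hq.le
    rw [show 1 + (s / w - 1) = s / w by ring, Real.div_rpow hs.le hw.le] at h
    have hwq : 0 < w ^ q := Real.rpow_pos_of_pos hw _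
    rw [le_div_iff₀ hwq] at h
    refine le_trans (le_of_eq ?_) h
    rw [e]
    field_simp

lemma rpow_sub_rpow_le {q s t : ℝ} (hq : 1 < q) (hs : 0 ≤ s) (ht : 0 ≤ t) :
    t ^ q - s ^ q ≤ q * t ^ (q - 1) * (t - s) := by
  have := posPart_rpow_tangent hq s t
  rw [max_eq_left hs, max_eq_left ht] at this
  linarith

lemma second_diff_posPart_rpow_le {q : ℝ} (hq : 2 < q) {h : ℝ} (hh : 0 ≤ h) (x : ℝ) :
    max (x + h) 0 ^ q - 2 * max x 0 ^ q + max (x - h) 0 ^ q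
      ≤ 2 * q * (q - 1) * max (x + h) 0 ^ (q - 2) * h ^ 2 := by
  have h1 := posPart_rpow_tangent (q := q) (by linarith) x (x + h)
  have h2 := posPart_rpow_tangent (q := q) (by linarith) x (x - h)
  have h3 := posPart_rpow_tangent (q := q - 1) (by linarith) (x - h) (x + h)
  rw [show q - 1 - 1 = q - 2 by ring] at h3
  have h4 : q * h * (max (x + h) 0 ^ (q - 1) - max (x - h) 0 ^ (q - 1)) ≤
      q * h * ((q - 1) * max (x + h) 0 ^ (q - 2) * (2 * h)) :=
    mul_le_mul_of_nonneg_left (by linarith) (by positivity)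
  nlinarith

/-- The pressure nonlinearity, truncated to be globally Lipschitz. -/
def truncPow (m M s : ℝ) : ℝ := max 0 (min s M) ^ m

section TruncPow

variable {m M : ℝ}

lemma truncPow_mono (hm : 0 ≤ m) : Monotone (truncPow m M) := fun _ _ hab =>
  Real.rpow_le_rpow (le_max_left _ _) (max_le_max le_rfl (min_le_min hab le_rfl)) hm

lemma truncPow_eq {s : ℝ} (hs : 0 ≤ s) (hsM : s ≤ M) : truncPow m M s = s ^ m := by
  rw [truncPow, min_eq_left hsM, max_eq_right hs]

lemma truncPow_sub_le (hm : 1 < m) (hM : 0 ≤ M) {a b : ℝ} (hab : a ≤ b) :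
    truncPow m M b - truncPow m M a ≤ m * M ^ (m - 1) * (b - a) := by
  have h1 := rpow_sub_rpow_le hm (le_max_left 0 (min a M)) (le_max_left 0 (min b M))
  have h2 : max 0 (min b M) ≤ M := max_le hM (min_le_right _ _)
  have h3 : max 0 (min a M) ≤ max 0 (min b M) := max_le_max le_rfl (min_le_min hab le_rfl)
  have h4 : max 0 (min b M) - max 0 (min a M) ≤ b - a := by
    have := abs_max_sub_max_le_abs (min b M) (min a M) 0
    rw [max_comm _ 0, max_comm _ 0] at this
    have h5 := abs_min_sub_min_le_max b M a M
    rw [sub_self, abs_zero, max_eq_left (abs_nonneg _), abs_of_nonneg (sub_nonneg.2 hab)] at h5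
    exact (le_abs_self _).trans (this.trans h5)
  unfold truncPow
  refine h1.trans ?_
  have h6 : max 0 (min b M) ^ (m - 1) ≤ M ^ (m - 1) :=
    Real.rpow_le_rpow (le_max_left _ _) h2 (by linarith)
  have h7 : 0 ≤ max 0 (min b M) ^ (m - 1) := Real.rpow_nonneg (le_max_left _ _) _
  have h8 : 0 ≤ M ^ (m - 1) := Real.rpow_nonneg hM _
  have hm0 : 0 < m := by linarith
  calc _ ≤ m * M ^ (m - 1) * (max 0 (min b M) - max 0 (min a M)) := by
        apply mul_le_mul_of_nonneg_right _ (by linarith)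
        exact mul_le_mul_of_nonneg_left h6 hm0.le
    _ ≤ _ := mul_le_mul_of_nonneg_left h4 (by positivity)

end TruncPow

/-- The travelling wave profile `ξ ↦ (ξ₊) ^ (1 / (1 - p))`. -/
def waveProfile (p ξ : ℝ) : ℝ := max ξ 0 ^ (1 / (1 - p))

/-- The constant in the bound for the second difference of the `m`-th power of the profile. -/
def waveConst (m p : ℝ) : ℝ := 2 * (m / (1 - p)) * (m / (1 - p) - 1)

/-- A sufficient speed for the travelling wave to be a supersolution. -/
def waveSpeed (m p M A : ℝ) : ℝ :=
  waveConst m p * 2 ^ (m / (1 - p) - 2) * M ^ ((m - 1) / (1 - p) - 1) + A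

/-- The absorption that compensates the discretisation error at the front of the wave. -/
def frontAbsorption (m p h : ℝ) : ℝ := waveConst m p * (2 * h) ^ (m / (1 - p) - 2)

section Wave

variable {m p M A h lam k : ℝ}

lemma one_lt_one_div_one_sub (hp0 : 0 < p) (hp1 : p < 1) : 1 < 1 / (1 - p) := by
  rw [lt_div_iff₀ (by linarith)]; linarith

lemma two_lt_div_one_sub (hp0 : 0 < p) (hp1 : p < 1) (hmp : 2 ≤ m + p) : 2 < m / (1 - p) := by
  rw [lt_div_iff₀ (by linarith)]; linarith

lemma waveConst_pos (hp0 : 0 < p) (hp1 : p < 1) (hmp : 2 ≤ m + p) : 0 < waveConst m p := by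
  have := two_lt_div_one_sub hp0 hp1 hmp
  unfold waveConst
  exact mul_pos (by linarith) (by linarith)

lemma frontAbsorption_nonneg (hp0 : 0 < p) (hp1 : p < 1) (hmp : 2 ≤ m + p) (hh : 0 ≤ h) :
    0 ≤ frontAbsorption m p h :=
  mul_nonneg (waveConst_pos hp0 hp1 hmp).le (Real.rpow_nonneg (by linarith) _)

lemma waveProfile_nonneg (ξ : ℝ) : 0 ≤ waveProfile p ξ := Real.rpow_nonneg (le_max_right _ _) _

lemma waveProfile_rpow (q ξ : ℝ) : waveProfile p ξ ^ q = max ξ 0 ^ (q / (1 - p)) := by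
  rw [waveProfile, ← Real.rpow_mul (le_max_right _ _)]; ring_nf

lemma waveProfile_of_nonpos (hp1 : p < 1) {ξ : ℝ} (hξ : ξ ≤ 0) : waveProfile p ξ = 0 := by
  rw [waveProfile, max_eq_right hξ, Real.zero_rpow]
  have : 0 < 1 - p := by linarith
  positivity

lemma le_waveProfile (hp0 : 0 < p) (hp1 : p < 1) {ξ : ℝ} (hξ : 1 ≤ ξ) : ξ ≤ waveProfile p ξ := by
  rw [waveProfile, max_eq_left (by linarith)]
  exact Real.self_le_rpow_of_one_le hξ (one_lt_one_div_one_sub hp0 hp1).le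

lemma waveProfile_supersolution (hm : 1 < m) (hp0 : 0 < p) (hp1 : p < 1) (hmp : 2 ≤ m + p)
    (hM : 1 ≤ M) (hA : 0 ≤ A) (hh : 0 < h) (hh1 : h ≤ 1) (hlam : lam * h ^ 2 = k) (hk : 0 < k)
    {S ξ : ℝ}
    (hS : (1 ≤ ξ ∧ S ≤ A * waveProfile p ξ ^ p) ∨
      S ≤ A * waveProfile p ξ ^ p - frontAbsorption m p h) :
    waveProfile p ξ + lam * (truncPow m M (waveProfile p (ξ + h))
      - 2 * truncPow m M (waveProfile p ξ) + truncPow m M (waveProfile p (ξ - h))) + k * S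
      ≤ waveProfile p (ξ + waveSpeed m p M A * k) := by
  have h1p : 0 < 1 - p := by linarith
  have hβ := one_lt_one_div_one_sub hp0 hp1
  have hγ := two_lt_div_one_sub hp0 hp1 hmp
  have hC := waveConst_pos hp0 hp1 hmp
  have hlam0 : 0 ≤ lam := by
    by_contra hneg
    have : lam * h ^ 2 < 0 := mul_neg_of_neg_of_pos (by linarith) (by positivity)
    linarith
  have hS' : S ≤ A * waveProfile p ξ ^ p := by
    rcases hS with h | h
    · exact h.2
    · linarith [frontAbsorption_nonneg hp0 hp1 hmp hh.le]
  have hpe : waveProfile p ξ ^ p = max ξ 0 ^ (1 / (1 - p) - 1) := by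
    rw [waveProfile_rpow]; congr 1; field_simp; ring
  set P := max ξ 0 ^ (1 / (1 - p) - 1) with hP
  have hP0 : 0 ≤ P := Real.rpow_nonneg (le_max_right _ _) _
  set v := waveSpeed m p M A with hv
  set W := waveConst m p * 2 ^ (m / (1 - p) - 2) * M ^ ((m - 1) / (1 - p) - 1) with hW
  have hW0 : 0 ≤ W := by positivity
  have hvW : v = W + A := rfl
  have htan : waveProfile p ξ + v * P * k ≤ waveProfile p (ξ + v * k) := by
    have := posPart_rpow_tangent hβ (ξ + v * k) ξ
    have h2 : v * P * k ≤ 1 / (1 - p) * P * (ξ + v * k - ξ) := by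
      have h0 : 0 ≤ v * P * k := by rw [hvW]; positivity
      nlinarith
    unfold waveProfile
    linarith
  have hle : ∀ y, truncPow m M (waveProfile p y) ≤ max y 0 ^ (m / (1 - p)) := fun y => by
    rw [← waveProfile_rpow]
    exact Real.rpow_le_rpow (le_max_left _ _)
      (max_le (waveProfile_nonneg _) (min_le_left _ _)) (by linarith)
  have hleM : ∀ y, truncPow m M y ≤ M ^ m := fun y =>
    Real.rpow_le_rpow (le_max_left _ _) (max_le (by linarith) (min_le_right _ _)) (by linarith)
  have hkS : k * S ≤ A * P * k := by
    rw [hpe] at hS'; nlinarith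
  have hWP : 0 ≤ W * P * k := by positivity
  rcases le_or_gt M (waveProfile p ξ) with hb | hb
  · have e : truncPow m M (waveProfile p ξ) = M ^ m := by
      rw [truncPow, min_eq_right hb, max_eq_right (by linarith)]
    have h3 : lam * (truncPow m M (waveProfile p (ξ + h)) - 2 * truncPow m M (waveProfile p ξ)
        + truncPow m M (waveProfile p (ξ - h))) ≤ 0 := by
      apply mul_nonpos_of_nonneg_of_nonpos hlam0
      rw [e]; linarith [hleM (waveProfile p (ξ + h)), hleM (waveProfile p (ξ - h))]
    have : v * P * k = W * P * k + A * P * k := by rw [hvW]; ring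
    linarith
  · have e : truncPow m M (waveProfile p ξ) = max ξ 0 ^ (m / (1 - p)) := by
      rw [truncPow_eq (waveProfile_nonneg _) hb.le, waveProfile_rpow]
    have h3 := second_diff_posPart_rpow_le hγ hh.le ξ
    have h4 : lam * (truncPow m M (waveProfile p (ξ + h)) - 2 * truncPow m M (waveProfile p ξ)
        + truncPow m M (waveProfile p (ξ - h)))
        ≤ waveConst m p * max (ξ + h) 0 ^ (m / (1 - p) - 2) * k := by
      rw [e, ← hlam]
      calc _ ≤ lam * (2 * (m / (1 - p)) * (m / (1 - p) - 1)
            * max (ξ + h) 0 ^ (m / (1 - p) - 2) * h ^ 2) := by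
            apply mul_le_mul_of_nonneg_left _ hlam0
            linarith [hle (ξ + h), hle (ξ - h)]
        _ = _ := by unfold waveConst; ring
    have hvk : v * P * k = W * P * k + A * P * k := by rw [hvW]; ring
    rcases le_or_gt h ξ with hξ | hξ
    · have hξ0 : 0 < ξ := by linarith
      have hξM : ξ ≤ M := by
        rcases le_or_gt ξ 1 with h5 | h5
        · linarith
        · linarith [le_waveProfile hp0 hp1 h5.le]
      have h5 : max (ξ + h) 0 ^ (m / (1 - p) - 2)
          ≤ 2 ^ (m / (1 - p) - 2) * M ^ ((m - 1) / (1 - p) - 1) * P := by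
        rw [hP, max_eq_left hξ0.le, max_eq_left (by linarith)]
        have hexp : 0 ≤ (m - 1) / (1 - p) - 1 := by
          rw [sub_nonneg, le_div_iff₀ h1p]; linarith
        calc (ξ + h) ^ (m / (1 - p) - 2) ≤ (2 * ξ) ^ (m / (1 - p) - 2) :=
              Real.rpow_le_rpow (by linarith) (by linarith) (by linarith)
          _ = 2 ^ (m / (1 - p) - 2) * ξ ^ (((m - 1) / (1 - p) - 1) + (1 / (1 - p) - 1)) := by
              rw [Real.mul_rpow (by norm_num) hξ0.le]; congr 2; field_simp; ring
          _ = 2 ^ (m / (1 - p) - 2) * (ξ ^ ((m - 1) / (1 - p) - 1) * ξ ^ (1 / (1 - p) - 1)) := by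
              rw [Real.rpow_add hξ0]
          _ ≤ 2 ^ (m / (1 - p) - 2) * (M ^ ((m - 1) / (1 - p) - 1) * ξ ^ (1 / (1 - p) - 1)) := by
              gcongr
          _ = _ := by ring
      have h6 : waveConst m p * max (ξ + h) 0 ^ (m / (1 - p) - 2) * k ≤ W * P * k := by
        rw [hW]
        calc _ ≤ waveConst m p * (2 ^ (m / (1 - p) - 2) * M ^ ((m - 1) / (1 - p) - 1) * P) * k := by
              gcongr
          _ = _ := by ring
      linarith
    · have hS2 : S ≤ A * P - frontAbsorption m p h := by
        rcases hS with h5 | h5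
        · linarith [h5.1]
        · rw [← hpe]; exact h5
      have h5 : waveConst m p * max (ξ + h) 0 ^ (m / (1 - p) - 2) * k
          ≤ frontAbsorption m p h * k := by
        unfold frontAbsorption
        gcongr
        exact max_le (by linarith) (by linarith)
      have h6 : k * S ≤ k * (A * P - frontAbsorption m p h) := mul_le_mul_of_nonneg_left hS2 hk.le
      linarith

end Wave

/-- A parabola positive exactly on `(R₀, R₀ + r)`, with maximum one. -/
def bump (R₀ r x : ℝ) : ℝ := 4 / r ^ 2 * ((x - R₀) * (R₀ + r - x))

section Bump

variable {R₀ r x : ℝ}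

lemma bump_le_one (hr : 0 < r) : bump R₀ r x ≤ 1 := by
  unfold bump
  rw [div_mul_eq_mul_div, div_le_one (by positivity)]
  nlinarith [sq_nonneg (x - R₀ - (R₀ + r - x))]

lemma bump_pos (hr : 0 < r) (hx : x ∈ Ioo R₀ (R₀ + r)) : 0 < bump R₀ r x :=
  mul_pos (by positivity) (mul_pos (by linarith [hx.1]) (by linarith [hx.2]))

lemma mem_of_bump_pos (hr : 0 < r) (hx : 0 < bump R₀ r x) : x ∈ Ioo R₀ (R₀ + r) := by
  have h : 0 < (x - R₀) * (R₀ + r - x) := by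
    unfold bump at hx
    exact (mul_pos_iff_of_pos_left (by positivity)).1 hx
  rcases mul_pos_iff.1 h with h | h
  · exact ⟨by linarith [h.1], by linarith [h.2]⟩
  · linarith [h.1, h.2]

lemma bump_subsolution {m p M h lam k B₀ B₁ E S : ℝ} (hm : 1 < m) (hp0 : 0 < p) (hp1 : p < 1)
    (hM : 1 ≤ M) (hr : 0 < r) (hlam : lam * h ^ 2 = k) (hlam0 : 0 ≤ lam)
    (hB₀ : 0 ≤ B₀) (hB : B₀ ≤ B₁) (hB₁ : B₁ ≤ 1) (hE : B₁ - B₀ ≤ k * E)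
    (hEB : E + 8 / r ^ 2 * (m / (m - p)) * B₁ ^ m ≤ B₁ ^ p)
    (hx : 0 < bump R₀ r x)
    (hS : (B₁ * max (bump R₀ r x) 0 ^ (1 / (m - p))) ^ p ≤ S) :
    B₁ * max (bump R₀ r x) 0 ^ (1 / (m - p)) ≤
      B₀ * max (bump R₀ r x) 0 ^ (1 / (m - p))
      + lam * (truncPow m M (B₀ * max (bump R₀ r (x + h)) 0 ^ (1 / (m - p)))
        - 2 * truncPow m M (B₀ * max (bump R₀ r x) 0 ^ (1 / (m - p)))
        + truncPow m M (B₀ * max (bump R₀ r (x - h)) 0 ^ (1 / (m - p)))) + k * S := by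
  have hmp : 0 < m - p := by linarith
  have hk : 0 ≤ k := by rw [← hlam]; positivity
  have hq : 1 < m / (m - p) := by rw [lt_div_iff₀ hmp]; linarith
  have hφ : ∀ y, truncPow m M (B₀ * max (bump R₀ r y) 0 ^ (1 / (m - p)))
      = B₀ ^ m * max (bump R₀ r y) 0 ^ (m / (m - p)) := fun y => by
    have h1 : max (bump R₀ r y) 0 ^ (1 / (m - p)) ≤ 1 :=
      Real.rpow_le_one (le_max_right _ _) (max_le (bump_le_one hr) zero_le_one) (by positivity)
    have h2 : 0 ≤ max (bump R₀ r y) 0 ^ (1 / (m - p)) := Real.rpow_nonneg (le_max_right _ _) _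
    rw [truncPow_eq (by positivity) (by nlinarith), Real.mul_rpow hB₀ h2,
      ← Real.rpow_mul (le_max_right _ _)]
    ring_nf
  have hB₁0 : 0 ≤ B₁ := hB₀.trans hB
  rw [hφ, hφ, hφ]
  have t1 := posPart_rpow_tangent hq (bump R₀ r (x + h)) (bump R₀ r x)
  have t2 := posPart_rpow_tangent hq (bump R₀ r (x - h)) (bump R₀ r x)
  have hw2 : bump R₀ r (x + h) - bump R₀ r x + (bump R₀ r (x - h) - bump R₀ r x)
      = - (8 / r ^ 2 * h ^ 2) := by
    unfold bump; ring
  have hqe : m / (m - p) - 1 = p / (m - p) := by field_simp; ring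
  rw [hqe] at t1 t2
  rw [max_eq_left hx.le] at *
  set w := bump R₀ r x with hw
  set Q := w ^ (p / (m - p)) with hQ
  have hQ0 : 0 ≤ Q := Real.rpow_nonneg hx.le _
  set Y₁ := max (bump R₀ r (x + h)) 0 ^ (m / (m - p))
  set Y₂ := max (bump R₀ r (x - h)) 0 ^ (m / (m - p))
  set Y := w ^ (m / (m - p))
  have h3 : -(8 / r ^ 2 * (m / (m - p)) * Q * h ^ 2) ≤ Y₁ - 2 * Y + Y₂ := by
    have : m / (m - p) * Q * (bump R₀ r (x + h) - w) + m / (m - p) * Q * (bump R₀ r (x - h) - w)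
      = -(8 / r ^ 2 * (m / (m - p)) * Q * h ^ 2) := by
      rw [← mul_add, hw2]; ring
    linarith
  have hBm : B₀ ^ m ≤ B₁ ^ m := Real.rpow_le_rpow hB₀ hB (by linarith)
  have hB₀m : 0 ≤ B₀ ^ m := Real.rpow_nonneg hB₀ _
  have hc : 0 ≤ 8 / r ^ 2 * (m / (m - p)) * Q := by positivity
  have h4 : -(k * (8 / r ^ 2 * (m / (m - p)) * B₁ ^ m * Q)) ≤
      lam * (B₀ ^ m * Y₁ - 2 * (B₀ ^ m * Y) + B₀ ^ m * Y₂) := by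
    calc _ ≤ -(k * (8 / r ^ 2 * (m / (m - p)) * B₀ ^ m * Q)) := by
          rw [neg_le_neg_iff]; gcongr
      _ = lam * (B₀ ^ m * -(8 / r ^ 2 * (m / (m - p)) * Q * h ^ 2)) := by rw [← hlam]; ring
      _ ≤ lam * (B₀ ^ m * (Y₁ - 2 * Y + Y₂)) := by gcongr
      _ = _ := by ring
  have h5 : w ^ (1 / (m - p)) ≤ Q := by
    refine Real.rpow_le_rpow_of_exponent_ge hx (bump_le_one hr) ?_
    gcongr
  have h6 : (B₁ - B₀) * w ^ (1 / (m - p)) ≤ k * (E * Q) := by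
    calc _ ≤ (B₁ - B₀) * Q := mul_le_mul_of_nonneg_left h5 (by linarith)
      _ ≤ k * E * Q := mul_le_mul_of_nonneg_right hE hQ0
      _ = _ := by ring
  have h7 : B₁ ^ p * Q ≤ S := by
    refine le_trans (le_of_eq ?_) hS
    rw [Real.mul_rpow hB₁0 (Real.rpow_nonneg hx.le _), ← Real.rpow_mul hx.le, hQ]
    ring_nf
  have h8 : k * ((E + 8 / r ^ 2 * (m / (m - p)) * B₁ ^ m) * Q) ≤ k * S :=
    mul_le_mul_of_nonneg_left ((mul_le_mul_of_nonneg_right hEB hQ0).trans h7) hk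
  linarith

end Bump

/-! ### Compactness and passage to the limit -/

lemma tendstoUniformlyOn_of_almost_equicontinuous {ι X : Type*} [PseudoMetricSpace X]
    {l : Filter ι} [l.NeBot] {f : ι → X → ℝ} {g : X → ℝ} {K : Set X} (hK : IsCompact K)
    (heq : ∀ ε > 0, ∃ δ > 0, ∀ᶠ i in l, ∀ x ∈ K, ∀ y ∈ K, dist x y < δ → |f i x - f i y| ≤ ε)
    (hlim : ∀ x ∈ K, Tendsto (fun i => f i x) l (𝓝 (g x))) :
    TendstoUniformlyOn f g l K ∧ ContinuousOn g K := by
  have hg : ∀ ε > 0, ∃ δ > 0, ∀ x ∈ K, ∀ y ∈ K, dist x y < δ → |g x - g y| ≤ ε := by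
    intro ε hε
    obtain ⟨δ, hδ, h⟩ := heq ε hε
    refine ⟨δ, hδ, fun x hx y hy hxy => ?_⟩
    exact le_of_tendsto ((hlim x hx).sub (hlim y hy)).abs
      (h.mono fun i hi => hi x hx y hy hxy)
  constructor
  · rw [Metric.tendstoUniformlyOn_iff]
    intro ε hε
    obtain ⟨δ₁, hδ₁, h₁⟩ := heq (ε / 4) (by positivity)
    obtain ⟨δ₂, hδ₂, h₂⟩ := hg (ε / 4) (by positivity)
    obtain ⟨s, hsK, hs⟩ := hK.elim_nhds_subcover (fun x => Metric.ball x (min δ₁ δ₂))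
      fun x _ => Metric.ball_mem_nhds x (lt_min hδ₁ hδ₂)
    have h3 : ∀ᶠ i in l, ∀ y ∈ s, |f i y - g y| < ε / 4 := by
      rw [Filter.eventually_all_finset]
      intro y hy
      exact (Metric.tendsto_nhds.1 (hlim y (hsK y hy))) (ε / 4) (by positivity)
    filter_upwards [h₁, h3] with i hi1 hi3 x hx
    obtain ⟨y, hy, hxy⟩ := mem_iUnion₂.1 (hs hx)
    have hxy' : dist x y < min δ₁ δ₂ := hxy
    have a1 := hi1 x hx y (hsK y hy) (hxy'.trans_le (min_le_left _ _))
    have a2 := h₂ x hx y (hsK y hy) (hxy'.trans_le (min_le_right _ _))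
    have a3 := hi3 y hy
    rw [Real.dist_eq]
    rw [abs_le] at a1 a2
    rw [abs_lt] at a3 ⊢
    constructor <;> linarith [a1.1, a1.2, a2.1, a2.2, a3.1, a3.2]
  · rw [Metric.continuousOn_iff]
    intro x hx ε hε
    obtain ⟨δ, hδ, h⟩ := hg (ε / 2) (by positivity)
    refine ⟨δ, hδ, fun y hy hxy => ?_⟩
    rw [Real.dist_eq]
    linarith [h y hy x hx hxy]

/-- The centred second difference quotient converges uniformly to the second derivative. -/
lemma second_diff_quotient_tendsto {ζ : ℝ → ℝ} (hζ : ContDiff ℝ 2 ζ) (hc : HasCompactSupport ζ)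
    {ε : ℝ} (hε : 0 < ε) : ∃ δ > 0, ∀ h, 0 < h → h < δ → ∀ x,
      |(ζ (x + h) - 2 * ζ x + ζ (x - h)) / h ^ 2 - deriv (deriv ζ) x| ≤ ε := by
  have hd1 : ContDiff ℝ 1 (deriv ζ) := by
    have : ContDiff ℝ (1 + 1) ζ := by simpa [one_add_one_eq_two] using hζ
    exact (contDiff_succ_iff_deriv.1 this).2.2
  have hd2 : Continuous (deriv (deriv ζ)) := hd1.continuous_deriv le_rfl
  have hD0 : ∀ y, HasDerivAt ζ (deriv ζ y) y := fun y =>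
    (hζ.differentiable (by norm_num) y).hasDerivAt
  have hD1 : ∀ y, HasDerivAt (deriv ζ) (deriv (deriv ζ) y) y := fun y =>
    (hd1.differentiable (by norm_num) y).hasDerivAt
  have huc : UniformContinuous (deriv (deriv ζ)) :=
    hc.deriv.deriv.uniformContinuous_of_continuous hd2
  obtain ⟨δ, hδ, hδ'⟩ := Metric.uniformContinuous_iff.1 huc (ε / 2) (by positivity)
  refine ⟨δ, hδ, fun h hh hhδ x => ?_⟩
  have h1 : ∀ s ∈ Icc 0 h, |deriv ζ (x + s) - deriv ζ (x - s) - 2 * s * deriv (deriv ζ) x|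
      ≤ ε * s := by
    intro s hs
    have := (convex_Icc 0 s).norm_image_sub_le_of_norm_hasDerivWithin_le
      (f := fun s => deriv ζ (x + s) - deriv ζ (x - s) - 2 * s * deriv (deriv ζ) x)
      (f' := fun s => deriv (deriv ζ) (x + s) + deriv (deriv ζ) (x - s) - 2 * deriv (deriv ζ) x)
      (C := ε) (x := 0) (y := s) ?_ ?_ (left_mem_Icc.2 hs.1) (right_mem_Icc.2 hs.1)
    · simpa [abs_of_nonneg hs.1] using this
    · intro y _
      have e1 := (hD1 (x + y)).comp_const_add x y
      have e2 := (hD1 (x - y)).comp_const_sub x y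
      have e3 : HasDerivAt (fun s : ℝ => 2 * s * deriv (deriv ζ) x) (2 * deriv (deriv ζ) x) y := by
        simpa using ((hasDerivAt_id y).const_mul 2).mul_const (deriv (deriv ζ) x)
      exact (((e1.sub e2).sub e3).congr_deriv (by ring)).hasDerivWithinAt
    · intro y hy
      have b1 := hδ' (a := x + y) (b := x) (by
        rw [Real.dist_eq, add_sub_cancel_left, abs_of_nonneg hy.1]; linarith [hy.2, hs.2])
      have b2 := hδ' (a := x - y) (b := x) (by
        rw [Real.dist_eq, sub_sub_cancel_left, abs_neg, abs_of_nonneg hy.1]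
        linarith [hy.2, hs.2])
      rw [Real.dist_eq] at b1 b2
      rw [Real.norm_eq_abs, show deriv (deriv ζ) (x + y) + deriv (deriv ζ) (x - y)
        - 2 * deriv (deriv ζ) x = (deriv (deriv ζ) (x + y) - deriv (deriv ζ) x)
        + (deriv (deriv ζ) (x - y) - deriv (deriv ζ) x) by ring]
      exact (abs_add_le _ _).trans (by linarith)
  have h2 : |ζ (x + h) - 2 * ζ x + ζ (x - h) - h ^ 2 * deriv (deriv ζ) x| ≤ ε * h * h := by
    have := (convex_Icc 0 h).norm_image_sub_le_of_norm_hasDerivWithin_le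
      (f := fun s => ζ (x + s) - 2 * ζ x + ζ (x - s) - s ^ 2 * deriv (deriv ζ) x)
      (f' := fun s => deriv ζ (x + s) - deriv ζ (x - s) - 2 * s * deriv (deriv ζ) x)
      (C := ε * h) (x := 0) (y := h) ?_ ?_ (left_mem_Icc.2 hh.le) (right_mem_Icc.2 hh.le)
    · have e : ζ x - 2 * ζ x + ζ x = 0 := by ring
      simpa [abs_of_nonneg hh.le, e] using this
    · intro y _
      have e1 := (hD0 (x + y)).comp_const_add x y
      have e2 := (hD0 (x - y)).comp_const_sub x y
      have e3 : HasDerivAt (fun s : ℝ => s ^ 2 * deriv (deriv ζ) x)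
          (2 * y * deriv (deriv ζ) x) y := by
        simpa using (hasDerivAt_pow 2 y).mul_const (deriv (deriv ζ) x)
      exact ((((e1.sub_const (2 * ζ x)).add e2).sub e3).congr_deriv (by ring)).hasDerivWithinAt
    · intro y hy
      exact (h1 y hy).trans (by have := hy.2; gcongr)
  rw [show (ζ (x + h) - 2 * ζ x + ζ (x - h)) / h ^ 2 - deriv (deriv ζ) x
    = (ζ (x + h) - 2 * ζ x + ζ (x - h) - h ^ 2 * deriv (deriv ζ) x) / h ^ 2 by field_simp,
    abs_div, abs_of_pos (by positivity : 0 < h ^ 2), div_le_iff₀ (by positivity)]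
  linarith

/-- The piecewise constant function on cells of length `h` with values `U`. -/
def cellFun (h : ℝ) (U : ℤ → ℝ) (x : ℝ) : ℝ := U ⌊x / h⌋

lemma measurable_cellFun (h : ℝ) (U : ℤ → ℝ) : Measurable (cellFun h U) :=
  (Measurable.of_discrete (f := U)).comp (Int.measurable_floor.comp (measurable_id.div_const h))

lemma cellFun_add {h : ℝ} (hh : 0 < h) (U : ℤ → ℝ) (x : ℝ) :
    cellFun h U (x + h) = cellFun h (fun j => U (j + 1)) x := by
  unfold cellFun
  rw [add_div, div_self hh.ne', Int.floor_add_one]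

lemma cellFun_sub {h : ℝ} (hh : 0 < h) (U : ℤ → ℝ) (x : ℝ) :
    cellFun h U (x - h) = cellFun h (fun j => U (j - 1)) x := by
  unfold cellFun
  rw [sub_div, div_self hh.ne', Int.floor_sub_one]

lemma integrable_mul_of_bound {g ζ : ℝ → ℝ} (hg : Measurable g) {C : ℝ} (hC : ∀ x, |g x| ≤ C)
    (hζ : Continuous ζ) (hc : HasCompactSupport ζ) : Integrable fun x => g x * ζ x :=
  (hζ.integrable_of_hasCompactSupport hc).bdd_mul hg.aestronglyMeasurable
    (Eventually.of_forall hC)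

lemma integral_cellFun_second_diff {h : ℝ} (hh : 0 < h) {V : ℤ → ℝ} {C : ℝ}
    (hC : ∀ j, |V j| ≤ C) {ζ : ℝ → ℝ} (hζ : Continuous ζ) (hc : HasCompactSupport ζ) :
    ∫ x, cellFun h (fun j => V (j + 1) - 2 * V j + V (j - 1)) x * ζ x
      = ∫ x, cellFun h V x * (ζ (x + h) - 2 * ζ x + ζ (x - h)) := by
  have hi : ∀ c : ℝ, Integrable fun x => cellFun h V x * ζ (x + c) := fun c =>
    integrable_mul_of_bound (measurable_cellFun h V) (fun x => hC _)
      (hζ.comp (continuous_add_const c)) (hc.comp_homeomorph (Homeomorph.addRight c))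
  have hj : ∀ c : ℤ, Integrable fun x => cellFun h (fun j => V (j + c)) x * ζ x := fun c =>
    integrable_mul_of_bound (measurable_cellFun h _) (fun x => hC _) hζ hc
  have e1 : ∫ x, cellFun h (fun j => V (j + 1)) x * ζ x = ∫ x, cellFun h V x * ζ (x - h) := by
    rw [← integral_add_right_eq_self (fun x => cellFun h V x * ζ (x - h)) h]
    simp [cellFun_add hh]
  have e2 : ∫ x, cellFun h (fun j => V (j - 1)) x * ζ x = ∫ x, cellFun h V x * ζ (x + h) := by
    rw [← integral_sub_right_eq_self (fun x => cellFun h V x * ζ (x + h)) h]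
    simp [cellFun_sub hh]
  have i1 := hj 1
  have i2 : Integrable fun x => cellFun h (fun j => V (j - 1)) x * ζ x := hj (-1)
  have i3 : Integrable fun x => cellFun h V x * ζ x := by simpa using hi 0
  have i4 := hi h
  have i5 : Integrable fun x => cellFun h V x * ζ (x - h) := hi (-h)
  have l1 : ∀ x, cellFun h (fun j => V (j + 1) - 2 * V j + V (j - 1)) x * ζ x =
      cellFun h (fun j => V (j + 1)) x * ζ x - 2 * (cellFun h V x * ζ x)
        + cellFun h (fun j => V (j - 1)) x * ζ x := fun x => by simp only [cellFun]; ring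
  have l2 : ∀ x, cellFun h V x * (ζ (x + h) - 2 * ζ x + ζ (x - h)) =
      cellFun h V x * ζ (x + h) - 2 * (cellFun h V x * ζ x) + cellFun h V x * ζ (x - h) :=
    fun x => by ring
  simp_rw [l1, l2]
  have i6 : Integrable fun x => 2 * (cellFun h V x * ζ x) := i3.const_mul 2
  have i7 : Integrable fun x => cellFun h (fun j => V (j + 1)) x * ζ x
    - 2 * (cellFun h V x * ζ x) := i1.sub i6
  have i8 : Integrable fun x => cellFun h V x * ζ (x + h)
    - 2 * (cellFun h V x * ζ x) := i4.sub i6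
  rw [integral_add i7 i2, integral_sub i1 i6, integral_add i8 i5, integral_sub i4 i6, e1, e2]
  ring

/-- Projection of a time onto `[0, τ]`. -/
def clampTime (τ t : ℝ) : ℝ := max 0 (min t τ)

lemma clampTime_nonneg (τ t : ℝ) : 0 ≤ clampTime τ t := le_max_left _ _

lemma clampTime_le {τ : ℝ} (hτ : 0 ≤ τ) (t : ℝ) : clampTime τ t ≤ τ :=
  max_le hτ (min_le_right _ _)

lemma clampTime_of_mem {τ t : ℝ} (ht : t ∈ Icc 0 τ) : clampTime τ t = t := by
  rw [clampTime, min_eq_left ht.2, max_eq_right ht.1]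

lemma abs_clampTime_sub_le (τ t s : ℝ) : |clampTime τ t - clampTime τ s| ≤ |t - s| := by
  unfold clampTime
  rw [max_comm 0, max_comm 0]
  exact (abs_max_sub_max_le_abs _ _ _).trans (by
    simpa using abs_min_sub_min_le_max t τ s τ)

/-- The piecewise constant interpolation of a space-time grid function, with time clamped
to `[0, τ]`. -/
def gridFun (h k τ : ℝ) (U : ℕ → ℤ → ℝ) (x t : ℝ) : ℝ := U ⌊clampTime τ t / k⌋₊ ⌊x / h⌋

/-- A family of explicit schemes consistent with `∂ₜ u = ∂ₓₓ (u ^ m) + f (x, t, u)`, bounded and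
almost equicontinuous. -/
structure IsConsistentScheme (m M C₁ C₂ τ : ℝ) (h k e : ℕ → ℝ) (f : ℝ × ℝ × ℝ → ℝ)
    (U : ℕ → ℕ → ℤ → ℝ) : Prop where
  h_pos : ∀ N, 0 < h N
  k_pos : ∀ N, 0 < k N
  h_tendsto : Tendsto h atTop (𝓝 0)
  k_tendsto : Tendsto k atTop (𝓝 0)
  e_tendsto : Tendsto e atTop (𝓝 0)
  nonneg : ∀ (N n : ℕ) (j : ℤ), 0 ≤ U N n j
  le_bound : ∀ (N n : ℕ) (j : ℤ), n * k N ≤ τ → U N n j ≤ M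
  modulus : ∀ (N n n' : ℕ) (i j : ℤ), n * k N ≤ τ → n' * k N ≤ τ → |U N n i - U N n' j| ^ m ≤
    C₁ * (h N * |(i : ℝ) - j|) + C₂ * √(k N * |(n : ℝ) - n'|)
  consistent : ∀ (N n : ℕ) (j : ℤ), (n + 1) * k N ≤ τ →
    |U N (n + 1) j - U N n j - k N / h N ^ 2 * (U N n (j + 1) ^ m - 2 * U N n j ^ m
      + U N n (j - 1) ^ m) - k N * f (j * h N, n * k N, U N n j)| ≤ k N * e N

lemma floor_mul_mem {a c : ℝ} (hc : 0 < c) : (⌊a / c⌋ : ℝ) * c ≤ a ∧ a < (⌊a / c⌋ + 1 : ℝ) * c :=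
  ⟨(le_div_iff₀ hc).1 (Int.floor_le _), (div_lt_iff₀ hc).1 (Int.lt_floor_add_one _)⟩

lemma natFloor_mul_mem {a c : ℝ} (ha : 0 ≤ a) (hc : 0 < c) :
    (⌊a / c⌋₊ : ℝ) * c ≤ a ∧ a < (⌊a / c⌋₊ + 1 : ℝ) * c :=
  ⟨(le_div_iff₀ hc).1 (Nat.floor_le (div_nonneg ha hc.le)),
    (div_lt_iff₀ hc).1 (Nat.lt_floor_add_one _)⟩

lemma abs_integral_le_of_support {g : ℝ → ℝ} {R c : ℝ} (hR : 0 ≤ R)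
    (h0 : ∀ x, R < |x| → g x = 0) (hc : ∀ x, |x| ≤ R → |g x| ≤ c) :
    |∫ x, g x| ≤ c * (2 * R) := by
  have e : ∫ x, g x = ∫ x in Icc (-R) R, g x := by
    refine (setIntegral_eq_integral_of_forall_compl_eq_zero fun x hx => h0 x ?_).symm
    by_contra hx'
    exact hx (abs_le.1 (not_lt.1 hx'))
  rw [e]
  have := norm_setIntegral_le_of_norm_le_const (μ := volume) (f := g) (s := Icc (-R) R) (C := c)
    (by simp) fun x hx => hc x (abs_le.2 hx)
  rw [Real.volume_real_Icc_of_le (by linarith)] at this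
  rw [Real.norm_eq_abs] at this
  linarith

section Limit

variable {m M C₁ C₂ τ : ℝ} {h k e : ℕ → ℝ} {f : ℝ × ℝ × ℝ → ℝ} {U : ℕ → ℕ → ℤ → ℝ}
  {𝒰 : Ultrafilter ℕ} {u : ℝ → ℝ → ℝ}

lemma IsConsistentScheme.gridFun_mem (H : IsConsistentScheme m M C₁ C₂ τ h k e f U)
    (hτ : 0 ≤ τ) (N : ℕ) (x t : ℝ) : gridFun (h N) (k N) τ (U N) x t ∈ Icc 0 M := by
  refine ⟨H.nonneg _ _ _, H.le_bound _ _ _ ?_⟩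
  exact (natFloor_mul_mem (clampTime_nonneg _ _) (H.k_pos N)).1.trans (clampTime_le hτ t)

lemma IsConsistentScheme.exists_limit (H : IsConsistentScheme m M C₁ C₂ τ h k e f U)
    (hτ : 0 ≤ τ) (𝒰 : Ultrafilter ℕ) : ∃ u : ℝ → ℝ → ℝ, ∀ x t,
      Tendsto (fun N => gridFun (h N) (k N) τ (U N) x t) 𝒰 (𝓝 (u x t)) := by
  have : ∀ x t, ∃ ℓ, Tendsto (fun N => gridFun (h N) (k N) τ (U N) x t) 𝒰 (𝓝 ℓ) := by
    intro x t
    obtain ⟨ℓ, -, hℓ⟩ := (isCompact_Icc (a := (0 : ℝ)) (b := M)).ultrafilter_le_nhds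
      (𝒰.map fun N => gridFun (h N) (k N) τ (U N) x t)
      (by
        rw [le_principal_iff, Ultrafilter.coe_map]
        exact mem_map.2 (Filter.univ_mem' fun N => H.gridFun_mem hτ N x t))
    exact ⟨ℓ, hℓ⟩
  choose u hu using this
  exact ⟨u, hu⟩

lemma IsConsistentScheme.almost_equicontinuous (H : IsConsistentScheme m M C₁ C₂ τ h k e f U)
    (hm : 0 < m) (hτ : 0 ≤ τ) (hC₁ : 0 ≤ C₁) (hC₂ : 0 ≤ C₂) {ε : ℝ} (hε : 0 < ε) :
    ∃ δ > 0, ∀ᶠ N in atTop, ∀ x y : ℝ × ℝ, dist x y < δ →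
      |gridFun (h N) (k N) τ (U N) x.1 x.2 - gridFun (h N) (k N) τ (U N) y.1 y.2| ≤ ε := by
  have hcont : Tendsto (fun r : ℝ => C₁ * r + C₂ * √r) (𝓝 0) (𝓝 0) := by
    have : Continuous fun r : ℝ => C₁ * r + C₂ * √r := by fun_prop
    simpa using this.tendsto 0
  obtain ⟨ρ, hρ, hρ'⟩ := Metric.tendsto_nhds_nhds.1 hcont (ε ^ m) (Real.rpow_pos_of_pos hε m)
  refine ⟨ρ / 2 / 2, by positivity, ?_⟩
  filter_upwards [H.h_tendsto.eventually_lt_const (by positivity : 0 < ρ / 2),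
    H.k_tendsto.eventually_lt_const (by positivity : 0 < ρ / 2)] with N hN kN x y hxy
  have hx : |x.1 - y.1| < ρ / 2 / 2 := (le_max_left _ _).trans_lt hxy
  have ht : |x.2 - y.2| < ρ / 2 / 2 := (le_max_right _ _).trans_lt hxy
  have ht' := (abs_clampTime_sub_le τ x.2 y.2).trans_lt ht
  have hp := H.h_pos N
  have kp := H.k_pos N
  have f1 := floor_mul_mem (a := x.1) hp
  have f2 := floor_mul_mem (a := y.1) hp
  have f3 := natFloor_mul_mem (clampTime_nonneg τ x.2) kp
  have f4 := natFloor_mul_mem (clampTime_nonneg τ y.2) kp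
  have mod := H.modulus N ⌊clampTime τ x.2 / k N⌋₊ ⌊clampTime τ y.2 / k N⌋₊ ⌊x.1 / h N⌋
    ⌊y.1 / h N⌋ (f3.1.trans (clampTime_le hτ _)) (f4.1.trans (clampTime_le hτ _))
  have d1 : h N * |(⌊x.1 / h N⌋ : ℝ) - ⌊y.1 / h N⌋| ≤ 3 * ρ / 4 := by
    rw [← abs_of_pos hp, ← abs_mul, abs_of_pos hp, abs_le]
    rw [abs_lt] at hx
    constructor <;> nlinarith
  have d2 : k N * |(⌊clampTime τ x.2 / k N⌋₊ : ℝ) - ⌊clampTime τ y.2 / k N⌋₊| ≤ 3 * ρ / 4 := by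
    rw [← abs_of_pos kp, ← abs_mul, abs_of_pos kp, abs_le]
    rw [abs_lt] at ht'
    constructor <;> nlinarith
  have h3 := hρ' (x := 3 * ρ / 4) (by
    rw [Real.dist_eq, sub_zero, abs_of_pos (by positivity)]; linarith)
  rw [Real.dist_eq, sub_zero, abs_lt] at h3
  have h4 := Real.sqrt_le_sqrt d2
  have h5 : |gridFun (h N) (k N) τ (U N) x.1 x.2 - gridFun (h N) (k N) τ (U N) y.1 y.2| ^ m
      ≤ ε ^ m := by
    refine mod.trans (le_trans ?_ h3.2.le)
    gcongr
  exact (Real.rpow_le_rpow_iff (abs_nonneg _) hε.le hm).1 h5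

/-- The grid functions converge locally uniformly to their pointwise ultralimit. -/
lemma IsConsistentScheme.uniform_limit (H : IsConsistentScheme m M C₁ C₂ τ h k e f U)
    (hm : 0 < m) (hτ : 0 ≤ τ) (hC₁ : 0 ≤ C₁) (hC₂ : 0 ≤ C₂) (h𝒰 : (𝒰 : Filter ℕ) ≤ atTop)
    (hu : ∀ x t, Tendsto (fun N => gridFun (h N) (k N) τ (U N) x t) 𝒰 (𝓝 (u x t)))
    {K : Set (ℝ × ℝ)} (hK : IsCompact K) :
    TendstoUniformlyOn (fun N (z : ℝ × ℝ) => gridFun (h N) (k N) τ (U N) z.1 z.2)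
      (Function.uncurry u) 𝒰 K ∧ ContinuousOn (Function.uncurry u) K := by
  refine tendstoUniformlyOn_of_almost_equicontinuous hK (fun ε hε => ?_)
    fun z _ => hu z.1 z.2
  obtain ⟨δ, hδ, hδ'⟩ := H.almost_equicontinuous hm hτ hC₁ hC₂ hε
  exact ⟨δ, hδ, (hδ'.filter_mono h𝒰).mono fun N hN x _ y _ hxy => hN x y hxy⟩

lemma IsConsistentScheme.continuous_limit (H : IsConsistentScheme m M C₁ C₂ τ h k e f U)
    (hm : 0 < m) (hτ : 0 ≤ τ) (hC₁ : 0 ≤ C₁) (hC₂ : 0 ≤ C₂) (h𝒰 : (𝒰 : Filter ℕ) ≤ atTop)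
    (hu : ∀ x t, Tendsto (fun N => gridFun (h N) (k N) τ (U N) x t) 𝒰 (𝓝 (u x t))) :
    Continuous (Function.uncurry u) := by
  rw [continuous_iff_continuousAt]
  intro z
  exact (H.uniform_limit hm hτ hC₁ hC₂ h𝒰 hu (isCompact_closedBall z 1)).2.continuousAt
    (Metric.closedBall_mem_nhds z one_pos)

end Limit

section Limit

variable {m M C₁ C₂ τ : ℝ} {h k e : ℕ → ℝ} {f : ℝ × ℝ × ℝ → ℝ} {U : ℕ → ℕ → ℤ → ℝ}
  {𝒰 : Ultrafilter ℕ} {u : ℝ → ℝ → ℝ}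

lemma IsConsistentScheme.limit_mem (H : IsConsistentScheme m M C₁ C₂ τ h k e f U)
    (hτ : 0 ≤ τ)
    (hu : ∀ x t, Tendsto (fun N => gridFun (h N) (k N) τ (U N) x t) 𝒰 (𝓝 (u x t))) (x t : ℝ) :
    u x t ∈ Icc 0 M :=
  isClosed_Icc.mem_of_tendsto (hu x t) (Eventually.of_forall fun N => H.gridFun_mem hτ N x t)

lemma IsConsistentScheme.uniform_comp (H : IsConsistentScheme m M C₁ C₂ τ h k e f U)
    (hm : 0 < m) (hτ : 0 ≤ τ) (hC₁ : 0 ≤ C₁) (hC₂ : 0 ≤ C₂) (h𝒰 : (𝒰 : Filter ℕ) ≤ atTop)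
    (hu : ∀ x t, Tendsto (fun N => gridFun (h N) (k N) τ (U N) x t) 𝒰 (𝓝 (u x t)))
    {Φ : ℝ × ℝ × ℝ → ℝ} (hΦ : Continuous Φ) (R : ℝ) {ε : ℝ} (hε : 0 < ε) :
    ∀ᶠ N in (𝒰 : Filter ℕ), ∀ x t, |x| ≤ R → t ∈ Icc 0 τ →
      |Φ (⌊x / h N⌋ * h N, ⌊t / k N⌋₊ * k N, gridFun (h N) (k N) τ (U N) x t)
        - Φ (x, t, u x t)| ≤ ε := by
  have hK : IsCompact (Icc (-(R + 1)) (R + 1) ×ˢ (Icc 0 τ ×ˢ Icc 0 M)) :=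
    isCompact_Icc.prod (isCompact_Icc.prod isCompact_Icc)
  obtain ⟨δ, hδ, hδ'⟩ := Metric.uniformContinuousOn_iff.1
    (hK.uniformContinuousOn_of_continuous hΦ.continuousOn) ε hε
  have hun := Metric.tendstoUniformlyOn_iff.1 (H.uniform_limit hm hτ hC₁ hC₂ h𝒰 hu
    (isCompact_Icc.prod isCompact_Icc : IsCompact (Icc (-R) R ×ˢ Icc 0 τ))).1 δ hδ
  filter_upwards [hun, (H.h_tendsto.eventually_lt_const hδ).filter_mono h𝒰,
    (H.h_tendsto.eventually_lt_const one_pos).filter_mono h𝒰,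
    (H.k_tendsto.eventually_lt_const hδ).filter_mono h𝒰] with N h1 h2 h3 h4 x t hx ht
  have hx' := abs_le.1 hx
  have f1 := floor_mul_mem (a := x) (H.h_pos N)
  have f3 := natFloor_mul_mem ht.1 (H.k_pos N)
  have h5 := h1 (x, t) ⟨hx', ht⟩
  rw [dist_comm] at h5
  refine (hδ' _ ⟨⟨?_, ?_⟩, ⟨?_, f3.1.trans ht.2⟩, H.gridFun_mem hτ N x t⟩ _
    ⟨⟨by linarith, by linarith⟩, ht, H.limit_mem hτ hu x t⟩ ?_).le
  · simp only; nlinarith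
  · simp only; nlinarith
  · have := (H.k_pos N).le
    simp only; positivity
  · refine max_lt ?_ (max_lt ?_ h5)
    · simp only [Real.dist_eq]
      rw [abs_lt]
      constructor <;> nlinarith
    · simp only [Real.dist_eq]
      rw [abs_lt]
      constructor <;> nlinarith

/-- The time derivative of `∫ u ζ` along a solution of `∂ₜ u = ∂ₓₓ (u ^ m) + f (x, t, u)`. -/
def weakRate (m : ℝ) (f : ℝ × ℝ × ℝ → ℝ) (u : ℝ → ℝ → ℝ) (ζ : ℝ → ℝ) (t : ℝ) : ℝ :=
  ∫ x, u x t ^ m * deriv (deriv ζ) x + f (x, t, u x t) * ζ x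

lemma exists_support_bound {ζ : ℝ → ℝ} (hc : HasCompactSupport ζ) :
    ∃ R, 0 ≤ R ∧ (∀ x, R < |x| → ζ x = 0) ∧ ∀ x, R < |x| → deriv (deriv ζ) x = 0 := by
  obtain ⟨R, hR⟩ := hc.isCompact.isBounded.subset_closedBall (0 : ℝ)
  have hx : ∀ x, max R 0 < |x| → x ∉ tsupport ζ := fun x hx hx' => by
    have := hR hx'
    rw [Metric.mem_closedBall, dist_zero_right, Real.norm_eq_abs] at this
    exact absurd (lt_of_le_of_lt (le_max_left _ _) hx) (not_lt.2 this)
  refine ⟨max R 0, le_max_right _ _, fun x h => image_eq_zero_of_notMem_tsupport (hx x h),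
    fun x h => image_eq_zero_of_notMem_tsupport fun h' => hx x h ?_⟩
  exact (tsupport_deriv_subset (f := ζ) : _) ((tsupport_deriv_subset (f := deriv ζ) : _) h')

lemma continuous_deriv_deriv {ζ : ℝ → ℝ} (hζ : ContDiff ℝ 2 ζ) : Continuous (deriv (deriv ζ)) := by
  have : ContDiff ℝ (1 + 1) ζ := by simpa [one_add_one_eq_two] using hζ
  exact (contDiff_succ_iff_deriv.1 this).2.2.continuous_deriv le_rfl

lemma IsConsistentScheme.step_estimate (H : IsConsistentScheme m M C₁ C₂ τ h k e f U)
    (hm : 0 < m) (hM : 0 ≤ M) (hτ : 0 ≤ τ) (hC₁ : 0 ≤ C₁) (hC₂ : 0 ≤ C₂)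
    (h𝒰 : (𝒰 : Filter ℕ) ≤ atTop)
    (hu : ∀ x t, Tendsto (fun N => gridFun (h N) (k N) τ (U N) x t) 𝒰 (𝓝 (u x t)))
    (hf : Continuous f) {ζ : ℝ → ℝ} (hζ : ContDiff ℝ 2 ζ) (hc : HasCompactSupport ζ)
    {ε : ℝ} (hε : 0 < ε) :
    ∀ᶠ N in (𝒰 : Filter ℕ), ∀ (n : ℕ) (t : ℝ), n * k N ≤ t → t < (n + 1) * k N →
      (n + 1) * k N ≤ τ →
      |(∫ x, cellFun (h N) (U N (n + 1)) x * ζ x) - (∫ x, cellFun (h N) (U N n) x * ζ x)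
        - k N * weakRate m f u ζ t| ≤ k N * ε := by
  obtain ⟨R, hR, hR1, hR2⟩ := exists_support_bound hc
  have hζ2 := continuous_deriv_deriv hζ
  have hc2 : HasCompactSupport (deriv (deriv ζ)) := hc.deriv.deriv
  obtain ⟨Z₁, hZ₁⟩ := hc.exists_bound_of_continuous hζ.continuous
  obtain ⟨Z₂, hZ₂⟩ := hc2.exists_bound_of_continuous hζ2
  obtain ⟨Z, hZ0, hZa, hZb⟩ : ∃ Z, 0 ≤ Z ∧ (∀ x, |ζ x| ≤ Z) ∧ ∀ x, |deriv (deriv ζ) x| ≤ Z :=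
    ⟨max 0 (max Z₁ Z₂), le_max_left _ _,
      fun x => (hZ₁ x).trans ((le_max_left _ _).trans (le_max_right _ _)),
      fun x => (hZ₂ x).trans ((le_max_right _ _).trans (le_max_right _ _))⟩
  have hMm : 0 ≤ M ^ m := Real.rpow_nonneg hM m
  obtain ⟨ε', hε', hεε'⟩ : ∃ ε' > 0, 2 * (R + 1) * (3 * Z + M ^ m) * ε' ≤ ε := by
    refine ⟨ε / (2 * (R + 1) * (3 * Z + M ^ m) + 1), by positivity, ?_⟩
    rw [mul_div_assoc', div_le_iff₀ (by positivity)]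
    nlinarith
  obtain ⟨δ, hδ, hδ'⟩ := second_diff_quotient_tendsto hζ hc hε'
  have hV : Continuous fun z : ℝ × ℝ × ℝ => z.2.2 ^ m :=
    (Real.continuous_rpow_const hm.le).comp (by fun_prop)
  have hucont := H.continuous_limit hm hτ hC₁ hC₂ h𝒰 hu
  filter_upwards [H.uniform_comp hm hτ hC₁ hC₂ h𝒰 hu hf (R + 1) hε',
    H.uniform_comp hm hτ hC₁ hC₂ h𝒰 hu hV (R + 1) hε',
    (H.h_tendsto.eventually_lt_const hδ).filter_mono h𝒰,
    (H.h_tendsto.eventually_lt_const one_pos).filter_mono h𝒰,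
    (H.e_tendsto.eventually_lt_const hε').filter_mono h𝒰] with N a1 a2 a3 a4 a5 n t hnt htn hnτ
  have hp := H.h_pos N
  have kp := H.k_pos N
  have ht0 : 0 ≤ t := le_trans (by positivity) hnt
  have ht : t ∈ Icc 0 τ := ⟨ht0, by linarith⟩
  have hfl : ⌊t / k N⌋₊ = n := by
    rw [Nat.floor_eq_iff (by positivity)]
    exact ⟨(le_div_iff₀ kp).2 hnt, (div_lt_iff₀ kp).2 htn⟩
  have hgrid : ∀ x, gridFun (h N) (k N) τ (U N) x t = U N n ⌊x / h N⌋ := fun x => by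
    rw [gridFun, clampTime_of_mem ht, hfl]
  have hnτ' : n * k N ≤ τ := by linarith
  replace a1 := fun x hx => a1 x t hx ht
  replace a2 := fun x hx => a2 x t hx ht
  simp only [hgrid, hfl] at a1 a2
  set V : ℤ → ℝ := fun j => U N n j ^ m with hVdef
  have hVb : ∀ j, |V j| ≤ M ^ m := fun j => by
    rw [abs_of_nonneg (Real.rpow_nonneg (H.nonneg N n j) m)]
    exact Real.rpow_le_rpow (H.nonneg N n j) (H.le_bound N n j hnτ') hm.le
  have hUb : ∀ n' : ℕ, n' * k N ≤ τ → ∀ j, |U N n' j| ≤ M := fun n' hn' j => by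
    rw [abs_of_nonneg (H.nonneg N n' j)]
    exact H.le_bound N n' j hn'
  have hucx : Continuous fun x => u x t := hucont.comp (Continuous.prodMk_left t)
  have hfx : Continuous fun x => f (x, t, u x t) := hf.comp (by fun_prop)
  have hvx : Continuous fun x => u x t ^ m := (Real.continuous_rpow_const hm.le).comp hucx
  have j1 : Integrable fun x => cellFun (h N) (U N (n + 1)) x * ζ x :=
    integrable_mul_of_bound (measurable_cellFun _ _) (fun x => hUb (n + 1) (by
      push_cast; exact hnτ) _) hζ.continuous hc
  have j2 : Integrable fun x => cellFun (h N) (U N n) x * ζ x :=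
    integrable_mul_of_bound (measurable_cellFun _ _) (fun x => hUb n hnτ' _) hζ.continuous hc
  have j3 : Integrable fun x => u x t ^ m * deriv (deriv ζ) x :=
    (hvx.mul hζ2).integrable_of_hasCompactSupport hc2.mul_left
  have j4 : Integrable fun x => f (x, t, u x t) * ζ x :=
    (hfx.mul hζ.continuous).integrable_of_hasCompactSupport hc.mul_left
  have j5 : Integrable fun x =>
      cellFun (h N) (fun j => V (j + 1) - 2 * V j + V (j - 1)) x * ζ x := by
    refine integrable_mul_of_bound (measurable_cellFun _ _) (C := 4 * M ^ m) (fun x => ?_)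
      hζ.continuous hc
    have b1 := abs_le.1 (hVb (⌊x / h N⌋ + 1))
    have b2 := abs_le.1 (hVb ⌊x / h N⌋)
    have b3 := abs_le.1 (hVb (⌊x / h N⌋ - 1))
    rw [cellFun, abs_le]
    constructor <;> linarith [b1.1, b1.2, b2.1, b2.2, b3.1, b3.2]
  have hζs : Continuous fun x => ζ (x + h N) - 2 * ζ x + ζ (x - h N) := by
    have := hζ.continuous
    fun_prop
  have j6 : Integrable fun x => cellFun (h N) V x * (ζ (x + h N) - 2 * ζ x + ζ (x - h N)) := by
    refine integrable_mul_of_bound (measurable_cellFun _ _) (fun x => hVb _) hζs ?_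
    have c1 := hc.comp_homeomorph (Homeomorph.addRight (h N))
    have c2 := hc.comp_homeomorph (Homeomorph.subRight (h N))
    exact (c1.sub (hc.mul_left (f := fun _ => (2 : ℝ)))).add c2
  have key : (∫ x, cellFun (h N) (U N (n + 1)) x * ζ x) - (∫ x, cellFun (h N) (U N n) x * ζ x)
        - k N * weakRate m f u ζ t =
      (∫ x, (U N (n + 1) ⌊x / h N⌋ - U N n ⌊x / h N⌋ - k N / h N ^ 2 *
        (V (⌊x / h N⌋ + 1) - 2 * V ⌊x / h N⌋ + V (⌊x / h N⌋ - 1)) - k N * f (x, t, u x t)) * ζ x)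
      + ∫ x, (k N / h N ^ 2 * (cellFun (h N) V x * (ζ (x + h N) - 2 * ζ x + ζ (x - h N)))
        - k N * (u x t ^ m * deriv (deriv ζ) x)) := by
    have i1 := integral_cellFun_second_diff hp hVb hζ.continuous hc
    have l1 : ∀ x, (U N (n + 1) ⌊x / h N⌋ - U N n ⌊x / h N⌋ - k N / h N ^ 2 *
        (V (⌊x / h N⌋ + 1) - 2 * V ⌊x / h N⌋ + V (⌊x / h N⌋ - 1)) - k N * f (x, t, u x t)) * ζ x
      = (cellFun (h N) (U N (n + 1)) x * ζ x - cellFun (h N) (U N n) x * ζ x)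
        - (k N / h N ^ 2 * (cellFun (h N) (fun j => V (j + 1) - 2 * V j + V (j - 1)) x * ζ x)
        + k N * (f (x, t, u x t) * ζ x)) := fun x => by simp only [cellFun]; ring
    simp_rw [l1]
    have j12 : Integrable fun x => cellFun (h N) (U N (n + 1)) x * ζ x
      - cellFun (h N) (U N n) x * ζ x := j1.sub j2
    have j5' := j5.const_mul (k N / h N ^ 2)
    have j4' := j4.const_mul (k N)
    have j54 : Integrable fun x => k N / h N ^ 2 *
      (cellFun (h N) (fun j => V (j + 1) - 2 * V j + V (j - 1)) x * ζ x)
        + k N * (f (x, t, u x t) * ζ x) := j5'.add j4'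
    rw [integral_sub j12 j54, integral_sub j1 j2, integral_add j5' j4',
      integral_sub (j6.const_mul _) (j3.const_mul _), weakRate, integral_add j3 j4]
    simp only [integral_const_mul]
    rw [i1]
    ring
  have b1 : |∫ x, (U N (n + 1) ⌊x / h N⌋ - U N n ⌊x / h N⌋ - k N / h N ^ 2 *
        (V (⌊x / h N⌋ + 1) - 2 * V ⌊x / h N⌋ + V (⌊x / h N⌋ - 1)) - k N * f (x, t, u x t)) * ζ x|
      ≤ k N * (2 * ε') * Z * (2 * (R + 1)) := by
    refine abs_integral_le_of_support (by positivity) (fun x hx => ?_) fun x hx => ?_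
    · rw [hR1 x (by linarith), mul_zero]
    · rw [abs_mul]
      refine mul_le_mul ?_ (hZa x) (abs_nonneg _) (by positivity)
      have c1 := H.consistent N n ⌊x / h N⌋ hnτ
      have c2 : |k N * (f (⌊x / h N⌋ * h N, n * k N, U N n ⌊x / h N⌋) - f (x, t, u x t))|
          ≤ k N * ε' := by
        rw [abs_mul, abs_of_pos kp]
        exact mul_le_mul_of_nonneg_left (a1 x hx) kp.le
      have c3 : k N * e N ≤ k N * ε' := mul_le_mul_of_nonneg_left a5.le kp.le
      have c4 := abs_add_le _ _ |>.trans (add_le_add c1 c2)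
      refine le_trans (le_of_eq ?_) (c4.trans (by linarith))
      congr 1
      simp only [hVdef]
      ring
  have b2 : |∫ x, (k N / h N ^ 2 * (cellFun (h N) V x * (ζ (x + h N) - 2 * ζ x + ζ (x - h N)))
        - k N * (u x t ^ m * deriv (deriv ζ) x))| ≤
        k N * (M ^ m * ε' + ε' * Z) * (2 * (R + 1)) := by
    refine abs_integral_le_of_support (by positivity) (fun x hx => ?_) fun x hx => ?_
    · have d1 : R < |x + h N| := by
        have := abs_sub_abs_le_abs_sub x (-h N)
        rw [abs_neg, abs_of_pos hp, sub_neg_eq_add] at this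
        linarith
      have d2 : R < |x - h N| := by
        have := abs_sub_abs_le_abs_sub x (h N)
        rw [abs_of_pos hp] at this
        linarith
      rw [hR1 _ d1, hR1 _ d2, hR1 x (by linarith), hR2 x (by linarith)]
      ring
    · rw [show k N / h N ^ 2 * (cellFun (h N) V x * (ζ (x + h N) - 2 * ζ x + ζ (x - h N)))
        - k N * (u x t ^ m * deriv (deriv ζ) x) = k N * (V ⌊x / h N⌋ *
          ((ζ (x + h N) - 2 * ζ x + ζ (x - h N)) / h N ^ 2 - deriv (deriv ζ) x)
          + (V ⌊x / h N⌋ - u x t ^ m) * deriv (deriv ζ) x) by rw [cellFun]; ring,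
        abs_mul, abs_of_pos kp]
      refine mul_le_mul_of_nonneg_left ((abs_add_le _ _).trans (add_le_add ?_ ?_)) kp.le
      · rw [abs_mul]
        exact mul_le_mul (hVb _) (hδ' _ hp a3 x) (abs_nonneg _) hMm
      · rw [abs_mul]
        exact mul_le_mul (a2 x hx) (hZb x) (abs_nonneg _) hε'.le
  rw [key]
  refine (abs_add_le _ _).trans ((add_le_add b1 b2).trans ?_)
  have := mul_le_mul_of_nonneg_left hεε' kp.le
  refine le_trans (le_of_eq ?_) this
  ring

end Limit

section Limit

variable {m M C₁ C₂ τ : ℝ} {h k e : ℕ → ℝ} {f : ℝ × ℝ × ℝ → ℝ} {U : ℕ → ℕ → ℤ → ℝ}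
  {𝒰 : Ultrafilter ℕ} {u : ℝ → ℝ → ℝ}

lemma IsConsistentScheme.tendsto_integral (H : IsConsistentScheme m M C₁ C₂ τ h k e f U)
    (hm : 0 < m) (hτ : 0 ≤ τ) (hC₁ : 0 ≤ C₁) (hC₂ : 0 ≤ C₂) (h𝒰 : (𝒰 : Filter ℕ) ≤ atTop)
    (hu : ∀ x t, Tendsto (fun N => gridFun (h N) (k N) τ (U N) x t) 𝒰 (𝓝 (u x t)))
    {ζ : ℝ → ℝ} (hζ : Continuous ζ) (hc : HasCompactSupport ζ) (t : ℝ) :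
    Tendsto (fun N => ∫ x, gridFun (h N) (k N) τ (U N) x t * ζ x) 𝒰 (𝓝 (∫ x, u x t * ζ x)) := by
  obtain ⟨R, hR, hR1, -⟩ := exists_support_bound hc
  obtain ⟨Z, hZ⟩ := hc.exists_bound_of_continuous hζ
  have hZ0 : 0 ≤ Z := (norm_nonneg _).trans (hZ 0)
  have hucont := H.continuous_limit hm hτ hC₁ hC₂ h𝒰 hu
  rw [Metric.tendsto_nhds]
  intro ε hε
  have hε' : 0 < ε / (Z * (2 * R) + 1) := by positivity
  have hun := Metric.tendstoUniformlyOn_iff.1 (H.uniform_limit hm hτ hC₁ hC₂ h𝒰 hu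
    (isCompact_Icc.prod isCompact_singleton : IsCompact (Icc (-R) R ×ˢ {t}))).1 _ hε'
  filter_upwards [hun] with N hN
  have j1 : Integrable fun x => gridFun (h N) (k N) τ (U N) x t * ζ x :=
    integrable_mul_of_bound (measurable_cellFun (h N) _) (C := M) (fun x => by
      have := H.gridFun_mem hτ N x t
      exact (abs_of_nonneg this.1).le.trans this.2) hζ hc
  have j2 : Integrable fun x => u x t * ζ x :=
    ((hucont.comp (Continuous.prodMk_left t)).mul hζ).integrable_of_hasCompactSupport hc.mul_left
  rw [Real.dist_eq, ← integral_sub j1 j2]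
  refine (abs_integral_le_of_support (c := ε / (Z * (2 * R) + 1) * Z) hR (fun x hx => ?_)
    fun x hx => ?_).trans_lt ?_
  · rw [hR1 x hx]; ring
  · rw [← sub_mul, abs_mul]
    refine mul_le_mul ?_ (hZ x) (abs_nonneg _) hε'.le
    have := hN (x, t) ⟨abs_le.1 hx, rfl⟩
    rw [dist_comm] at this
    exact this.le
  · rw [mul_assoc, div_mul_eq_mul_div, div_lt_iff₀ (by positivity)]
    nlinarith

lemma IsConsistentScheme.abs_integral_sub_le (H : IsConsistentScheme m M C₁ C₂ τ h k e f U)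
    (hm : 0 < m) (hM : 0 ≤ M) (hC₁ : 0 ≤ C₁) (hC₂ : 0 ≤ C₂)
    (h𝒰 : (𝒰 : Filter ℕ) ≤ atTop)
    (hu : ∀ x t, Tendsto (fun N => gridFun (h N) (k N) τ (U N) x t) 𝒰 (𝓝 (u x t)))
    (hf : Continuous f) {ζ : ℝ → ℝ} (hζ : ContDiff ℝ 2 ζ) (hc : HasCompactSupport ζ)
    {s t c b : ℝ} (hs : 0 ≤ s) (hst : s ≤ t) (htτ : t ≤ τ)
    (hG : ∀ r ∈ Icc s t, |weakRate m f u ζ r - c| ≤ b) :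
    |(∫ x, u x t * ζ x) - (∫ x, u x s * ζ x) - (t - s) * c| ≤ (t - s) * b := by
  have hτ : 0 ≤ τ := by linarith
  have hb : 0 ≤ b := (abs_nonneg _).trans (hG s (left_mem_Icc.2 hst))
  have ht := H.tendsto_integral hm hτ hC₁ hC₂ h𝒰 hu hζ.continuous hc t
  have hs' := H.tendsto_integral hm hτ hC₁ hC₂ h𝒰 hu hζ.continuous hc s
  have hk := H.k_tendsto.mono_left h𝒰
  have hfl : ∀ r, 0 ≤ r → Tendsto (fun N => (⌊r / k N⌋₊ : ℝ) * k N) 𝒰 (𝓝 r) := by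
    intro r hr
    refine tendsto_of_tendsto_of_tendsto_of_le_of_le (g := fun N => r - k N) (h := fun _ => r)
      (by simpa using tendsto_const_nhds.sub hk) tendsto_const_nhds (fun N => ?_) fun N => ?_
    · have := (natFloor_mul_mem hr (H.k_pos N)).2
      simp only; linarith
    · exact (natFloor_mul_mem hr (H.k_pos N)).1
  have hd := (hfl t (hs.trans hst)).sub (hfl s hs)
  refine le_of_forall_pos_le_add fun ε hε => ?_
  obtain ⟨ε', hε', hεε'⟩ : ∃ ε' > 0, (t - s) * ε' ≤ ε := by
    refine ⟨ε / (t - s + 1), by have : 0 < t - s + 1 := by linarith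
                                positivity, ?_⟩
    rw [mul_div_assoc', div_le_iff₀ (by linarith)]
    nlinarith
  suffices hsuff : |(∫ x, u x t * ζ x) - (∫ x, u x s * ζ x) - (t - s) * c|
      ≤ (t - s) * (b + ε') by linarith
  refine le_of_tendsto_of_tendsto ((ht.sub hs').sub (hd.mul_const c)).abs (hd.mul_const (b + ε')) ?_
  filter_upwards [H.step_estimate hm hM hτ hC₁ hC₂ h𝒰 hu hf hζ hc hε'] with N hN
  have kp := H.k_pos N
  have fs := natFloor_mul_mem hs kp
  have ft := natFloor_mul_mem (hs.trans hst) kp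
  have cs : clampTime τ s = s := clampTime_of_mem ⟨hs, hst.trans htτ⟩
  have ct : clampTime τ t = t := clampTime_of_mem ⟨hs.trans hst, htτ⟩
  have hle : ⌊s / k N⌋₊ ≤ ⌊t / k N⌋₊ := Nat.floor_le_floor (by gcongr)
  have ind : ∀ n, ⌊s / k N⌋₊ ≤ n → n ≤ ⌊t / k N⌋₊ →
      |(∫ x, cellFun (h N) (U N n) x * ζ x) - (∫ x, cellFun (h N) (U N ⌊s / k N⌋₊) x * ζ x)
        - (n * k N - ⌊s / k N⌋₊ * k N) * c| ≤ (n * k N - ⌊s / k N⌋₊ * k N) * (b + ε') := by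
    intro n hn
    induction n, hn using Nat.le_induction with
    | base => simp
    | succ n hn ih =>
      intro hnt
      have ih := ih (by omega)
      have hn1 : (⌊s / k N⌋₊ : ℝ) ≤ n := by exact_mod_cast hn
      have hn2 : ((n : ℝ) + 1) ≤ ⌊t / k N⌋₊ := by exact_mod_cast hnt
      have hn3 : ((n : ℝ) + 1) * k N ≤ t := le_trans (by gcongr) ft.1
      have hsn : s < ((n : ℝ) + 1) * k N := fs.2.trans_le (by gcongr)
      have step := hN n (max s (n * k N)) (le_max_right _ _)
        (max_lt hsn (by linarith)) (hn3.trans htτ)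
      have hGr := hG (max s (n * k N)) ⟨le_max_left _ _, max_le hst (by linarith)⟩
      have hGr' := mul_le_mul_of_nonneg_left hGr kp.le
      rw [← abs_of_pos kp, ← abs_mul, abs_of_pos kp] at hGr'
      push_cast
      rw [abs_le] at step ih hGr' ⊢
      constructor <;> linarith [step.1, step.2, ih.1, ih.2, hGr'.1, hGr'.2]
  have := ind _ hle le_rfl
  simpa only [gridFun, cs, ct, cellFun] using this

lemma continuous_weakRate (hm : 0 < m) (hu : Continuous (Function.uncurry u)) (hf : Continuous f)
    {ζ : ℝ → ℝ} (hζ : ContDiff ℝ 2 ζ) (hc : HasCompactSupport ζ) :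
    Continuous (weakRate m f u ζ) := by
  obtain ⟨R, hR, hR1, hR2⟩ := exists_support_bound hc
  have hζ2 := continuous_deriv_deriv hζ
  have hcont : Continuous fun z : ℝ × ℝ => u z.2 z.1 ^ m * deriv (deriv ζ) z.2
      + f (z.2, z.1, u z.2 z.1) * ζ z.2 := by
    have h1 : Continuous fun z : ℝ × ℝ => u z.2 z.1 := hu.comp continuous_swap
    have h2 : Continuous fun z : ℝ × ℝ => u z.2 z.1 ^ m :=
      (Real.continuous_rpow_const hm.le).comp h1
    have h3 : Continuous fun z : ℝ × ℝ => f (z.2, z.1, u z.2 z.1) := hf.comp (by fun_prop)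
    have := hζ.continuous
    fun_prop
  have e : weakRate m f u ζ = fun t => ∫ x in Icc (-R) R, (u x t ^ m * deriv (deriv ζ) x
      + f (x, t, u x t) * ζ x) := by
    ext t
    refine (setIntegral_eq_integral_of_forall_compl_eq_zero fun x hx => ?_).symm
    have hx' : R < |x| := by
      by_contra hx'
      exact hx (abs_le.1 (not_lt.1 hx'))
    rw [hR1 x hx', hR2 x hx']
    ring
  rw [e]
  exact continuous_parametric_integral_of_continuous hcont isCompact_Icc

theorem IsConsistentScheme.hasDerivAt_integral (H : IsConsistentScheme m M C₁ C₂ τ h k e f U)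
    (hm : 0 < m) (hM : 0 ≤ M) (hC₁ : 0 ≤ C₁) (hC₂ : 0 ≤ C₂) (h𝒰 : (𝒰 : Filter ℕ) ≤ atTop)
    (hu : ∀ x t, Tendsto (fun N => gridFun (h N) (k N) τ (U N) x t) 𝒰 (𝓝 (u x t)))
    (hf : Continuous f) {ζ : ℝ → ℝ} (hζ : ContDiff ℝ 2 ζ) (hc : HasCompactSupport ζ)
    {t : ℝ} (ht : t ∈ Ioo 0 τ) :
    HasDerivAt (fun t => ∫ x, u x t * ζ x) (weakRate m f u ζ t) t := by
  have hτ : 0 ≤ τ := (ht.1.trans ht.2).le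
  have hG := continuous_weakRate hm (H.continuous_limit hm hτ hC₁ hC₂ h𝒰 hu) hf hζ hc
  rw [hasDerivAt_iff_isLittleO, Asymptotics.isLittleO_iff]
  intro ε hε
  obtain ⟨δ, hδ, hδ'⟩ := Metric.continuous_iff.1 hG t ε hε
  filter_upwards [Metric.ball_mem_nhds t hδ, Ioo_mem_nhds ht.1 ht.2] with r hr hr'
  rw [Metric.mem_ball, Real.dist_eq, abs_lt] at hr
  rw [smul_eq_mul, Real.norm_eq_abs, Real.norm_eq_abs]
  rcases le_total t r with htr | htr
  · rw [abs_of_nonneg (sub_nonneg.2 htr), mul_comm ε]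
    refine H.abs_integral_sub_le hm hM hC₁ hC₂ h𝒰 hu hf hζ hc ht.1.le htr hr'.2.le fun y hy => ?_
    exact (hδ' y (by rw [Real.dist_eq, abs_lt]; constructor <;> linarith [hy.1, hy.2])).le
  · rw [abs_of_nonpos (sub_nonpos.2 htr), neg_sub, mul_comm ε]
    have := H.abs_integral_sub_le (b := ε) (c := weakRate m f u ζ t) hm hM hC₁ hC₂ h𝒰 hu hf hζ hc
      hr'.1.le htr ht.2.le fun y hy =>
        (hδ' y (by rw [Real.dist_eq, abs_lt]; constructor <;> linarith [hy.1, hy.2])).le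
    rw [← abs_neg]
    convert this using 2
    ring

end Limit

/-! ### Monotone limits of continuous approximate solutions -/

/-- An increasing sequence of bounded continuous solutions of
`∂ₜ v = ∂ₓₓ (v ^ m) + f i (x, t, v)`, tested against functions of `x` only. -/
structure IsMonotoneApprox (m M C τ : ℝ) (f : ℕ → ℝ × ℝ × ℝ → ℝ) (v : ℕ → ℝ → ℝ → ℝ) : Prop where
  continuous : ∀ i, Continuous (Function.uncurry (v i))
  mono : ∀ x t, Monotone fun i => v i x t
  nonneg : ∀ i x t, 0 ≤ v i x t
  le_bound : ∀ i x t, v i x t ≤ M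
  source_continuous : ∀ i, Continuous (f i)
  source_bound : ∀ i x t, |f i (x, t, v i x t)| ≤ C
  hasDerivAt : ∀ i (ζ : ℝ → ℝ), ContDiff ℝ 2 ζ → HasCompactSupport ζ → ∀ t ∈ Ioo 0 τ,
    HasDerivAt (fun t => ∫ x, v i x t * ζ x) (weakRate m (f i) (v i) ζ t) t

/-- The partial derivative in the first variable of a smooth function is smooth. -/
lemma contDiff_partial_left {η : ℝ → ℝ → ℝ} (hη : ContDiff ℝ (⊤ : ℕ∞) (Function.uncurry η)) :
    ContDiff ℝ (⊤ : ℕ∞) (Function.uncurry fun x s => deriv (fun y => η y s) x) := by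
  have e : (Function.uncurry fun x s => deriv (fun y => η y s) x)
      = fun z => fderiv ℝ (Function.uncurry η) z (1, 0) := by
    ext ⟨x, s⟩
    have h1 := (hη.differentiable (by simp) (x, s)).hasFDerivAt
    have h2 : HasDerivAt (fun y : ℝ => (y, s)) (1, 0) x :=
      (hasDerivAt_id x).prodMk (hasDerivAt_const x s)
    exact (h1.comp_hasDerivAt x h2).deriv
  rw [e]
  exact (hη.fderiv_right (by simp)).clm_apply contDiff_const

/-- The partial derivative in the second variable of a smooth function is smooth. -/
lemma contDiff_partial_right {η : ℝ → ℝ → ℝ} (hη : ContDiff ℝ (⊤ : ℕ∞) (Function.uncurry η)) :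
    ContDiff ℝ (⊤ : ℕ∞) (Function.uncurry fun x s => deriv (η x) s) := by
  have e : (Function.uncurry fun x s => deriv (η x) s)
      = fun z => fderiv ℝ (Function.uncurry η) z (0, 1) := by
    ext ⟨x, s⟩
    have h1 := (hη.differentiable (by simp) (x, s)).hasFDerivAt
    have h2 : HasDerivAt (fun y : ℝ => (x, y)) (0, 1) s :=
      (hasDerivAt_const s x).prodMk (hasDerivAt_id s)
    exact (h1.comp_hasDerivAt s h2).deriv
  rw [e]
  exact (hη.fderiv_right (by simp)).clm_apply contDiff_const

/-- A test function together with uniform bounds for the derivatives in the weak formulation. -/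
lemma IsTestFn1.exists_bounds {τ : ℝ} {η : ℝ → ℝ → ℝ} (hη : IsTestFn1 τ η) :
    ∃ R Z : ℝ, 0 ≤ R ∧ 0 ≤ Z ∧ (∀ x s, R < |x| → η x s = 0 ∧ deriv (η x) s = 0 ∧
        deriv (deriv fun y => η y s) x = 0) ∧
      ∀ x, ∀ s ∈ Icc 0 τ, |η x s| ≤ Z ∧ |deriv (η x) s| ≤ Z ∧
        |deriv (deriv fun y => η y s) x| ≤ Z := by
  obtain ⟨h1, h2, -⟩ := hη
  obtain ⟨R, hR⟩ := h2.isCompact.isBounded.subset_closedBall (0 : ℝ × ℝ)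
  have hz : ∀ x s, max R 0 < |x| → η x s = 0 := fun x s hx => by
    by_contra hne
    have := hR (subset_tsupport (Function.uncurry η) (show (x, s) ∈ Function.support _ from hne))
    rw [Metric.mem_closedBall, dist_zero_right] at this
    have h3 : |x| ≤ ‖((x, s) : ℝ × ℝ)‖ := norm_fst_le (x, s)
    linarith [le_max_left R 0]
  have hev : ∀ x, max R 0 < |x| → ∀ᶠ y in 𝓝 x, max R 0 < |y| := fun x hx =>
    (continuous_abs.tendsto x).eventually_const_lt hx
  have hz' : ∀ x s, max R 0 < |x| → η x s = 0 ∧ deriv (η x) s = 0 ∧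
        deriv (deriv fun y => η y s) x = 0 := by
    intro x s hx
    refine ⟨hz x s hx, ?_, ?_⟩
    · rw [show η x = fun _ => 0 from funext fun s => hz x s hx]
      simp
    · have e1 : (fun y => η y s) =ᶠ[𝓝 x] fun _ => 0 := (hev x hx).mono fun y hy => hz y s hy
      have e2 := e1.deriv.deriv
      rw [e2.eq_of_nhds]
      simp
  have c1 := contDiff_partial_right h1
  have c2 := contDiff_partial_left (contDiff_partial_left h1)
  have hK : IsCompact (Icc (-max R 0) (max R 0) ×ˢ Icc 0 τ) := isCompact_Icc.prod isCompact_Icc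
  obtain ⟨Z₀, hZ₀⟩ := hK.exists_bound_of_continuousOn h1.continuous.continuousOn
  obtain ⟨Z₁, hZ₁⟩ := hK.exists_bound_of_continuousOn c1.continuous.continuousOn
  obtain ⟨Z₂, hZ₂⟩ := hK.exists_bound_of_continuousOn c2.continuous.continuousOn
  have hZ : 0 ≤ max 0 (max Z₀ (max Z₁ Z₂)) := le_max_left _ _
  refine ⟨max R 0, max 0 (max Z₀ (max Z₁ Z₂)), le_max_right _ _, hZ, hz', fun x s hs => ?_⟩
  by_cases hx : max R 0 < |x|
  · obtain ⟨a, b, c⟩ := hz' x s hx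
    rw [a, b, c, abs_zero]
    exact ⟨hZ, hZ, hZ⟩
  · have hmem : (x, s) ∈ Icc (-max R 0) (max R 0) ×ˢ Icc 0 τ := ⟨abs_le.1 (not_lt.1 hx), hs⟩
    have hmax := le_max_right 0 (max Z₀ (max Z₁ Z₂))
    exact ⟨(hZ₀ _ hmem).trans ((le_max_left _ _).trans hmax),
      (hZ₁ _ hmem).trans ((le_max_left _ _).trans ((le_max_right _ _).trans hmax)),
      (hZ₂ _ hmem).trans ((le_max_right _ _).trans ((le_max_right _ _).trans hmax))⟩

lemma continuous_integral_of_support {g : ℝ → ℝ → ℝ} (hg : Continuous (Function.uncurry g)) {R : ℝ}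
    (hR : ∀ x s, R < |x| → g x s = 0) : Continuous fun s => ∫ x, g x s := by
  have e : (fun s => ∫ x, g x s) = fun s => ∫ x in Icc (-R) R, g x s := by
    ext s
    refine (setIntegral_eq_integral_of_forall_compl_eq_zero fun x hx => hR x s ?_).symm
    by_contra hx'
    exact hx (abs_le.1 (not_lt.1 hx'))
  rw [e]
  exact continuous_parametric_integral_of_continuous (f := fun s x => g x s)
    (show Continuous fun z : ℝ × ℝ => g z.2 z.1 from hg.comp continuous_swap) isCompact_Icc

lemma integrable_of_support {g : ℝ → ℝ} (hg : Continuous g) {R : ℝ}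
    (hR : ∀ x, R < |x| → g x = 0) : Integrable g :=
  hg.integrable_of_hasCompactSupport (HasCompactSupport.intro (K := Icc (-R) R) isCompact_Icc
    fun x hx => hR x (by
      by_contra hx'
      exact hx (abs_le.1 (not_lt.1 hx'))))

/-- Dominated convergence on a fixed bounded interval. -/
lemma tendsto_integral_of_support {ι : Type*} {l : Filter ι} [l.IsCountablyGenerated]
    {g : ι → ℝ → ℝ} {g' : ℝ → ℝ} {R C : ℝ}
    (hmeas : ∀ᶠ i in l, AEStronglyMeasurable (g i))
    (hR : ∀ᶠ i in l, ∀ x, R < |x| → g i x = 0) (hC : ∀ᶠ i in l, ∀ x, |g i x| ≤ C)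
    (hlim : ∀ x, Tendsto (fun i => g i x) l (𝓝 (g' x))) :
    Tendsto (fun i => ∫ x, g i x) l (𝓝 (∫ x, g' x)) := by
  refine tendsto_integral_filter_of_dominated_convergence ((Icc (-R) R).indicator fun _ => C)
    hmeas ?_ ((integrable_indicator_iff measurableSet_Icc).2 (by simp))
    (Eventually.of_forall hlim)
  filter_upwards [hR, hC] with i h1 h2
  refine Eventually.of_forall fun x => ?_
  by_cases hx : x ∈ Icc (-R) R
  · rw [indicator_of_mem hx]; exact h2 x
  · rw [indicator_of_notMem hx, h1 x (by
      by_contra hx'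
      exact hx (abs_le.1 (not_lt.1 hx'))), norm_zero]

lemma tendsto_integral_integral_of_support {g : ℕ → ℝ → ℝ → ℝ} {g' : ℝ → ℝ → ℝ} {R C t : ℝ}
    (hR0 : 0 ≤ R) (hg : ∀ i, Continuous (Function.uncurry (g i)))
    (hR : ∀ i x s, R < |x| → g i x s = 0) (hC : ∀ i x, ∀ s ∈ Ioo 0 t, |g i x s| ≤ C)
    (hlim : ∀ x, ∀ s ∈ Ioo 0 t, Tendsto (fun i => g i x s) atTop (𝓝 (g' x s))) :
    Tendsto (fun i => ∫ s in Ioo 0 t, ∫ x, g i x s) atTop (𝓝 (∫ s in Ioo 0 t, ∫ x, g' x s)) := by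
  refine tendsto_integral_of_dominated_convergence (fun _ => C * (2 * R))
    (fun i => (continuous_integral_of_support (hg i) (hR i)).aestronglyMeasurable)
    (integrable_const _) (fun i => ?_) ?_
  · refine (ae_restrict_iff' measurableSet_Ioo).2 (Eventually.of_forall fun s hs => ?_)
    exact abs_integral_le_of_support hR0 (fun x hx => hR i x s hx) fun x _ => hC i x s hs
  · refine (ae_restrict_iff' measurableSet_Ioo).2 (Eventually.of_forall fun s hs => ?_)
    refine tendsto_integral_of_support (R := R) (C := C)
      (Eventually.of_forall fun i => ?_) (Eventually.of_forall fun i x hx => hR i x s hx)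
      (Eventually.of_forall fun i x => hC i x s hs) fun x => hlim x s hs
    exact ((hg i).comp (Continuous.prodMk_left s)).aestronglyMeasurable

section MonotoneLimit

variable {m M C τ : ℝ} {f : ℕ → ℝ × ℝ × ℝ → ℝ} {v : ℕ → ℝ → ℝ → ℝ} {η : ℝ → ℝ → ℝ}

lemma IsTestFn1.hasDerivAt_right {τ : ℝ} (hη : IsTestFn1 τ η) (x s : ℝ) :
    HasDerivAt (η x) (deriv (η x) s) s :=
  ((hη.1.comp (contDiff_prodMk_right x)).differentiable (by simp) s).hasDerivAt

lemma IsMonotoneApprox.hasDerivAt_mul (H : IsMonotoneApprox m M C τ f v) (hm : 0 < m)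
    (hη : IsTestFn1 τ η) (i : ℕ) {t : ℝ} (ht : t ∈ Ioo 0 τ) :
    HasDerivAt (fun t => ∫ x, v i x t * η x t)
      ((∫ x, (v i x t * deriv (η x) t + v i x t ^ m * deriv (deriv fun y => η y t) x))
        + ∫ x, f i (x, t, v i x t) * η x t) t := by
  obtain ⟨R, Z, hR, hZ, hRη, hZη⟩ := hη.exists_bounds
  have hv := H.continuous i
  have hM : 0 ≤ M := (H.nonneg i 0 0).trans (H.le_bound i 0 0)
  have hηt : Continuous fun x => η x t := hη.1.continuous.comp (Continuous.prodMk_left t)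
  have hvt : ∀ s, Continuous fun x => v i x s := fun s => hv.comp (Continuous.prodMk_left s)
  have hηs : ∀ s, Continuous fun x => η x s := fun s =>
    hη.1.continuous.comp (Continuous.prodMk_left s)
  have hs : ContDiff ℝ 2 fun x => η x t :=
    by
    exact_mod_cast contDiff_infty.1 (hη.1.comp (contDiff_prodMk_left t)) 2
  have hc : HasCompactSupport fun x => η x t :=
    HasCompactSupport.intro (K := Icc (-R) R) isCompact_Icc fun x hx => (hRη x t (by
      by_contra hx'
      exact hx (abs_le.1 (not_lt.1 hx')))).1
  have d1 := H.hasDerivAt i _ hs hc t ht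
  have d2 : HasDerivAt (fun s => ∫ x, v i x s * (η x s - η x t))
      (∫ x, v i x t * deriv (η x) t) t := by
    rw [hasDerivAt_iff_tendsto_slope]
    have e : slope (fun s => ∫ x, v i x s * (η x s - η x t)) t
        = fun s => ∫ x, v i x s * slope (η x) t s := by
      ext s
      simp only [slope_def_field, sub_self, mul_zero, integral_zero, sub_zero]
      rw [← integral_div]
      congr 1
      ext x
      ring
    rw [e]
    refine tendsto_integral_of_support (R := R) (C := M * Z) ?_ ?_ ?_ fun x => ?_
    · refine Eventually.of_forall fun s => ?_
      simp only [slope_def_field]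
      exact ((hvt s).mul (((hηs s).sub hηt).div_const _)).aestronglyMeasurable
    · refine Eventually.of_forall fun s x hx => ?_
      rw [slope_def_field, (hRη x s hx).1, (hRη x t hx).1]
      simp
    · have : ∀ᶠ s in 𝓝[≠] t, s ∈ Icc 0 τ :=
        nhdsWithin_le_nhds (mem_of_superset (Ioo_mem_nhds ht.1 ht.2) Ioo_subset_Icc_self)
      filter_upwards [this, self_mem_nhdsWithin] with s hs hst x
      rw [abs_mul, abs_of_nonneg (H.nonneg i x s)]
      refine mul_le_mul (H.le_bound i x s) ?_ (abs_nonneg _) hM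
      have := (convex_Icc 0 τ).norm_image_sub_le_of_norm_hasDerivWithin_le (f := η x)
        (f' := deriv (η x)) (C := Z) (x := t) (y := s)
        (fun r _ => (hη.hasDerivAt_right x r).hasDerivWithinAt)
        (fun r hr => (hZη x r hr).2.1) (Ioo_subset_Icc_self ht) hs
      have hne : s - t ≠ 0 := sub_ne_zero.2 hst
      rw [slope_def_field, abs_div, div_le_iff₀ (abs_pos.2 hne)]
      exact this
    · have h1 : Tendsto (fun s => v i x s) (𝓝[≠] t) (𝓝 (v i x t)) :=
        ((hv.comp (Continuous.prodMk_right x)).tendsto t).mono_left nhdsWithin_le_nhds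
      exact h1.mul (hasDerivAt_iff_tendsto_slope.1 (hη.hasDerivAt_right x t))
  have hvm : Continuous fun x => v i x t ^ m :=
    (Real.continuous_rpow_const hm.le).comp (hvt t)
  have hft : Continuous fun x => f i (x, t, v i x t) := by
    have := H.source_continuous i
    have := hvt t
    fun_prop
  have i1 : Integrable fun x => v i x t ^ m * deriv (deriv fun y => η y t) x :=
    integrable_of_support (R := R) (hvm.mul (continuous_deriv_deriv hs)) fun x hx => by
      rw [(hRη x t hx).2.2, mul_zero]
  have i2 : Integrable fun x => f i (x, t, v i x t) * η x t :=
    integrable_of_support (R := R) (hft.mul hηt) fun x hx => by rw [(hRη x t hx).1, mul_zero]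
  have i3 : Integrable fun x => v i x t * deriv (η x) t :=
    integrable_of_support (R := R) ((hvt t).mul ((contDiff_partial_right hη.1).continuous.comp
      (Continuous.prodMk_left t))) fun x hx => by rw [(hRη x t hx).2.1, mul_zero]
  have e1 : (fun s => ∫ x, v i x s * η x s) = fun s =>
      (∫ x, v i x s * η x t) + ∫ x, v i x s * (η x s - η x t) := by
    ext s
    rw [← integral_add]
    · congr 1
      ext x
      ring
    · exact integrable_of_support (R := R) ((hvt s).mul hηt) fun x hx => by
        rw [(hRη x t hx).1, mul_zero]
    · exact integrable_of_support (R := R) ((hvt s).mul ((hηs s).sub hηt)) fun x hx => by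
        rw [(hRη x t hx).1, (hRη x s hx).1, sub_self, mul_zero]
  rw [e1]
  refine (d1.add d2).congr_deriv ?_
  rw [weakRate, integral_add i1 i2, integral_add i3 i1]
  ring

/-- Each approximant satisfies the weak formulation with its own source. -/
lemma IsMonotoneApprox.weak_identity (H : IsMonotoneApprox m M C τ f v) (hm : 0 < m)
    (hη : IsTestFn1 τ η) (i : ℕ) {t : ℝ} (ht : t ∈ Ioo 0 τ) :
    (∫ x, v i x t * η x t) + ∫ s in Ioo (0 : ℝ) t, ∫ x,
        (-(v i x s * deriv (η x) s) - v i x s ^ m * deriv (deriv fun y => η y s) x)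
      = ∫ s in Ioo (0 : ℝ) t, ∫ x, f i (x, s, v i x s) * η x s := by
  obtain ⟨R, Z, hR, hZ, hRη, hZη⟩ := hη.exists_bounds
  have hv := H.continuous i
  have c1 : Continuous fun s => ∫ x, v i x s * η x s :=
    continuous_integral_of_support (g := fun x s => v i x s * η x s) (R := R)
      (hv.mul hη.1.continuous) fun x s hx => by rw [(hRη x s hx).1, mul_zero]
  have c2 : Continuous fun s => ∫ x,
      (v i x s * deriv (η x) s + v i x s ^ m * deriv (deriv fun y => η y s) x) :=
    continuous_integral_of_support (R := R) (g := fun x s =>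
      v i x s * deriv (η x) s + v i x s ^ m * deriv (deriv fun y => η y s) x)
      ((hv.mul (contDiff_partial_right hη.1).continuous).add
      (((Real.continuous_rpow_const hm.le).comp hv).mul
        (contDiff_partial_left (contDiff_partial_left hη.1)).continuous)) fun x s hx => by
        rw [(hRη x s hx).2.1, (hRη x s hx).2.2]; ring
  have c3 : Continuous fun s => ∫ x, f i (x, s, v i x s) * η x s := by
    refine continuous_integral_of_support (R := R) (g := fun x s => f i (x, s, v i x s) * η x s)
      ?_ fun x s hx => by rw [(hRη x s hx).1, mul_zero]
    refine Continuous.mul (f := fun z : ℝ × ℝ => f i (z.1, z.2, v i z.1 z.2))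
      ((H.source_continuous i).comp ?_) hη.1.continuous
    exact continuous_fst.prodMk (continuous_snd.prodMk hv)
  have ftc := intervalIntegral.integral_eq_sub_of_hasDerivAt_of_le ht.1.le c1.continuousOn
    (fun s hs => H.hasDerivAt_mul hm hη i ⟨hs.1, hs.2.trans ht.2⟩)
    ((c2.add c3).intervalIntegrable 0 t)
  have z0 : ∫ x, v i x 0 * η x 0 = 0 := by
    simp [hη.2.2 _ 0 (by simp)]
  rw [z0, sub_zero, intervalIntegral.integral_add (c2.intervalIntegrable 0 t)
    (c3.intervalIntegrable 0 t), intervalIntegral.integral_of_le ht.1.le,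
    intervalIntegral.integral_of_le ht.1.le, integral_Ioc_eq_integral_Ioo,
    integral_Ioc_eq_integral_Ioo] at ftc
  have e : ∀ s, ∫ x, (-(v i x s * deriv (η x) s) - v i x s ^ m * deriv (deriv fun y => η y s) x)
      = -∫ x, (v i x s * deriv (η x) s + v i x s ^ m * deriv (deriv fun y => η y s) x) := by
    intro s
    rw [← integral_neg]
    congr 1
    ext x
    ring
  simp_rw [e]
  rw [integral_neg]
  linarith

/-- The monotone limit satisfies the weak formulation with the limiting source. -/
lemma IsMonotoneApprox.weak_identity_limit (H : IsMonotoneApprox m M C τ f v) (hm : 0 < m)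
    (hη : IsTestFn1 τ η) {w q : ℝ → ℝ → ℝ}
    (hw : ∀ x t, Tendsto (fun i => v i x t) atTop (𝓝 (w x t)))
    (hq : ∀ x, ∀ t ∈ Ioo 0 τ, Tendsto (fun i => f i (x, t, v i x t)) atTop (𝓝 (q x t)))
    {t : ℝ} (ht : t ∈ Ioo 0 τ) :
    (∫ x, w x t * η x t) + ∫ s in Ioo (0 : ℝ) t, ∫ x,
        (-(w x s * deriv (η x) s) - w x s ^ m * deriv (deriv fun y => η y s) x)
      = ∫ s in Ioo (0 : ℝ) t, ∫ x, q x s * η x s := by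
  obtain ⟨R, Z, hR, hZ, hRη, hZη⟩ := hη.exists_bounds
  have hM : 0 ≤ M := (H.nonneg 0 0 0).trans (H.le_bound 0 0 0)
  have hC : 0 ≤ C := (abs_nonneg _).trans (H.source_bound 0 0 0)
  have hsub : ∀ s ∈ Ioo 0 t, s ∈ Icc 0 τ := fun s hs => ⟨hs.1.le, (hs.2.trans ht.2).le⟩
  have t1 : Tendsto (fun i => ∫ x, v i x t * η x t) atTop (𝓝 (∫ x, w x t * η x t)) := by
    refine tendsto_integral_of_support (R := R) (C := M * Z) (Eventually.of_forall fun i => ?_)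
      (Eventually.of_forall fun i x hx => by rw [(hRη x t hx).1, mul_zero])
      (Eventually.of_forall fun i x => ?_) fun x => (hw x t).mul_const _
    · exact (((H.continuous i).comp (Continuous.prodMk_left t)).mul
        (hη.1.continuous.comp (Continuous.prodMk_left t))).aestronglyMeasurable
    · rw [abs_mul, abs_of_nonneg (H.nonneg i x t)]
      exact mul_le_mul (H.le_bound i x t) (hZη x t (Ioo_subset_Icc_self ht)).1 (abs_nonneg _) hM
  have t2 : Tendsto (fun i => ∫ s in Ioo (0 : ℝ) t, ∫ x, (-(v i x s * deriv (η x) s)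
        - v i x s ^ m * deriv (deriv fun y => η y s) x)) atTop (𝓝 (∫ s in Ioo (0 : ℝ) t, ∫ x,
        (-(w x s * deriv (η x) s) - w x s ^ m * deriv (deriv fun y => η y s) x))) := by
    refine tendsto_integral_integral_of_support (R := R) (C := M * Z + M ^ m * Z) hR
      (g := fun i x s => -(v i x s * deriv (η x) s)
        - v i x s ^ m * deriv (deriv fun y => η y s) x) (fun i => ?_)
      (fun i x s hx => by rw [(hRη x s hx).2.1, (hRη x s hx).2.2]; ring)
      (fun i x s hs => ?_) fun x s hs => ?_
    · exact ((H.continuous i).mul (contDiff_partial_right hη.1).continuous).neg.sub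
        (((Real.continuous_rpow_const hm.le).comp (H.continuous i)).mul
        (contDiff_partial_left (contDiff_partial_left hη.1)).continuous)
    · obtain ⟨-, b1, b2⟩ := hZη x s (hsub s hs)
      have hvm : 0 ≤ v i x s ^ m := Real.rpow_nonneg (H.nonneg i x s) m
      refine (abs_sub _ _).trans ?_
      rw [abs_neg, abs_mul, abs_mul, abs_of_nonneg (H.nonneg i x s), abs_of_nonneg hvm]
      exact add_le_add (mul_le_mul (H.le_bound i x s) b1 (abs_nonneg _) hM)
        (mul_le_mul (Real.rpow_le_rpow (H.nonneg i x s) (H.le_bound i x s) hm.le) b2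
          (abs_nonneg _) (Real.rpow_nonneg hM m))
    · exact ((hw x s).mul_const _).neg.sub
        ((((Real.continuous_rpow_const hm.le).tendsto _).comp (hw x s)).mul_const _)
  have t3 : Tendsto (fun i => ∫ s in Ioo (0 : ℝ) t, ∫ x, f i (x, s, v i x s) * η x s) atTop
      (𝓝 (∫ s in Ioo (0 : ℝ) t, ∫ x, q x s * η x s)) := by
    refine tendsto_integral_integral_of_support (R := R) (C := C * Z) hR
      (g := fun i x s => f i (x, s, v i x s) * η x s) (fun i => ?_)
      (fun i x s hx => by rw [(hRη x s hx).1, mul_zero])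
      (fun i x s hs => ?_) fun x s hs => (hq x s ⟨hs.1, hs.2.trans ht.2⟩).mul_const _
    · refine Continuous.mul (f := fun z : ℝ × ℝ => f i (z.1, z.2, v i z.1 z.2))
        ((H.source_continuous i).comp ?_) hη.1.continuous
      exact continuous_fst.prodMk (continuous_snd.prodMk (H.continuous i))
    · rw [abs_mul]
      exact mul_le_mul (H.source_bound i x s) (hZη x s (hsub s hs)).1 (abs_nonneg _) hC
  have := t1.add t2
  simp_rw [H.weak_identity hm hη _ ht] at this
  exact tendsto_nhds_unique this t3

end MonotoneLimit

section MonotoneLimit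

variable {m M C τ : ℝ} {f : ℕ → ℝ × ℝ × ℝ → ℝ} {v : ℕ → ℝ → ℝ → ℝ} {w : ℝ → ℝ → ℝ}

lemma IsMonotoneApprox.le_limit (H : IsMonotoneApprox m M C τ f v)
    (hw : ∀ x t, Tendsto (fun i => v i x t) atTop (𝓝 (w x t))) (i : ℕ) (x t : ℝ) :
    v i x t ≤ w x t := (H.mono x t).ge_of_tendsto (hw x t) i

lemma IsMonotoneApprox.limit_mem (H : IsMonotoneApprox m M C τ f v)
    (hw : ∀ x t, Tendsto (fun i => v i x t) atTop (𝓝 (w x t))) (x t : ℝ) : w x t ∈ Icc 0 M :=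
  isClosed_Icc.mem_of_tendsto (hw x t) (Eventually.of_forall fun i =>
    ⟨H.nonneg i x t, H.le_bound i x t⟩)

lemma IsMonotoneApprox.measurable_limit (H : IsMonotoneApprox m M C τ f v)
    (hw : ∀ x t, Tendsto (fun i => v i x t) atTop (𝓝 (w x t))) (t : ℝ) :
    Measurable fun x => w x t :=
  measurable_of_tendsto_metrizable
    (fun i => ((H.continuous i).comp (Continuous.prodMk_left t)).measurable)
    (tendsto_pi_nhds.2 fun x => hw x t)

lemma IsMonotoneApprox.exists_lipschitz (H : IsMonotoneApprox m M C τ f v) (hm : 0 < m)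
    (hw : ∀ x t, Tendsto (fun i => v i x t) atTop (𝓝 (w x t)))
    {ζ : ℝ → ℝ} (hζ : ContDiff ℝ 2 ζ) (hc : HasCompactSupport ζ) :
    ∃ L, ∀ s ∈ Icc 0 τ, ∀ t ∈ Icc 0 τ,
      |(∫ x, w x t * ζ x) - ∫ x, w x s * ζ x| ≤ L * |t - s| := by
  obtain ⟨R, hR, hR1, hR2⟩ := exists_support_bound hc
  obtain ⟨Z₁, hZ₁⟩ := hc.exists_bound_of_continuous hζ.continuous
  obtain ⟨Z₂, hZ₂⟩ := hc.deriv.deriv.exists_bound_of_continuous (continuous_deriv_deriv hζ)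
  have hM : 0 ≤ M := (H.nonneg 0 0 0).trans (H.le_bound 0 0 0)
  have hC : 0 ≤ C := (abs_nonneg _).trans (H.source_bound 0 0 0)
  have hrate : ∀ i t, |weakRate m (f i) (v i) ζ t| ≤ (M ^ m * Z₂ + C * Z₁) * (2 * R) := by
    intro i t
    refine abs_integral_le_of_support hR (fun x hx => by rw [hR1 x hx, hR2 x hx]; ring)
      fun x _ => (abs_add_le _ _).trans (add_le_add ?_ ?_)
    · rw [abs_mul, abs_of_nonneg (Real.rpow_nonneg (H.nonneg i x t) m)]
      exact mul_le_mul (Real.rpow_le_rpow (H.nonneg i x t) (H.le_bound i x t) hm.le) (hZ₂ x)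
        (abs_nonneg _) (Real.rpow_nonneg hM m)
    · rw [abs_mul]
      exact mul_le_mul (H.source_bound i x t) (hZ₁ x) (abs_nonneg _) hC
  have hcont : ∀ i, Continuous fun t => ∫ x, v i x t * ζ x := fun i =>
    continuous_integral_of_support (g := fun x s => v i x s * ζ x) (R := R)
      ((H.continuous i).mul (hζ.continuous.comp continuous_fst))
      fun x s hx => by rw [hR1 x hx, mul_zero]
  have happrox : ∀ i, ∀ s ∈ Icc 0 τ, ∀ t ∈ Icc 0 τ, s < t →
      |(∫ x, v i x t * ζ x) - ∫ x, v i x s * ζ x| ≤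
        (M ^ m * Z₂ + C * Z₁) * (2 * R) * |t - s| := by
    intro i s hs t ht hst
    obtain ⟨c, hc1, hc2⟩ := exists_hasDerivAt_eq_slope _ _ hst (hcont i).continuousOn
      fun r hr => H.hasDerivAt i ζ hζ hc r ⟨hs.1.trans_lt hr.1, hr.2.trans_le ht.2⟩
    have hts : 0 < t - s := sub_pos.2 hst
    have h1 := (eq_div_iff hts.ne').1 hc2
    rw [← h1, abs_mul]
    exact mul_le_mul_of_nonneg_right (hrate i c) (abs_nonneg _)
  have hlim : ∀ t, Tendsto (fun i => ∫ x, v i x t * ζ x) atTop (𝓝 (∫ x, w x t * ζ x)) := by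
    intro t
    refine tendsto_integral_of_support (R := R) (C := M * Z₁) (Eventually.of_forall fun i => ?_)
      (Eventually.of_forall fun i x hx => by rw [hR1 x hx, mul_zero])
      (Eventually.of_forall fun i x => ?_) fun x => (hw x t).mul_const _
    · exact (((H.continuous i).comp (Continuous.prodMk_left t)).mul
        hζ.continuous).aestronglyMeasurable
    · rw [abs_mul, abs_of_nonneg (H.nonneg i x t)]
      exact mul_le_mul (H.le_bound i x t) (hZ₁ x) (abs_nonneg _) hM
  refine ⟨(M ^ m * Z₂ + C * Z₁) * (2 * R), fun s hs t ht => ?_⟩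
  rcases lt_trichotomy s t with hst | rfl | hst
  · exact le_of_tendsto ((hlim t).sub (hlim s)).abs
      (Eventually.of_forall fun i => happrox i s hs t ht hst)
  · simp
  · rw [abs_sub_comm, abs_sub_comm t]
    exact le_of_tendsto ((hlim s).sub (hlim t)).abs
      (Eventually.of_forall fun i => happrox i t ht s hs hst)

/-- The monotone limit is lower semicontinuous in time and its mass varies continuously, hence it
is continuous in time with values in `L¹_loc`. -/
lemma IsMonotoneApprox.tendsto_L1 (H : IsMonotoneApprox m M C τ f v) (hm : 0 < m)
    (hw : ∀ x t, Tendsto (fun i => v i x t) atTop (𝓝 (w x t)))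
    {K : Set ℝ} (hK : IsCompact K) {s : ℝ} (hs : s ∈ Icc 0 τ) :
    Tendsto (fun t => ∫ x in K, |w x t - w x s|) (𝓝[Icc 0 τ] s) (𝓝 0) := by
  obtain ⟨R, hR0, hR⟩ := hK.isBounded.subset_closedBall_lt 0 (0 : ℝ)
  let b : ContDiffBump (0 : ℝ) := ⟨R, R + 1, hR0, by linarith⟩
  have hb : ContDiff ℝ 2 b := b.contDiff
  have hbc : HasCompactSupport b := b.hasCompactSupport
  have hb0 : ∀ x, R + 1 < |x| → b x = 0 := fun x hx =>
    b.zero_of_le_dist (by simpa [Real.dist_eq] using hx.le)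
  have hmeas := H.measurable_limit hw
  have hbd : ∀ x t, |w x t - w x s| ≤ M := fun x t => by
    have h1 := H.limit_mem hw x t
    have h2 := H.limit_mem hw x s
    rw [abs_le]
    constructor <;> linarith [h1.1, h1.2, h2.1, h2.2]
  have hwb : ∀ t, Integrable fun x => w x t * b x := fun t =>
    integrable_mul_of_bound (hmeas t) (C := M) (fun x => by
      rw [abs_of_nonneg (H.limit_mem hw x t).1]; exact (H.limit_mem hw x t).2) hb.continuous hbc
  have habs : ∀ t, Integrable fun x => |w x t - w x s| * b x := fun t =>
    integrable_mul_of_bound ((hmeas t).sub (hmeas s)).abs (C := M)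
      (fun x => by rw [abs_abs]; exact hbd x t) hb.continuous hbc
  have hpos : ∀ t, Integrable fun x => max (w x s - w x t) 0 * b x := fun t =>
    integrable_mul_of_bound (((hmeas s).sub (hmeas t)).max measurable_const) (C := M)
      (fun x => by
        rw [abs_of_nonneg (le_max_right _ _)]
        refine max_le ?_ ((abs_nonneg _).trans (hbd x t))
        exact (le_abs_self _).trans ((abs_sub_comm _ _).trans_le (hbd x t))) hb.continuous hbc
  have hle : ∀ t, ∫ x in K, |w x t - w x s| ≤
      ((∫ x, w x t * b x) - ∫ x, w x s * b x) + 2 * ∫ x, max (w x s - w x t) 0 * b x := by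
    intro t
    have e1 : ((∫ x, w x t * b x) - ∫ x, w x s * b x) + 2 * ∫ x, max (w x s - w x t) 0 * b x
        = ∫ x, |w x t - w x s| * b x := by
      have hsub : Integrable fun x => w x t * b x - w x s * b x := (hwb t).sub (hwb s)
      rw [← integral_sub (hwb t) (hwb s), ← integral_const_mul, ← integral_add hsub
        ((hpos t).const_mul 2)]
      congr 1
      ext x
      rcases le_total (w x t) (w x s) with h | h
      · rw [abs_of_nonpos (by linarith), max_eq_left (by linarith)]; ring
      · rw [abs_of_nonneg (by linarith), max_eq_right (by linarith)]; ring
    rw [e1]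
    calc ∫ x in K, |w x t - w x s| = ∫ x in K, |w x t - w x s| * b x := by
          refine setIntegral_congr_fun hK.measurableSet fun x hx => ?_
          rw [b.one_of_mem_closedBall (hR hx), mul_one]
      _ ≤ ∫ x, |w x t - w x s| * b x := setIntegral_le_integral (habs t)
          (Eventually.of_forall fun x => mul_nonneg (abs_nonneg _) b.nonneg)
  obtain ⟨L, hL⟩ := H.exists_lipschitz hm hw hb hbc
  have t1 : Tendsto (fun t => (∫ x, w x t * b x) - ∫ x, w x s * b x) (𝓝[Icc 0 τ] s) (𝓝 0) := by
    rw [tendsto_zero_iff_abs_tendsto_zero]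
    refine squeeze_zero' (Eventually.of_forall fun t => abs_nonneg _)
      (g := fun t => L * |t - s|) (eventually_mem_nhdsWithin.mono fun t ht => hL s hs t ht) ?_
    have : Continuous fun t => L * |t - s| := by fun_prop
    simpa using (this.tendsto s).mono_left nhdsWithin_le_nhds
  have t2 : Tendsto (fun t => ∫ x, max (w x s - w x t) 0 * b x) (𝓝[Icc 0 τ] s) (𝓝 0) := by
    have := tendsto_integral_of_support (l := 𝓝[Icc 0 τ] s) (R := R + 1) (C := M)
      (g := fun t x => max (w x s - w x t) 0 * b x) (g' := fun _ => 0)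
      (Eventually.of_forall fun t => (hpos t).aestronglyMeasurable)
      (Eventually.of_forall fun t x hx => by rw [hb0 x hx, mul_zero])
      (Eventually.of_forall fun t x => ?_) fun x => ?_
    · simpa using this
    · have h0 : 0 ≤ max (w x s - w x t) 0 := le_max_right _ _
      rw [abs_mul, abs_of_nonneg h0, abs_of_nonneg b.nonneg]
      refine (mul_le_of_le_one_right h0 b.le_one).trans (max_le ?_ ((abs_nonneg _).trans (hbd x t)))
      exact (le_abs_self _).trans ((abs_sub_comm _ _).trans_le (hbd x t))
    · suffices h : Tendsto (fun t => max (w x s - w x t) 0) (𝓝[Icc 0 τ] s) (𝓝 0) by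
        simpa using h.mul_const (b x)
      rw [Metric.tendsto_nhds]
      intro ε hε
      obtain ⟨i, hi⟩ := (Metric.tendsto_nhds.1 (hw x s) (ε / 2) (by positivity)).exists
      have hc := ((H.continuous i).comp (Continuous.prodMk_right x)).tendsto s
      filter_upwards [(Metric.tendsto_nhds.1 hc (ε / 2) (by positivity)).filter_mono
        nhdsWithin_le_nhds] with t ht
      rw [Real.dist_eq, abs_lt] at hi ht
      simp only [Function.comp_apply, Function.uncurry_apply_pair] at ht
      rw [Real.dist_eq, sub_zero, abs_of_nonneg (le_max_right _ _)]
      exact max_lt (by linarith [hi.1, ht.1, H.le_limit hw i x t]) hε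
  refine squeeze_zero (fun t => integral_nonneg fun x => abs_nonneg _) hle ?_
  simpa using t1.add (t2.const_mul 2)

/-- A monotone limit of approximate solutions whose sources converge to `(1 + |x|) ^ σ * w ^ p` is
a weak solution. -/
theorem IsMonotoneApprox.isWeakSolution1 {p σ : ℝ} {u₀ : ℝ → ℝ}
    (H : IsMonotoneApprox m M C τ f v) (hm : 0 < m) (hτ : 0 < τ)
    (hw : ∀ x t, Tendsto (fun i => v i x t) atTop (𝓝 (w x t)))
    (hq : ∀ x, ∀ t ∈ Ioo 0 τ,
      Tendsto (fun i => f i (x, t, v i x t)) atTop (𝓝 ((1 + |x|) ^ σ * w x t ^ p)))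
    (h0 : ∀ x, w x 0 = u₀ x) : IsWeakSolution1 m p σ τ w u₀ where
  nonneg x t _ := (H.limit_mem hw x t).1
  timeContL1 K hK s hs := (H.tendsto_L1 hm hw hK (Ioo_subset_Icc_self hs)).mono_left
    (nhdsWithin_mono _ Ioo_subset_Icc_self)
  locBdd K _ a b _ _ := ⟨M, fun x _ t _ => (H.limit_mem hw x t).2⟩
  weakForm η hη t ht := H.weak_identity_limit hm hη hw hq ht
  initL1 K hK := by
    have := (H.tendsto_L1 hm hw hK (left_mem_Icc.2 hτ.le)).mono_left
      (nhdsWithin_mono _ (Ioo_subset_Icc_self (a := 0) (b := τ)))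
    simp_rw [h0] at this
    rwa [nhdsWithin_Ioo_eq_nhdsGT hτ] at this

end MonotoneLimit

/-! ### The regularised problem and its discretisation -/

/-- Data of the regularised equation `∂ₜ u = ∂ₓₓ (u ^ m) + a (x) max (H (x, t)) (g u)` with
initial datum `w`. -/
structure IsRegularData (m p M M₀ A L₀ T Lg CH κ : ℝ) (a : ℝ → ℝ) (H : ℝ → ℝ → ℝ)
    (g w : ℝ → ℝ) : Prop where
  one_lt_m : 1 < m
  p_pos : 0 < p
  p_lt_one : p < 1
  two_le : 2 ≤ m + p
  one_le_M : 1 ≤ M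
  T_pos : 0 < T
  T_le_one : T ≤ 1
  bound_le : M₀ + A * M ^ p * T ≤ M
  speed_le : waveSpeed m p M A * T ≤ 1
  L₀_nonneg : 0 ≤ L₀
  w_nonneg : ∀ x, 0 ≤ w x
  w_le : ∀ x, w x ≤ M₀
  w_eq_zero : ∀ x, L₀ ≤ |x| → w x = 0
  κ_nonneg : 0 ≤ κ
  semiconcave : ∀ x h, w (x + h) ^ m - 2 * w x ^ m + w (x - h) ^ m ≤ κ * h ^ 2
  one_le_a : ∀ x, 1 ≤ a x
  a_le : ∀ x, a x ≤ A
  H_nonneg : ∀ x t, 0 ≤ H x t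
  H_le_one : ∀ x, ∀ t ∈ Icc 0 T, H x t ≤ 1
  H_lipschitz : ∀ x, ∀ t ∈ Icc 0 T, ∀ s ∈ Icc 0 T, |H x t - H x s| ≤ CH * |t - s|
  CH_nonneg : 0 ≤ CH
  H_eq_zero : ∀ x t, L₀ ≤ |x| → H x t = 0
  g_mono : Monotone g
  g_zero : g 0 = 0
  g_le : ∀ s, 0 ≤ s → g s ≤ s ^ p
  Lg_nonneg : 0 ≤ Lg
  g_lipschitz : ∀ s s', |g s - g s'| ≤ Lg * |s - s'|

/-- The mesh ratio `k / h ^ 2`. -/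
def meshRatio (m M : ℝ) : ℝ := 1 / (2 * (m * M ^ (m - 1)))

/-- The source of the discretised regularised problem, with absorption away from the support of
the data. -/
def regSource (m p M L₀ : ℝ) (a : ℝ → ℝ) (H : ℝ → ℝ → ℝ) (g : ℝ → ℝ) (h : ℝ) (n : ℕ) (j : ℤ)
    (s : ℝ) : ℝ :=
  a (j * h) * max (H (j * h) ((n + 1) * (meshRatio m M * h ^ 2))) (g s)
    - if L₀ ≤ |j * h| then frontAbsorption m p h else 0

/-- The discrete solution of the regularised problem. -/
def regSol (m p M L₀ : ℝ) (a : ℝ → ℝ) (H : ℝ → ℝ → ℝ) (g w : ℝ → ℝ) (h : ℝ) : ℕ → ℤ → ℝ :=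
  fdSol (meshRatio m M) (meshRatio m M * h ^ 2) (truncPow m M) (regSource m p M L₀ a H g h)
    fun j => w (j * h)

section Regular

variable {m p M M₀ A L₀ T Lg CH κ h : ℝ} {a : ℝ → ℝ} {H : ℝ → ℝ → ℝ} {g w : ℝ → ℝ}

local notation "Usol" => regSol m p M L₀ a H g w h
local notation "kk" => meshRatio m M * h ^ 2

lemma regSol_succ (n : ℕ) (j : ℤ) : Usol (n + 1) j =
    fdStep (meshRatio m M) kk (truncPow m M) (regSource m p M L₀ a H g h n) (Usol n) j := rfl

namespace IsRegularData

variable (D : IsRegularData m p M M₀ A L₀ T Lg CH κ a H g w)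
include D

lemma m_pos : 0 < m := one_pos.trans D.one_lt_m
lemma M_pos : 0 < M := one_pos.trans_le D.one_le_M
lemma one_le_A : 1 ≤ A := (D.one_le_a 0).trans (D.a_le 0)
lemma A_pos : 0 < A := one_pos.trans_le D.one_le_A
lemma M₀_nonneg : 0 ≤ M₀ := (D.w_nonneg 0).trans (D.w_le 0)

lemma M₀_le : M₀ ≤ M := by
  have h1 := D.A_pos
  have h2 := D.M_pos
  have h3 := D.T_pos
  have : 0 ≤ A * M ^ p * T := by positivity
  linarith [D.bound_le]

lemma meshRatio_pos : 0 < meshRatio m M := by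
  have h1 := D.m_pos
  have h2 := D.M_pos
  unfold meshRatio; positivity

lemma cfl : 2 * meshRatio m M * (m * M ^ (m - 1)) ≤ 1 := by
  have h1 := D.m_pos
  have h2 := D.M_pos
  have h3 : 0 < M ^ (m - 1) := by positivity
  unfold meshRatio
  apply le_of_eq
  field_simp

lemma regSource_mono (n : ℕ) (j : ℤ) : Monotone (regSource m p M L₀ a H g h n j) := fun _ _ hs => by
  unfold regSource
  refine sub_le_sub_right (mul_le_mul_of_nonneg_left (max_le_max le_rfl (D.g_mono hs)) ?_) _
  exact zero_le_one.trans (D.one_le_a _)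

lemma step_mono (hh : 0 < h) {G : ℤ → ℝ → ℝ} {U U' : ℤ → ℝ} (n : ℕ)
    (hG : ∀ j, regSource m p M L₀ a H g h n j (U' j) ≤ G j (U' j)) (hU : ∀ j, U j ≤ U' j) (j : ℤ) :
    fdStep (meshRatio m M) kk (truncPow m M) (regSource m p M L₀ a H g h n) U j ≤
      fdStep (meshRatio m M) kk (truncPow m M) G U' j :=
  have h1 := D.meshRatio_pos
  fdStep_mono h1.le (by positivity) (truncPow_mono D.m_pos.le)
    (fun _ _ hab => truncPow_sub_le D.one_lt_m D.M_pos.le hab) D.cfl (D.regSource_mono n) hG hU j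

lemma regSol_nonneg (n : ℕ) (j : ℤ) : 0 ≤ Usol n j := by
  cases n with
  | zero => exact D.w_nonneg _
  | succ n => exact fdStep_nonneg _

lemma time_mem (hh : 0 < h) {n : ℕ} (hn : n * kk ≤ T) : (n * kk : ℝ) ∈ Icc 0 T := by
  have h1 := D.meshRatio_pos
  exact ⟨by positivity, hn⟩

lemma time_le_of_succ (hh : 0 < h) {n : ℕ} (hn : (n + 1) * kk ≤ T) : n * kk ≤ T := by
  have h1 := D.meshRatio_pos
  have : 0 < kk := by positivity
  nlinarith

lemma source_le (hh : 0 < h) {n : ℕ} (hn : (n + 1) * kk ≤ T) {s : ℝ} (j : ℤ) (hs : 0 ≤ s) :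
    a (j * h) * max (H (j * h) ((n + 1) * kk)) (g s) ≤ A * max 1 (s ^ p) := by
  have ht : ((n + 1) * kk : ℝ) ∈ Icc 0 T := by
    have := D.time_mem (h := h) hh (n := n + 1) (by push_cast; exact hn)
    push_cast at this; exact this
  refine mul_le_mul (D.a_le _) (max_le_max (D.H_le_one _ _ ht) (D.g_le _ hs)) ?_ D.A_pos.le
  exact (D.H_nonneg _ _).trans (le_max_left _ _)

lemma regSol_le (hh : 0 < h) {n : ℕ} (hn : n * kk ≤ T) (j : ℤ) :
    Usol n j ≤ M₀ + A * M ^ p * (n * kk) := by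
  have h1 := D.meshRatio_pos
  have hA := D.A_pos
  have hM := D.M_pos
  have hM₀ := D.M₀_nonneg
  have hp := D.p_pos
  induction n generalizing j with
  | zero => simpa [regSol, fdSol] using D.w_le _
  | succ n ih =>
    push_cast at hn ⊢
    have hn' := D.time_le_of_succ hh hn
    set c := M₀ + A * M ^ p * (n * kk) with hc
    have hc0 : 0 ≤ c := by positivity
    have hcM : c ≤ M := by
      refine le_trans ?_ D.bound_le
      rw [hc]; gcongr
    have hθ := frontAbsorption_nonneg (m := m) D.p_pos D.p_lt_one D.two_le hh.le
    have h2 := D.step_mono (U := Usol n) (U' := fun _ => c) (G := fun _ _ => A * M ^ p) hh n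
      (fun i => by
        have h3 := D.source_le hh hn i hc0
        have h4 : max 1 (c ^ p) ≤ M ^ p := max_le (Real.one_le_rpow D.one_le_M hp.le)
          (Real.rpow_le_rpow hc0 hcM hp.le)
        have h5 : A * max 1 (c ^ p) ≤ A * M ^ p := by gcongr
        have h6 : 0 ≤ if L₀ ≤ |(i : ℝ) * h| then frontAbsorption m p h else 0 := by
          split_ifs
          · exact hθ
          · exact le_rfl
        unfold regSource
        linarith) (ih hn') j
    rw [regSol_succ]
    refine h2.trans ?_
    unfold fdStep
    refine max_le (by positivity) ?_
    rw [hc]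
    apply le_of_eq
    ring

lemma regSol_le_M (hh : 0 < h) {n : ℕ} (hn : n * kk ≤ T) (j : ℤ) : Usol n j ≤ M := by
  refine (D.regSol_le hh hn j).trans (le_trans ?_ D.bound_le)
  have hA := D.A_pos
  have hM := D.M_pos
  gcongr

lemma truncPow_regSol (hh : 0 < h) {n : ℕ} (hn : n * kk ≤ T) (j : ℤ) :
    truncPow m M (Usol n j) = Usol n j ^ m :=
  truncPow_eq (D.regSol_nonneg n j) (D.regSol_le_M hh hn j)

/-- Comparison with travelling waves. -/
lemma regSol_le_wave (hh : 0 < h) (hh1 : h ≤ 1) {ε : ℝ} (hε : ε = 1 ∨ ε = -1) {n : ℕ}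
    (hn : n * kk ≤ T) (j : ℤ) :
    Usol n j ≤ waveProfile p (L₀ + M + waveSpeed m p M A * (n * kk) + ε * (j * h)) := by
  have h1 := D.meshRatio_pos
  have hk : 0 < kk := by positivity
  have hA := D.A_pos
  have hM := D.M_pos
  have hp := D.p_pos
  have hv : 0 ≤ waveSpeed m p M A := by
    have := waveConst_pos (m := m) D.p_pos D.p_lt_one D.two_le
    unfold waveSpeed; positivity
  have habs : ∀ i : ℤ, |(i : ℝ) * h| < L₀ → -L₀ ≤ ε * (i * h) := fun i hi => by
    rcases abs_lt.1 hi with ⟨h2, h3⟩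
    rcases hε with rfl | rfl <;> linarith
  induction n generalizing j with
  | zero =>
    simp only [Nat.cast_zero, zero_mul, mul_zero, add_zero]
    change w (j * h) ≤ _
    rcases lt_or_ge |(j : ℝ) * h| L₀ with hj | hj
    · have h3 : M ≤ L₀ + M + ε * (j * h) := by linarith [habs j hj]
      exact (D.w_le _).trans (D.M₀_le.trans (h3.trans
        (le_waveProfile hp D.p_lt_one (D.one_le_M.trans h3))))
    · rw [D.w_eq_zero _ hj]; exact waveProfile_nonneg _
  | succ n ih =>
    push_cast at hn ⊢
    have hn' := D.time_le_of_succ hh hn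
    set ξ : ℤ → ℝ := fun i => L₀ + M + waveSpeed m p M A * (n * kk) + ε * (i * h) with hξ
    have h2 := D.step_mono (U := Usol n) (U' := fun i => waveProfile p (ξ i))
      (G := regSource m p M L₀ a H g h n) hh n (fun i => le_rfl) (ih hn') j
    rw [regSol_succ]
    refine h2.trans (max_le (waveProfile_nonneg _) ?_)
    have h4 : 0 ≤ waveSpeed m p M A * (n * kk) := by positivity
    have hS := waveProfile_supersolution (lam := meshRatio m M) (ξ := ξ j)
      (S := regSource m p M L₀ a H g h n j (waveProfile p (ξ j))) D.one_lt_m hp D.p_lt_one D.two_le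
      D.one_le_M hA.le hh hh1 rfl hk ?_
    · have e1 : ξ j + waveSpeed m p M A * kk
          = L₀ + M + waveSpeed m p M A * ((n + 1) * kk) + ε * (j * h) := by
        rw [hξ]; ring
      rw [← e1]
      refine le_trans (le_of_eq ?_) hS
      beta_reduce
      rcases hε with rfl | rfl
      · have e2 : ξ (j + 1) = ξ j + h := by simp only [hξ]; push_cast; ring
        have e3 : ξ (j - 1) = ξ j - h := by simp only [hξ]; push_cast; ring
        rw [e2, e3]
      · have e2 : ξ (j + 1) = ξ j - h := by simp only [hξ]; push_cast; ring
        have e3 : ξ (j - 1) = ξ j + h := by simp only [hξ]; push_cast; ring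
        rw [e2, e3]; ring
    · rcases lt_or_ge |(j : ℝ) * h| L₀ with hj | hj
      · left
        have h3 : M ≤ ξ j := by simp only [hξ]; linarith [habs j hj]
        have h5 : 1 ≤ ξ j := D.one_le_M.trans h3
        refine ⟨h5, ?_⟩
        unfold regSource
        rw [if_neg (not_le.2 hj), sub_zero]
        refine (D.source_le hh hn j (waveProfile_nonneg _)).trans ?_
        rw [max_eq_right]
        exact Real.one_le_rpow (h5.trans (le_waveProfile hp D.p_lt_one h5)) hp.le
      · right
        unfold regSource
        rw [if_pos hj, D.H_eq_zero _ _ hj]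
        refine sub_le_sub_right (mul_le_mul (D.a_le _) (max_le (Real.rpow_nonneg
          (waveProfile_nonneg _) _) (D.g_le _ (waveProfile_nonneg _))) (le_max_left _ _) hA.le) _

lemma regSol_eq_zero (hh : 0 < h) (hh1 : h ≤ 1) {n : ℕ} (hn : n * kk ≤ T) {j : ℤ}
    (hj : L₀ + M + 1 ≤ |j * h|) : Usol n j = 0 := by
  refine le_antisymm ?_ (D.regSol_nonneg n j)
  have hv : 0 ≤ waveSpeed m p M A := by
    have := waveConst_pos (m := m) D.p_pos D.p_lt_one D.two_le
    have hM := D.M_pos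
    have hA := D.A_pos
    unfold waveSpeed; positivity
  have h3 : waveSpeed m p M A * (n * kk) ≤ 1 :=
    (mul_le_mul_of_nonneg_left hn hv).trans D.speed_le
  rcases le_abs.1 hj with h4 | h4
  · have := D.regSol_le_wave hh hh1 (Or.inr rfl) hn j
    rwa [waveProfile_of_nonpos D.p_lt_one (by linarith)] at this
  · have := D.regSol_le_wave hh hh1 (Or.inl rfl) hn j
    rwa [waveProfile_of_nonpos D.p_lt_one (by linarith)] at this

/-- A growing bump stays below the discrete solution. -/
lemma bump_le_regSol (hh : 0 < h) {R₀ r : ℝ} (hr : 0 < r) {B E : ℝ → ℝ}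
    (hB0 : B 0 = 0) (hBnonneg : ∀ t ∈ Icc 0 T, 0 ≤ B t) (hB1 : ∀ t ∈ Icc 0 T, B t ≤ 1)
    (hB : ∀ s ∈ Icc 0 T, ∀ t ∈ Icc 0 T, s ≤ t → B s ≤ B t ∧ B t - B s ≤ (t - s) * E t)
    (hE : ∀ t ∈ Icc 0 T, E t + 8 / r ^ 2 * (m / (m - p)) * B t ^ m ≤ B t ^ p)
    (hH : ∀ x, ∀ t ∈ Icc 0 T, H x t = (B t * max (bump R₀ r x) 0 ^ (1 / (m - p))) ^ p)
    (hL : ∀ x, 0 < bump R₀ r x → |x| < L₀) {n : ℕ} (hn : n * kk ≤ T) (j : ℤ) :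
    B (n * kk) * max (bump R₀ r (j * h)) 0 ^ (1 / (m - p)) ≤ Usol n j := by
  have h1 := D.meshRatio_pos
  have hk : 0 < kk := by positivity
  have hmp : 0 < m - p := by linarith [D.one_lt_m, D.p_lt_one]
  induction n generalizing j with
  | zero =>
    rw [Nat.cast_zero, zero_mul, hB0, zero_mul]
    exact D.regSol_nonneg _ _
  | succ n ih =>
    have ht1 := D.time_mem hh hn
    push_cast at hn ht1 ⊢
    have hn' := D.time_le_of_succ hh hn
    have ht0 := D.time_mem hh hn'
    have h2 := D.step_mono
      (U := fun j : ℤ => B (n * kk) * max (bump R₀ r (j * h)) 0 ^ (1 / (m - p)))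
      (U' := Usol n) (G := regSource m p M L₀ a H g h n) hh n (fun i => le_rfl) (ih hn') j
    rw [regSol_succ]
    rcases le_or_gt (bump R₀ r (j * h)) 0 with hb | hb
    · rw [max_eq_right hb, Real.zero_rpow (by positivity), mul_zero]
      exact fdStep_nonneg j
    · refine le_trans ?_ (h2.trans' (le_max_right _ _))
      obtain ⟨h3, h4⟩ := hB _ ht0 _ ht1 (by linarith)
      have e1 : ((j + 1 : ℤ) : ℝ) * h = j * h + h := by push_cast; ring
      have e2 : ((j - 1 : ℤ) : ℝ) * h = j * h - h := by push_cast; ring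
      beta_reduce
      rw [e1, e2]
      refine bump_subsolution (E := E ((n + 1) * kk)) D.one_lt_m D.p_pos D.p_lt_one D.one_le_M hr
        rfl h1.le (hBnonneg _ ht0) h3 (hB1 _ ht1) (h4.trans (le_of_eq (by ring))) (hE _ ht1) hb ?_
      unfold regSource
      rw [if_neg (not_le.2 (hL _ hb)), sub_zero, ← hH _ _ ht1]
      exact (le_max_left _ _).trans (le_mul_of_one_le_left
        ((D.H_nonneg _ _).trans (le_max_left _ _)) (D.one_le_a _))

/-- Comparison of discrete solutions of ordered problems. -/
lemma regSol_mono (hh : 0 < h) {g' w' : ℝ → ℝ} (hg : ∀ s, 0 ≤ s → g s ≤ g' s)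
    (hw : ∀ x, w x ≤ w' x) (n : ℕ) (j : ℤ) : Usol n j ≤ regSol m p M L₀ a H g' w' h n j := by
  induction n generalizing j with
  | zero => exact hw _
  | succ n ih =>
    refine D.step_mono hh n (fun i => ?_) ih j
    unfold regSource
    refine sub_le_sub_right (mul_le_mul_of_nonneg_left (max_le_max le_rfl (hg _ ?_))
      (zero_le_one.trans (D.one_le_a _))) _
    exact (D.regSol_nonneg n i).trans (ih i)

end IsRegularData

end Regular

/-! ### Uniform estimates for the discrete solutions -/

section Cells

variable {h R c : ℝ} {f : ℤ → ℝ}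

lemma mem_cells (hh : 0 < h) {j : ℤ} (hj : |(j : ℝ) * h| < R) :
    j ∈ Finset.Icc (-⌊R / h⌋) ⌊R / h⌋ := by
  obtain ⟨h1, h2⟩ := abs_lt.1 hj
  rw [Finset.mem_Icc, neg_le, Int.le_floor, Int.le_floor, le_div_iff₀ hh, le_div_iff₀ hh]
  push_cast
  constructor <;> linarith

lemma finite_support_of_cells (hh : 0 < h) (hf : ∀ j : ℤ, R ≤ |j * h| → f j = 0) :
    f.support.Finite :=
  (Finset.finite_toSet (Finset.Icc (-⌊R / h⌋) ⌊R / h⌋)).subset fun j hj => by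
    by_contra hc
    exact hj (hf j (not_lt.1 fun h1 => hc (Finset.mem_coe.2 (mem_cells hh h1))))

lemma tsum_le_of_cells (hh : 0 < h) (hh1 : h ≤ 1) (hR : 0 ≤ R) (hc : 0 ≤ c)
    (hf : ∀ j : ℤ, R ≤ |j * h| → f j = 0) (hfc : ∀ j, f j ≤ c) :
    ∑' j, f j ≤ c * ((2 * R + 1) / h) := by
  rw [tsum_eq_sum (s := Finset.Icc (-⌊R / h⌋) ⌊R / h⌋) fun j hj =>
    hf j (not_lt.1 fun h1 => hj (mem_cells hh h1))]
  refine (Finset.sum_le_card_nsmul _ _ c fun j _ => hfc j).trans ?_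
  rw [nsmul_eq_mul, mul_comm, Int.card_Icc]
  refine mul_le_mul_of_nonneg_left ?_ hc
  have h0 : 0 ≤ ⌊R / h⌋ := Int.floor_nonneg.2 (by positivity)
  have h1 : (((⌊R / h⌋ + 1 - -⌊R / h⌋).toNat : ℤ) : ℝ) = 2 * ⌊R / h⌋ + 1 := by
    rw [Int.toNat_of_nonneg (by omega)]; push_cast; ring
  rw [Int.cast_natCast] at h1
  rw [h1, add_div, mul_div_assoc]
  have h2 : 1 ≤ 1 / h := (one_le_div hh).2 hh1
  linarith [Int.floor_le (R / h)]

lemma tsum_second_diff (hf : f.support.Finite) :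
    ∑' j, (f (j + 1) - 2 * f j + f (j - 1)) = 0 := by
  have s2 : Summable f := summable_of_hasFiniteSupport hf
  have s3 : Summable fun j => f (j + 1) :=
    summable_of_hasFiniteSupport (finite_support_comp_add hf 1)
  have s4 : Summable fun j => f (j - 1) :=
    summable_of_hasFiniteSupport (finite_support_comp_add hf (-1))
  have e3 : ∑' j, f (j + 1) = ∑' j, f j := (Equiv.addRight (1 : ℤ)).tsum_eq f
  have e4 : ∑' j, f (j - 1) = ∑' j, f j := (Equiv.subRight (1 : ℤ)).tsum_eq f
  rw [(s3.sub (s2.mul_left 2)).tsum_add s4, s3.tsum_sub (s2.mul_left 2), tsum_mul_left, e3, e4]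
  ring

lemma finite_support_second_diff (hf : f.support.Finite) :
    (Function.support fun j => f (j + 1) - 2 * f j + f (j - 1)).Finite := by
  refine (((finite_support_comp_add hf 1).union hf).union
    (finite_support_comp_add hf (-1))).subset fun j hj => ?_
  by_contra hc
  simp only [mem_union, Function.mem_support, not_or, not_not] at hc hj
  obtain ⟨⟨h1, h2⟩, h3⟩ := hc
  rw [← sub_eq_add_neg] at h3
  apply hj
  rw [h1, h2, h3]; ring

lemma abs_diff_le_tsum_second_diff (hf : f.support.Finite) (j : ℤ) :
    |f (j + 1) - f j| ≤ ∑' i, |f (i + 1) - 2 * f i + f (i - 1)| := by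
  have h1 : (Function.support fun j => f (j + 1) - f j).Finite :=
    ((finite_support_comp_add hf 1).union hf).subset fun i hi => by
      by_contra hc
      simp only [mem_union, Function.mem_support, not_or, not_not] at hc hi
      exact hi (by rw [hc.1, hc.2, sub_zero])
  refine (abs_le_tsum_abs_diff h1 j).trans (le_of_eq ?_)
  rw [← (Equiv.addRight (1 : ℤ)).tsum_eq fun i => |f (i + 1) - 2 * f i + f (i - 1)|]
  refine tsum_congr fun i => ?_
  simp only [Equiv.coe_addRight, add_sub_cancel_right]
  congr 1; ring

end Cells

lemma frontAbsorption_le {m p h : ℝ} (hp0 : 0 < p) (hp1 : p < 1) (hmp : 2 ≤ m + p) (hh : 0 ≤ h)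
    (hh1 : h ≤ 1) : frontAbsorption m p h ≤ frontAbsorption m p 1 := by
  have h1 := two_lt_div_one_sub hp0 hp1 hmp
  exact mul_le_mul_of_nonneg_left (Real.rpow_le_rpow (by linarith) (by linarith) (by linarith))
    (waveConst_pos hp0 hp1 hmp).le

lemma abs_sub_rpow_le {m a b : ℝ} (hm : 1 ≤ m) (ha : 0 ≤ a) (hb : 0 ≤ b) :
    |a - b| ^ m ≤ |a ^ m - b ^ m| := by
  wlog hab : b ≤ a generalizing a b
  · rw [abs_sub_comm, abs_sub_comm (a ^ m)]
    exact this hb ha (le_of_not_ge hab)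
  rw [abs_of_nonneg (sub_nonneg.2 hab)]
  refine le_trans ?_ (le_abs_self _)
  have := Real.add_rpow_le_rpow_add (sub_nonneg.2 hab) hb hm
  rw [sub_add_cancel] at this
  linarith

section Regular

variable {m p M M₀ A L₀ T Lg CH κ h : ℝ} {a : ℝ → ℝ} {H : ℝ → ℝ → ℝ} {g w : ℝ → ℝ}

local notation "Usol" => regSol m p M L₀ a H g w h
local notation "Fsrc" => regSource m p M L₀ a H g h
local notation "kk" => meshRatio m M * h ^ 2

namespace IsRegularData

variable (D : IsRegularData m p M M₀ A L₀ T Lg CH κ a H g w)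
include D

lemma sourceBound_nonneg : 0 ≤ A * M ^ p + frontAbsorption m p 1 := by
  have h1 := D.A_pos
  have h2 := D.M_pos
  have h3 := frontAbsorption_nonneg (m := m) D.p_pos D.p_lt_one D.two_le zero_le_one
  positivity

/-- The truncated step solves the difference equation up to a defect controlled by the
absorption. -/
lemma exists_defect (hh : 0 < h) (hh1 : h ≤ 1) {n : ℕ} (hn : (n + 1) * kk ≤ T) (j : ℤ) :
    ∃ d, 0 ≤ d ∧ d ≤ kk * frontAbsorption m p h ∧
      Usol (n + 1) j - Usol n j - meshRatio m M * (Usol n (j + 1) ^ m - 2 * Usol n j ^ m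
        + Usol n (j - 1) ^ m) = kk * Fsrc n j (Usol n j) + d ∧
      |kk * Fsrc n j (Usol n j) + d| ≤ kk * (A * M ^ p + frontAbsorption m p 1) := by
  have h1 := D.meshRatio_pos
  have hk : 0 < kk := by positivity
  have hn' := D.time_le_of_succ hh hn
  have hθ := frontAbsorption_nonneg (m := m) D.p_pos D.p_lt_one D.two_le hh.le
  have hθ1 := frontAbsorption_le (m := m) D.p_pos D.p_lt_one D.two_le hh.le hh1
  have hU := D.regSol_nonneg (h := h) n
  set X := Usol n j + meshRatio m M * (truncPow m M (Usol n (j + 1))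
    - 2 * truncPow m M (Usol n j) + truncPow m M (Usol n (j - 1))) + kk * Fsrc n j (Usol n j)
    with hX
  have hstep : Usol (n + 1) j = max 0 X := rfl
  have hS0 : 0 ≤ a (j * h) * max (H (j * h) ((n + 1) * kk)) (g (Usol n j)) :=
    mul_nonneg (zero_le_one.trans (D.one_le_a _)) ((D.H_nonneg _ _).trans (le_max_left _ _))
  have hF0 : -frontAbsorption m p h ≤ Fsrc n j (Usol n j) := by
    unfold regSource; split_ifs <;> linarith
  have hF1 : Fsrc n j (Usol n j) ≤ A * M ^ p := by
    have h3 := D.source_le hh hn j (hU j)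
    have h4 : max 1 (Usol n j ^ p) ≤ M ^ p := max_le (Real.one_le_rpow D.one_le_M D.p_pos.le)
      (Real.rpow_le_rpow (hU j) (D.regSol_le_M hh hn' j) D.p_pos.le)
    have h5 : A * max 1 (Usol n j ^ p) ≤ A * M ^ p := mul_le_mul_of_nonneg_left h4 D.A_pos.le
    unfold regSource; split_ifs <;> linarith
  have hXlow : -(kk * frontAbsorption m p h) ≤ X := by
    have h3 : truncPow m M (Usol n j) ≤ m * M ^ (m - 1) * Usol n j := by
      have := truncPow_sub_le D.one_lt_m D.M_pos.le (hU j)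
      have h0 : truncPow m M 0 = 0 := by
        rw [truncPow_eq le_rfl D.M_pos.le, Real.zero_rpow D.m_pos.ne']
      rwa [h0, sub_zero, sub_zero] at this
    have h4 : 2 * meshRatio m M * truncPow m M (Usol n j) ≤ Usol n j := by
      calc _ ≤ 2 * meshRatio m M * (m * M ^ (m - 1) * Usol n j) := by gcongr
        _ = (2 * meshRatio m M * (m * M ^ (m - 1))) * Usol n j := by ring
        _ ≤ 1 * Usol n j := mul_le_mul_of_nonneg_right D.cfl (hU j)
        _ = _ := one_mul _
    have h5 : ∀ i, 0 ≤ truncPow m M (Usol n i) := fun i =>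
      Real.rpow_nonneg (le_max_left _ _) _
    have h6 := mul_nonneg h1.le (h5 (j + 1))
    have h7 := mul_nonneg h1.le (h5 (j - 1))
    have h8 := mul_le_mul_of_nonneg_left hF0 hk.le
    rw [hX]
    linarith
  refine ⟨max 0 X - X, sub_nonneg.2 (le_max_right _ _), ?_, ?_, ?_⟩
  · have : 0 ≤ kk * frontAbsorption m p h := by positivity
    rcases max_cases 0 X with h3 | h3 <;> linarith [h3.1]
  · rw [hstep, ← D.truncPow_regSol hh hn' (j + 1), ← D.truncPow_regSol hh hn' j,
      ← D.truncPow_regSol hh hn' (j - 1), hX]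
    ring
  · have h8 := mul_le_mul_of_nonneg_left hF0 hk.le
    have h9 := mul_le_mul_of_nonneg_left hF1 hk.le
    have h10 := mul_le_mul_of_nonneg_left hθ1 hk.le
    have h11 : 0 ≤ kk * frontAbsorption m p h := by positivity
    rw [abs_le]
    constructor
    · have : 0 ≤ kk * (A * M ^ p) := by
        have := D.A_pos
        have := D.M_pos
        positivity
      linarith [le_max_right 0 X]
    · rcases max_cases 0 X with h3 | h3 <;> linarith [h3.1]

lemma finite_support_regSol_rpow (hh : 0 < h) (hh1 : h ≤ 1) {n : ℕ} (hn : n * kk ≤ T) :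
    (Function.support fun j => Usol n j ^ m).Finite :=
  finite_support_of_cells hh fun _ hj => by
    rw [D.regSol_eq_zero hh hh1 hn hj, Real.zero_rpow D.m_pos.ne']

lemma finite_support_regSol_sub (hh : 0 < h) (hh1 : h ≤ 1) {n l : ℕ} (hn : n * kk ≤ T)
    (hl : l * kk ≤ T) : (Function.support fun j => Usol n j - Usol l j).Finite :=
  finite_support_of_cells hh fun _ hj => by
    rw [D.regSol_eq_zero hh hh1 hn hj, D.regSol_eq_zero hh hh1 hl hj, sub_zero]

/-- Semiconcavity bounds the total variation of the slopes of the initial pressure. -/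
lemma tsum_initial_second_diff_le (hh : 0 < h) (hh1 : h ≤ 1) :
    ∑' j, |Usol 0 (j + 1) ^ m - 2 * Usol 0 j ^ m + Usol 0 (j - 1) ^ m| ≤
      2 * κ * h * (2 * (L₀ + 1) + 1) := by
  have hV : (Function.support fun j => Usol 0 j ^ m).Finite :=
    D.finite_support_regSol_rpow hh hh1 (by simpa using D.T_pos.le)
  have hδ := finite_support_second_diff hV
  have h0 := tsum_second_diff hV
  have s1 : Summable fun j => Usol 0 (j + 1) ^ m - 2 * Usol 0 j ^ m + Usol 0 (j - 1) ^ m :=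
    summable_of_hasFiniteSupport hδ
  have s2 := summable_abs_of_finite hδ
  have h1 : ∀ j, |Usol 0 (j + 1) ^ m - 2 * Usol 0 j ^ m + Usol 0 (j - 1) ^ m|
      + (Usol 0 (j + 1) ^ m - 2 * Usol 0 j ^ m + Usol 0 (j - 1) ^ m) ≤ 2 * κ * h ^ 2 := fun j => by
    have h2 := D.semiconcave (j * h) h
    have e1 : ((j + 1 : ℤ) : ℝ) * h = j * h + h := by push_cast; ring
    have e2 : ((j - 1 : ℤ) : ℝ) * h = j * h - h := by push_cast; ring
    change |w ((j + 1 : ℤ) * h) ^ m - 2 * w (j * h) ^ m + w ((j - 1 : ℤ) * h) ^ m|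
      + (w ((j + 1 : ℤ) * h) ^ m - 2 * w (j * h) ^ m + w ((j - 1 : ℤ) * h) ^ m) ≤ _
    rw [e1, e2]
    have hκ := D.κ_nonneg
    have h3 : 0 ≤ κ * h ^ 2 := by positivity
    rcases abs_cases (w (j * h + h) ^ m - 2 * w (j * h) ^ m + w (j * h - h) ^ m) with h4 | h4 <;>
      linarith [h4.1]
  have h2 := tsum_le_of_cells (R := L₀ + 1) hh hh1 (by linarith [D.L₀_nonneg])
    (by have := D.κ_nonneg; positivity) (fun j hj => by
      have hz : ∀ i : ℤ, L₀ ≤ |(i : ℝ) * h| → Usol 0 i ^ m = 0 := fun i hi => by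
        change w (i * h) ^ m = 0
        rw [D.w_eq_zero _ hi, Real.zero_rpow D.m_pos.ne']
      have e1 : ((j + 1 : ℤ) : ℝ) * h = j * h + h := by push_cast; ring
      have e2 : ((j - 1 : ℤ) : ℝ) * h = j * h - h := by push_cast; ring
      have ha : |h| ≤ 1 := by rwa [abs_of_pos hh]
      rw [hz j (by linarith), hz (j + 1), hz (j - 1)]
      · simp
      · rw [e2]; linarith [abs_sub_abs_le_abs_sub (j * h) h]
      · rw [e1]; linarith [abs_sub_abs_le_abs_add (j * h) h]) h1
  rw [s2.tsum_add s1, h0, add_zero] at h2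
  refine h2.trans (le_of_eq ?_)
  field_simp

/-- The increments in time and the second differences in space have comparable sums. -/
lemma abs_tsum_increment_sub_le (hh : 0 < h) (hh1 : h ≤ 1) {n : ℕ} (hn : (n + 1) * kk ≤ T) :
    |(∑' j, |Usol (n + 1) j - Usol n j|) - meshRatio m M *
      (∑' j, |Usol n (j + 1) ^ m - 2 * Usol n j ^ m + Usol n (j - 1) ^ m|)| ≤
      kk * (A * M ^ p + frontAbsorption m p 1) * ((2 * (L₀ + M + 2) + 1) / h) := by
  have hlam := D.meshRatio_pos
  have hL := D.L₀_nonneg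
  have hM := D.one_le_M
  have hB := D.sourceBound_nonneg
  have hn0 := D.time_le_of_succ hh hn
  have hn1 : ((n + 1 : ℕ) : ℝ) * kk ≤ T := by push_cast; exact hn
  have hV := D.finite_support_regSol_rpow hh hh1 hn0
  have s2 := (summable_abs_of_finite (finite_support_second_diff hV)).mul_left (meshRatio m M)
  have s3 := summable_abs_of_finite (D.finite_support_regSol_sub hh hh1 hn1 hn0)
  have hpt : ∀ j, |(|Usol (n + 1) j - Usol n j| - meshRatio m M *
      |Usol n (j + 1) ^ m - 2 * Usol n j ^ m + Usol n (j - 1) ^ m|)| ≤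
      kk * (A * M ^ p + frontAbsorption m p 1) := fun j => by
    obtain ⟨d, -, -, h1, h2⟩ := D.exists_defect hh hh1 hn j
    have h3 := abs_abs_sub_abs_le (Usol (n + 1) j - Usol n j) (meshRatio m M *
      (Usol n (j + 1) ^ m - 2 * Usol n j ^ m + Usol n (j - 1) ^ m))
    rw [h1, abs_mul, abs_of_pos hlam] at h3
    exact h3.trans h2
  have hz : ∀ j : ℤ, L₀ + M + 2 ≤ |j * h| → |Usol (n + 1) j - Usol n j| - meshRatio m M *
      |Usol n (j + 1) ^ m - 2 * Usol n j ^ m + Usol n (j - 1) ^ m| = 0 := fun j hj => by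
    have e1 : ((j + 1 : ℤ) : ℝ) * h = j * h + h := by push_cast; ring
    have e2 : ((j - 1 : ℤ) : ℝ) * h = j * h - h := by push_cast; ring
    have ha : |h| ≤ 1 := by rwa [abs_of_pos hh]
    have h3 : L₀ + M + 1 ≤ |((j + 1 : ℤ) : ℝ) * h| := by
      rw [e1]; linarith [abs_sub_abs_le_abs_add (j * h) h]
    have h4 : L₀ + M + 1 ≤ |((j - 1 : ℤ) : ℝ) * h| := by
      rw [e2]; linarith [abs_sub_abs_le_abs_sub (j * h) h]
    rw [D.regSol_eq_zero hh hh1 hn1 (j := j) (by linarith),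
      D.regSol_eq_zero hh hh1 hn0 (j := j) (by linarith), D.regSol_eq_zero hh hh1 hn0 h3,
      D.regSol_eq_zero hh hh1 hn0 h4, Real.zero_rpow D.m_pos.ne']
    simp
  rw [← tsum_mul_left, ← s3.tsum_sub s2, abs_le]
  have hc : 0 ≤ kk * (A * M ^ p + frontAbsorption m p 1) := by positivity
  constructor
  · rw [neg_le, ← tsum_neg]
    exact tsum_le_of_cells hh hh1 (by linarith) hc (fun j hj => by rw [hz j hj, neg_zero])
      fun j => (neg_le_abs _).trans (hpt j)
  · exact tsum_le_of_cells hh hh1 (by linarith) hc hz fun j => (le_abs_self _).trans (hpt j)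

end IsRegularData

local notation "Uh" => regSol m p M L₀ a H g w
local notation "Fh" => regSource m p M L₀ a H g

/-- The total variation in time of the discrete solutions is bounded uniformly in the mesh. -/
lemma IsRegularData.exists_rate (D : IsRegularData m p M M₀ A L₀ T Lg CH κ a H g w) :
    ∃ C, 0 ≤ C ∧ ∀ h, 0 < h → h ≤ 1 → ∀ n : ℕ, (n + 1) * (meshRatio m M * h ^ 2) ≤ T →
      ∑' j, |Uh h (n + 1) j - Uh h n j| ≤ C * (meshRatio m M * h ^ 2 / h) := by
  have hlam := D.meshRatio_pos
  have hL := D.L₀_nonneg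
  have hM := D.one_le_M
  have hB := D.sourceBound_nonneg
  have hκ := D.κ_nonneg
  have hA := D.A_pos
  have hCH := D.CH_nonneg
  have hLg := D.Lg_nonneg
  set B := A * M ^ p + frontAbsorption m p 1 with hBdef
  set R := 2 * (L₀ + M + 2) + 1 with hR
  have hR0 : 0 ≤ R := by positivity
  refine ⟨R * (2 * κ + B + A * CH) * Real.exp (A * Lg), by positivity, ?_⟩
  intro h hh hh1 n hn
  have hk : 0 < (meshRatio m M * h ^ 2) := by positivity
  have hkT : (meshRatio m M * h ^ 2) ≤ T := by
    have : (0 : ℝ) ≤ n * (meshRatio m M * h ^ 2) := by positivity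
    linarith
  have h0 : ∑' j, |Uh h 1 j - Uh h 0 j| ≤ (meshRatio m M * h ^ 2) / h * (R * (2 * κ + B)) := by
    have h1 := (abs_le.1 (D.abs_tsum_increment_sub_le hh hh1 (n := 0) (by simpa using hkT))).2
    have h2 := mul_le_mul_of_nonneg_left (D.tsum_initial_second_diff_le hh hh1) hlam.le
    have h3 : meshRatio m M * (2 * κ * h * (2 * (L₀ + 1) + 1)) ≤
        (meshRatio m M * h ^ 2) / h * (R * (2 * κ)) := by
      have e : (meshRatio m M * h ^ 2) / h * (R * (2 * κ)) =
          meshRatio m M * (2 * κ * h * R) := by field_simp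
      rw [e]
      have : 2 * (L₀ + 1) + 1 ≤ R := by rw [hR]; linarith
      gcongr
    rw [zero_add] at h1
    have e2 : (meshRatio m M * h ^ 2) * B * (R / h) =
        (meshRatio m M * h ^ 2) / h * (R * B) := by ring
    rw [← hBdef, ← hR, e2] at h1
    linarith
  have hrec : ∀ i, i < n → ∑' j, |Uh h (i + 1 + 1) j - Uh h (i + 1) j| ≤
      (1 + (meshRatio m M * h ^ 2) * (A * Lg)) * ∑' j, |Uh h (i + 1) j - Uh h i j|
        + (meshRatio m M * h ^ 2) * (A * CH * (meshRatio m M * h ^ 2) * (R / h)) := by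
    intro i hi
    have hin : ((i + 1 : ℕ) : ℝ) + 1 ≤ n + 1 := by
      have : ((i + 1 : ℕ) : ℝ) ≤ n := by exact_mod_cast hi
      linarith
    have ht2 : (((i + 1 : ℕ) : ℝ) + 1) * (meshRatio m M * h ^ 2) ≤ T := le_trans (by gcongr) hn
    have ht1 := D.time_le_of_succ hh ht2
    have ht0 : (i : ℝ) * (meshRatio m M * h ^ 2) ≤ T := by
      push_cast at ht1
      exact D.time_le_of_succ hh ht1
    have hdiff : ∀ j, |Fh h (i + 1) j (Uh h i j) - Fh h i j (Uh h i j)| ≤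
        A * CH * (meshRatio m M * h ^ 2) := fun j => by
      unfold regSource
      rw [sub_sub_sub_cancel_right, ← mul_sub, abs_mul,
        abs_of_nonneg (zero_le_one.trans (D.one_le_a _)), mul_assoc]
      refine mul_le_mul (D.a_le _) ?_ (abs_nonneg _) hA.le
      refine (abs_max_sub_max_le_abs _ _ _).trans ?_
      have m2 := D.time_mem hh (n := i + 1 + 1) (by push_cast at ht2 ⊢; exact ht2)
      have m1 := D.time_mem hh ht1
      refine (D.H_lipschitz _ _ (by push_cast at m2 ⊢; exact m2) _
        (by push_cast at m1 ⊢; exact m1)).trans (le_of_eq ?_)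
      have e : (((i + 1 : ℕ) : ℝ) + 1) * (meshRatio m M * h ^ 2)
          - (i + 1) * (meshRatio m M * h ^ 2) = (meshRatio m M * h ^ 2) := by push_cast; ring
      rw [e, abs_of_pos hk]
    have hdz : ∀ j : ℤ, L₀ + M + 2 ≤ |j * h| →
        Fh h (i + 1) j (Uh h i j) - Fh h i j (Uh h i j) = 0 := fun j hj => by
      unfold regSource
      rw [D.H_eq_zero _ _ (by linarith), D.H_eq_zero _ _ (by linarith), sub_self]
    have h1 := tsum_abs_fdStep_sub_le (L := A * Lg) (U := Uh h (i + 1)) (U' := Uh h i)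
      (G := Fh h (i + 1)) (G' := Fh h i) hlam.le hk.le (truncPow_mono D.m_pos.le)
      (fun _ _ hab => truncPow_sub_le D.one_lt_m D.M_pos.le hab) D.cfl
      (fun j b c => by
        unfold regSource
        rw [sub_sub_sub_cancel_right, ← mul_sub, abs_mul,
          abs_of_nonneg (zero_le_one.trans (D.one_le_a _)), mul_assoc]
        refine mul_le_mul (D.a_le _) ?_ (abs_nonneg _) hA.le
        rw [max_comm _ (g b), max_comm _ (g c)]
        exact (abs_max_sub_max_le_abs _ _ _).trans (D.g_lipschitz _ _))
      (D.finite_support_regSol_sub hh hh1 ht1 ht0)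
      (finite_support_of_cells hh hdz)
    refine h1.trans (add_le_add_right (mul_le_mul_of_nonneg_left ?_ hk.le) _)
    exact tsum_le_of_cells hh hh1 (by linarith) (by positivity)
      (fun j hj => by rw [hdz j hj, abs_zero]) hdiff
  have hd := le_of_le_one_add_mul_add (d := fun i => ∑' j, |Uh h (i + 1) j - Uh h i j|)
    (a := (meshRatio m M * h ^ 2) * (A * Lg)) (by positivity)
    (b := (meshRatio m M * h ^ 2) * (A * CH * (meshRatio m M * h ^ 2) * (R / h))) (by positivity)
    (tsum_nonneg fun _ => abs_nonneg _) hrec n le_rfl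
  have hn1 : n * (meshRatio m M * h ^ 2) ≤ 1 := (D.time_le_of_succ hh hn).trans D.T_le_one
  have hn0 : 0 ≤ n * (meshRatio m M * h ^ 2) := by positivity
  refine hd.trans ?_
  calc _ ≤ ((meshRatio m M * h ^ 2) / h * (R * (2 * κ + B))
        + (n * (meshRatio m M * h ^ 2)) * ((meshRatio m M * h ^ 2) / h * (R * (A * CH)))) *
        Real.exp ((n * (meshRatio m M * h ^ 2)) * (A * Lg)) := by
        refine mul_le_mul (add_le_add h0 (le_of_eq (by ring))) (le_of_eq (by ring_nf))
          (Real.exp_pos _).le (by positivity)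
    _ ≤ ((meshRatio m M * h ^ 2) / h * (R * (2 * κ + B))
        + 1 * ((meshRatio m M * h ^ 2) / h * (R * (A * CH)))) *
        Real.exp (1 * (A * Lg)) := by gcongr
    _ = _ := by rw [one_mul, one_mul]; ring

/-- The discrete pressures are Lipschitz in space uniformly in the mesh. -/
lemma IsRegularData.exists_slope (D : IsRegularData m p M M₀ A L₀ T Lg CH κ a H g w) :
    ∃ C, 0 ≤ C ∧ ∀ h, 0 < h → h ≤ 1 → ∀ n : ℕ, (n + 1) * (meshRatio m M * h ^ 2) ≤ T → ∀ j,
      |Uh h n (j + 1) ^ m - Uh h n j ^ m| ≤ C * h := by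
  obtain ⟨C, hC, H1⟩ := D.exists_rate
  have hlam := D.meshRatio_pos
  have hL := D.L₀_nonneg
  have hM := D.one_le_M
  have hB := D.sourceBound_nonneg
  refine ⟨C + (A * M ^ p + frontAbsorption m p 1) * (2 * (L₀ + M + 2) + 1), by positivity, ?_⟩
  intro h hh hh1 n hn j
  refine (abs_diff_le_tsum_second_diff (D.finite_support_regSol_rpow hh hh1
    (D.time_le_of_succ hh hn)) j).trans ?_
  have h1 := (abs_le.1 (D.abs_tsum_increment_sub_le hh hh1 hn)).1
  have h2 := H1 h hh hh1 n hn
  refine le_of_mul_le_mul_left ?_ hlam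
  have e : meshRatio m M * ((C + (A * M ^ p + frontAbsorption m p 1) *
      (2 * (L₀ + M + 2) + 1)) * h) =
      C * (meshRatio m M * h ^ 2 / h) + (meshRatio m M * h ^ 2) * (A * M ^ p + frontAbsorption m p 1)
      * ((2 * (L₀ + M + 2) + 1) / h) := by field_simp
  rw [e]
  linarith

/-- The discrete pressures are Hölder continuous in time uniformly in the mesh. -/
lemma IsRegularData.exists_time_modulus (D : IsRegularData m p M M₀ A L₀ T Lg CH κ a H g w) :
    ∃ C, 0 ≤ C ∧ ∀ h, 0 < h → h ≤ 1 → ∀ n l : ℕ, (n + 1) * (meshRatio m M * h ^ 2) ≤ T →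
      (l + 1) * (meshRatio m M * h ^ 2) ≤ T → ∀ j,
      |Uh h n j ^ m - Uh h l j ^ m| ≤ C * √((meshRatio m M * h ^ 2) * |(n : ℝ) - l|) := by
  obtain ⟨C, hC, H1⟩ := D.exists_rate
  obtain ⟨S, hS, H2⟩ := D.exists_slope
  have hlam := D.meshRatio_pos
  have hM := D.M_pos
  have hm := D.m_pos
  set Λ := m * M ^ (m - 1) with hΛ
  have hΛ0 : 0 ≤ Λ := by positivity
  refine ⟨√(4 * S * (Λ * C)), Real.sqrt_nonneg _, ?_⟩
  intro h hh hh1 n l hn hl j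
  wlog hln : l ≤ n generalizing n l
  · rw [abs_sub_comm, abs_sub_comm (n : ℝ)]
    exact this l n hl hn (le_of_not_ge hln)
  have hk : 0 < (meshRatio m M * h ^ 2) := by positivity
  have hn0 := D.time_le_of_succ hh hn
  have hl0 := D.time_le_of_succ hh hl
  have hsum : ∑' j, |Uh h n j - Uh h l j| ≤ (n - l : ℝ) * (C * (meshRatio m M * h ^ 2 / h)) := by
    clear hl
    induction n, hln using Nat.le_induction with
    | base => simp
    | succ i hi ih =>
      have hi1 : (i + 1 : ℝ) * (meshRatio m M * h ^ 2) ≤ T := by push_cast at hn0; exact hn0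
      have hi0 := D.time_le_of_succ hh hi1
      have s1 := summable_abs_of_finite (D.finite_support_regSol_sub hh hh1 hi0 hl0)
      have s2 := summable_abs_of_finite (D.finite_support_regSol_sub hh hh1 hn0 hi0)
      have s3 := summable_abs_of_finite (D.finite_support_regSol_sub hh hh1 hn0 hl0)
      have h1 := s3.tsum_le_tsum (fun j => abs_sub_le _ (Uh h i j) _) (s2.add s1)
      rw [s2.tsum_add s1] at h1
      have h2 := H1 h hh hh1 i hi1
      have h3 := ih hi1 hi0
      push_cast
      linarith
  have hfin : (Function.support fun j => Uh h n j ^ m - Uh h l j ^ m).Finite :=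
    finite_support_of_cells hh fun j hj => by
      rw [D.regSol_eq_zero hh hh1 hn0 hj, D.regSol_eq_zero hh hh1 hl0 hj, sub_self]
  have hV : ∑' j, |Uh h n j ^ m - Uh h l j ^ m| ≤ Λ * ∑' j, |Uh h n j - Uh h l j| := by
    have s1 := (summable_abs_of_finite (D.finite_support_regSol_sub hh hh1 hn0 hl0)).mul_left Λ
    rw [← tsum_mul_left]
    refine (summable_abs_of_finite hfin).tsum_le_tsum (fun j => ?_) s1
    have key : ∀ b c : ℝ, b ≤ c → |truncPow m M b - truncPow m M c| ≤ Λ * |b - c| :=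
      fun b c hbc => by
        rw [abs_sub_comm, abs_sub_comm b, abs_of_nonneg (sub_nonneg.2 hbc),
          abs_of_nonneg (sub_nonneg.2 (truncPow_mono hm.le hbc))]
        exact truncPow_sub_le D.one_lt_m hM.le hbc
    rw [← D.truncPow_regSol hh hn0, ← D.truncPow_regSol hh hl0]
    rcases le_total (Uh h n j) (Uh h l j) with h1 | h1
    · exact key _ _ h1
    · rw [abs_sub_comm, abs_sub_comm (Uh h n j)]; exact key _ _ h1
  have hsq := sq_le_of_lipschitz_of_tsum hfin (c := 2 * (S * h)) (fun i => by
    have h1 := H2 h hh hh1 n hn i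
    have h2 := H2 h hh hh1 l hl i
    rw [abs_le] at h1 h2 ⊢
    constructor <;> linarith) j
  have hnl : (0 : ℝ) ≤ n - l := sub_nonneg.2 (by exact_mod_cast hln)
  rw [← Real.sqrt_mul (by positivity), abs_of_nonneg hnl]
  apply Real.abs_le_sqrt
  refine hsq.trans ?_
  calc _ ≤ 2 * (2 * (S * h)) * (Λ * ((n - l : ℝ) * (C * (meshRatio m M * h ^ 2 / h)))) := by
        gcongr; exact hV.trans (by gcongr)
    _ = _ := by field_simp; ring

/-- Along a mesh sequence tending to zero, the discrete solutions form a consistent scheme. -/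
theorem IsRegularData.exists_isConsistentScheme
    (D : IsRegularData m p M M₀ A L₀ T Lg CH κ a H g w) {η : ℕ → ℝ} (hη0 : ∀ N, 0 < η N)
    (hη1 : ∀ N, η N ≤ 1) (hη : Tendsto η atTop (𝓝 0))
    (hηT : ∀ N, meshRatio m M * η N ^ 2 ≤ T / 2) :
    ∃ C₁ C₂ e, 0 ≤ C₁ ∧ 0 ≤ C₂ ∧ IsConsistentScheme m M C₁ C₂ (T / 2) η
      (fun N => meshRatio m M * η N ^ 2) e
      (fun z => a z.1 * max (H z.1 z.2.1) (g z.2.2)) (fun N => regSol m p M L₀ a H g w (η N)) := by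
  obtain ⟨C₁, hC₁, H1⟩ := D.exists_slope
  obtain ⟨C₂, hC₂, H2⟩ := D.exists_time_modulus
  have hlam := D.meshRatio_pos
  have hT := D.T_pos
  have hk : ∀ N, 0 < meshRatio m M * η N ^ 2 := fun N => by have := hη0 N; positivity
  have hkt : Tendsto (fun N => meshRatio m M * η N ^ 2) atTop (𝓝 0) := by
    have := (hη.pow 2).const_mul (meshRatio m M)
    simpa using this
  have hle : ∀ (N n : ℕ), n * (meshRatio m M * η N ^ 2) ≤ T / 2 →
      (n + 1) * (meshRatio m M * η N ^ 2) ≤ T := fun N n hn => by linarith [hηT N]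
  have hle0 : ∀ (N n : ℕ), n * (meshRatio m M * η N ^ 2) ≤ T / 2 →
      n * (meshRatio m M * η N ^ 2) ≤ T := fun N n hn => by linarith
  refine ⟨C₁, C₂, fun N => A * CH * (meshRatio m M * η N ^ 2) + 2 * frontAbsorption m p (η N),
    hC₁, hC₂, hη0, hk, hη, hkt, ?_, fun N n j => D.regSol_nonneg n j,
    fun N n j hn => D.regSol_le_M (hη0 N) (hle0 N n hn) j, ?_, ?_⟩
  · have hq : 0 < m / (1 - p) - 2 := by
      linarith [two_lt_div_one_sub D.p_pos D.p_lt_one D.two_le]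
    have h1 : Tendsto (fun N => (2 * η N) ^ (m / (1 - p) - 2)) atTop (𝓝 0) := by
      have h2 := (hη.const_mul 2).rpow_const (p := m / (1 - p) - 2) (Or.inr hq.le)
      rwa [mul_zero, Real.zero_rpow hq.ne'] at h2
    have h3 := (hkt.const_mul (A * CH)).add (((h1.const_mul (waveConst m p)).const_mul 2))
    simpa [frontAbsorption] using h3
  · intro N n l i j hn hl
    refine (abs_sub_rpow_le D.one_lt_m.le (D.regSol_nonneg _ _) (D.regSol_nonneg _ _)).trans ?_
    refine (abs_sub_le _ (regSol m p M L₀ a H g w (η N) n j ^ m) _).trans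
      (add_le_add ?_ (H2 _ (hη0 N) (hη1 N) n l (hle N n hn) (hle N l hl) j))
    have hstep : ∀ i : ℤ, ∀ d : ℕ, |regSol m p M L₀ a H g w (η N) n (i + d) ^ m
        - regSol m p M L₀ a H g w (η N) n i ^ m| ≤ C₁ * η N * d := fun i d => by
      induction d with
      | zero => simp
      | succ d ih =>
        have h1 := H1 _ (hη0 N) (hη1 N) n (hle N n hn) (i + d)
        have h2 := abs_sub_le (regSol m p M L₀ a H g w (η N) n (i + d + 1) ^ m)
          (regSol m p M L₀ a H g w (η N) n (i + d) ^ m) (regSol m p M L₀ a H g w (η N) n i ^ m)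
        push_cast
        rw [← add_assoc]
        linarith
    rcases le_total j i with hij | hij
    · have h1 := hstep j (i - j).toNat
      have e1 : ((i - j).toNat : ℤ) = i - j := Int.toNat_of_nonneg (by omega)
      have e2 : ((i - j).toNat : ℝ) = i - j := by exact_mod_cast congrArg (Int.cast (R := ℝ)) e1
      rw [e1, e2, add_sub_cancel] at h1
      rw [abs_of_nonneg (sub_nonneg.2 (by exact_mod_cast hij : (j : ℝ) ≤ i))]
      linarith
    · have h1 := hstep i (j - i).toNat
      have e1 : ((j - i).toNat : ℤ) = j - i := Int.toNat_of_nonneg (by omega)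
      have e2 : ((j - i).toNat : ℝ) = j - i := by exact_mod_cast congrArg (Int.cast (R := ℝ)) e1
      rw [e1, e2, add_sub_cancel, abs_sub_comm] at h1
      rw [abs_sub_comm (i : ℝ), abs_of_nonneg (sub_nonneg.2 (by exact_mod_cast hij : (i : ℝ) ≤ j))]
      linarith
  · intro N n j hn
    have hn' : (n + 1) * (meshRatio m M * η N ^ 2) ≤ T := by linarith
    obtain ⟨d, hd0, hd1, hd, -⟩ := D.exists_defect (hη0 N) (hη1 N) hn' j
    have e0 : meshRatio m M * η N ^ 2 / η N ^ 2 = meshRatio m M := by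
      have := (hη0 N).ne'
      field_simp
    rw [e0, hd]
    set k := meshRatio m M * η N ^ 2 with hkdef
    set s := regSol m p M L₀ a H g w (η N) n j with hs
    have hθ := frontAbsorption_nonneg (m := m) D.p_pos D.p_lt_one D.two_le (hη0 N).le
    have hdiff : |a (j * η N) * max (H (j * η N) ((n + 1) * k)) (g s)
        - a (j * η N) * max (H (j * η N) (n * k)) (g s)| ≤ A * CH * k := by
      rw [← mul_sub, abs_mul, abs_of_nonneg (zero_le_one.trans (D.one_le_a _)), mul_assoc]
      refine mul_le_mul (D.a_le _) ?_ (abs_nonneg _) D.A_pos.le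
      refine (abs_max_sub_max_le_abs _ _ _).trans ?_
      have m1 := D.time_mem (hη0 N) (n := n + 1) (by push_cast; exact hn')
      have m0 := D.time_mem (hη0 N) (D.time_le_of_succ (hη0 N) hn')
      push_cast at m1
      refine (D.H_lipschitz _ _ m1 _ m0).trans (le_of_eq ?_)
      have e : ((n : ℝ) + 1) * k - n * k = k := by ring
      rw [← hkdef, e, abs_of_pos (hk N)]
    have hF : |regSource m p M L₀ a H g (η N) n j s
        - a (j * η N) * max (H (j * η N) (n * k)) (g s)| ≤
        A * CH * k + frontAbsorption m p (η N) := by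
      unfold regSource
      rw [← hkdef]
      rw [abs_le] at hdiff ⊢
      split_ifs <;> constructor <;> linarith
    have h3 := mul_le_mul_of_nonneg_left (abs_le.1 hF).1 (hk N).le
    have h4 := mul_le_mul_of_nonneg_left (abs_le.1 hF).2 (hk N).le
    have h5 : 0 ≤ k * frontAbsorption m p (η N) := mul_nonneg (hk N).le hθ
    rw [← hkdef] at h3 h4
    rw [abs_le]
    constructor <;> linarith

end Regular

/-! ### Semiconcave approximation from below -/

/-- The quadratic inf-convolution of `V`. -/
def infConv (V : ℝ → ℝ) (i x : ℝ) : ℝ := ⨅ z, V (x - z) + i * z ^ 2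

section InfConv

variable {V : ℝ → ℝ} {i : ℝ}

lemma infConv_bddBelow (hV : ∀ x, 0 ≤ V x) (hi : 0 ≤ i) (x : ℝ) :
    BddBelow (range fun z => V (x - z) + i * z ^ 2) := by
  refine ⟨0, ?_⟩
  rintro _ ⟨z, rfl⟩
  have := hV (x - z)
  positivity

lemma infConv_le (hV : ∀ x, 0 ≤ V x) (hi : 0 ≤ i) (x z : ℝ) :
    infConv V i x ≤ V (x - z) + i * z ^ 2 := ciInf_le (infConv_bddBelow hV hi x) z

lemma infConv_le_self (hV : ∀ x, 0 ≤ V x) (hi : 0 ≤ i) (x : ℝ) : infConv V i x ≤ V x := by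
  simpa using infConv_le hV hi x 0

lemma infConv_nonneg (hV : ∀ x, 0 ≤ V x) (hi : 0 ≤ i) (x : ℝ) : 0 ≤ infConv V i x :=
  le_ciInf fun z => by have := hV (x - z); positivity

lemma infConv_mono (hV : ∀ x, 0 ≤ V x) (hi : 0 ≤ i) {i' : ℝ} (hii : i ≤ i') (x : ℝ) :
    infConv V i x ≤ infConv V i' x :=
  le_ciInf fun z => (infConv_le hV hi x z).trans (by gcongr)

lemma infConv_semiconcave (hV : ∀ x, 0 ≤ V x) (hi : 0 ≤ i) (x h : ℝ) :
    infConv V i (x + h) - 2 * infConv V i x + infConv V i (x - h) ≤ 2 * i * h ^ 2 := by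
  have : (infConv V i (x + h) + infConv V i (x - h) - 2 * i * h ^ 2) / 2 ≤ infConv V i x := by
    refine le_ciInf fun z => ?_
    have h1 := infConv_le hV hi (x + h) (z + h)
    have h2 := infConv_le hV hi (x - h) (z - h)
    rw [show x + h - (z + h) = x - z by ring] at h1
    rw [show x - h - (z - h) = x - z by ring] at h2
    nlinarith
  linarith

lemma continuous_infConv (hV : ∀ x, 0 ≤ V x) (hi : 0 ≤ i) (hu : UniformContinuous V) :
    Continuous (infConv V i) := by
  refine Metric.continuous_iff.2 fun x ε hε => ?_
  obtain ⟨δ, hδ, H⟩ := Metric.uniformContinuous_iff.1 hu (ε / 2) (half_pos hε)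
  have key : ∀ a b : ℝ, dist a b < δ → infConv V i a - ε / 2 ≤ infConv V i b := fun a b hab =>
    le_ciInf fun z => by
      have h1 := infConv_le hV hi a z
      have h2 := H (a := a - z) (b := b - z) (by rwa [dist_sub_right])
      rw [Real.dist_eq] at h2
      linarith [le_abs_self (V (a - z) - V (b - z))]
  refine ⟨δ, hδ, fun y hy => ?_⟩
  rw [Real.dist_eq, abs_lt]
  constructor <;> linarith [key x y (by rwa [dist_comm]), key y x hy]

lemma tendsto_infConv (hV : ∀ x, 0 ≤ V x) (hc : Continuous V) (x : ℝ) :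
    Tendsto (fun n : ℕ => infConv V n x) atTop (𝓝 (V x)) := by
  refine Metric.tendsto_atTop.2 fun ε hε => ?_
  obtain ⟨δ, hδ, H⟩ := Metric.continuous_iff.1 hc x (ε / 2) (half_pos hε)
  obtain ⟨N, hN⟩ := exists_nat_ge (V x / δ ^ 2)
  refine ⟨N, fun n hn => ?_⟩
  have hn' : V x ≤ n * δ ^ 2 := (div_le_iff₀ (by positivity)).1 (hN.trans (by exact_mod_cast hn))
  have h1 := infConv_le_self hV (Nat.cast_nonneg n) x
  have h2 : V x - ε / 2 ≤ infConv V n x := le_ciInf fun z => by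
    have h0 := hV (x - z)
    rcases lt_or_ge |z| δ with hz | hz
    · have h3 := H (x - z) (by simpa [Real.dist_eq] using hz)
      rw [Real.dist_eq] at h3
      have h4 : 0 ≤ (n : ℝ) * z ^ 2 := by positivity
      linarith [neg_abs_le (V (x - z) - V x)]
    · have h3 : δ ^ 2 ≤ z ^ 2 := by rw [← sq_abs z]; gcongr
      have h4 : (n : ℝ) * δ ^ 2 ≤ n * z ^ 2 := by gcongr
      linarith
  rw [Real.dist_eq, abs_lt]
  constructor <;> linarith

end InfConv

/-! ### Lipschitz approximation of the power nonlinearity -/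

/-- A Lipschitz approximation of `s ^ p` from below. -/
def lipPow (p δ s : ℝ) : ℝ := max s δ ^ p - δ ^ p

section LipPow

variable {p δ s : ℝ}

lemma rpow_sub_rpow_le_of_le_one (hp1 : p ≤ 1) {x y : ℝ} (hδ : 0 < δ) (hy : δ ≤ y)
    (hxy : y ≤ x) : x ^ p - y ^ p ≤ δ ^ (p - 1) * (x - y) := by
  have hy0 : 0 < y := hδ.trans_le hy
  have h1 : (x / y) ^ p ≤ x / y := by
    have := Real.rpow_le_rpow_of_exponent_le ((one_le_div hy0).2 hxy) hp1
    rwa [Real.rpow_one] at this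
  rw [Real.div_rpow (hy0.le.trans hxy) hy0.le] at h1
  have h2 : y ^ p = y ^ (p - 1) * y := by
    rw [← Real.rpow_add_one hy0.ne', sub_add_cancel]
  have hyp : 0 < y ^ p := by positivity
  rw [div_le_iff₀ hyp] at h1
  have h3 : x / y * y ^ p = y ^ (p - 1) * x := by rw [h2]; field_simp
  have h4 : y ^ (p - 1) ≤ δ ^ (p - 1) := Real.rpow_le_rpow_of_nonpos hδ hy (by linarith)
  calc x ^ p - y ^ p ≤ y ^ (p - 1) * (x - y) := by rw [h3] at h1; linarith
    _ ≤ _ := mul_le_mul_of_nonneg_right h4 (by linarith)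

lemma lipPow_mono (hp0 : 0 < p) (hδ : 0 < δ) : Monotone (lipPow p δ) := fun s s' h => by
  have : 0 ≤ max s δ := hδ.le.trans (le_max_right _ _)
  unfold lipPow
  gcongr

lemma lipPow_zero (hδ : 0 < δ) : lipPow p δ 0 = 0 := by simp [lipPow, max_eq_right hδ.le]

lemma lipPow_anti (hp0 : 0 < p) {δ' : ℝ} (hδ' : 0 < δ') (h : δ' ≤ δ) (s : ℝ) :
    lipPow p δ s ≤ lipPow p δ' s := by
  have h1 : δ' ^ p ≤ δ ^ p := Real.rpow_le_rpow hδ'.le h hp0.le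
  unfold lipPow
  rcases le_total s δ with hs1 | hs1
  · rw [max_eq_right hs1]
    have : δ' ^ p ≤ max s δ' ^ p := Real.rpow_le_rpow hδ'.le (le_max_right _ _) hp0.le
    linarith
  · rw [max_eq_left hs1, max_eq_left (h.trans hs1)]
    linarith

lemma lipPow_le (hδ : 0 < δ) (hs : 0 ≤ s) : lipPow p δ s ≤ s ^ p := by
  have h0 : 0 ≤ δ ^ p := by positivity
  have h1 : 0 ≤ s ^ p := by positivity
  unfold lipPow
  rcases le_total s δ with hs1 | hs1
  · rw [max_eq_right hs1]; linarith
  · rw [max_eq_left hs1]; linarith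

lemma abs_lipPow_sub_le (hp0 : 0 < p) (hp1 : p ≤ 1) (hδ : 0 < δ) (s s' : ℝ) :
    |lipPow p δ s - lipPow p δ s'| ≤ δ ^ (p - 1) * |s - s'| := by
  wlog h : s' ≤ s generalizing s s'
  · rw [abs_sub_comm, abs_sub_comm s]
    exact this s' s (le_of_not_ge h)
  have h1 := lipPow_mono hp0 hδ h
  rw [abs_of_nonneg (sub_nonneg.2 h1), abs_of_nonneg (sub_nonneg.2 h)]
  have h2 := rpow_sub_rpow_le_of_le_one hp1 hδ (le_max_right s' δ) (max_le_max_right δ h)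
  have h3 : max s δ - max s' δ ≤ s - s' := by
    rcases le_total s δ with h4 | h4
    · rw [max_eq_right h4, max_eq_right (h.trans h4)]; linarith
    · rw [max_eq_left h4]; linarith [le_max_left s' δ]
  have h4 : 0 < δ ^ (p - 1) := by positivity
  unfold lipPow
  nlinarith

lemma continuous_lipPow (hp0 : 0 < p) : Continuous (lipPow p δ) :=
  ((Real.continuous_rpow_const hp0.le).comp (continuous_id.max continuous_const)).sub
    continuous_const

lemma tendsto_lipPow {ι : Type*} {l : Filter ι} (hp0 : 0 < p) {d v : ι → ℝ} {y : ℝ}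
    (hd : Tendsto d l (𝓝 0)) (hv : Tendsto v l (𝓝 y)) (hy : 0 ≤ y) :
    Tendsto (fun i => lipPow p (d i) (v i)) l (𝓝 (y ^ p)) := by
  have h1 := (hv.max hd).rpow_const (p := p) (.inr hp0.le)
  have h2 := hd.rpow_const (p := p) (.inr hp0.le)
  have := h1.sub h2
  rwa [max_eq_left hy, Real.zero_rpow hp0.ne', sub_zero] at this

end LipPow

/-! ### Properties of the limits of the discrete solutions -/

lemma tendsto_floor_mul {ι : Type*} {l : Filter ι} {η : ι → ℝ} (hη0 : ∀ i, 0 < η i)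
    (hη : Tendsto η l (𝓝 0)) (x : ℝ) : Tendsto (fun i => (⌊x / η i⌋ : ℝ) * η i) l (𝓝 x) := by
  have h1 : Tendsto (fun i => x - η i) l (𝓝 x) := by simpa using hη.const_sub x
  refine tendsto_of_tendsto_of_tendsto_of_le_of_le h1 tendsto_const_nhds (fun i => ?_) fun i => ?_
  · have := (floor_mul_mem (a := x) (hη0 i)).2
    dsimp only
    linarith
  · exact (floor_mul_mem (hη0 i)).1

lemma tendsto_natFloor_mul {ι : Type*} {l : Filter ι} {η : ι → ℝ} (hη0 : ∀ i, 0 < η i)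
    (hη : Tendsto η l (𝓝 0)) {x : ℝ} (hx : 0 ≤ x) :
    Tendsto (fun i => (⌊x / η i⌋₊ : ℝ) * η i) l (𝓝 x) := by
  have h1 : Tendsto (fun i => x - η i) l (𝓝 x) := by simpa using hη.const_sub x
  refine tendsto_of_tendsto_of_tendsto_of_le_of_le h1 tendsto_const_nhds (fun i => ?_) fun i => ?_
  · have := (natFloor_mul_mem hx (hη0 i)).2
    dsimp only
    linarith
  · exact (natFloor_mul_mem hx (hη0 i)).1

section RegularLimit

variable {m p M M₀ A L₀ T Lg CH κ : ℝ} {a : ℝ → ℝ} {H : ℝ → ℝ → ℝ} {g w : ℝ → ℝ} {η : ℕ → ℝ}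
  {l : Filter ℕ} {u : ℝ → ℝ → ℝ}

namespace IsRegularData

variable (D : IsRegularData m p M M₀ A L₀ T Lg CH κ a H g w) (hη0 : ∀ N, 0 < η N)

include D hη0

lemma floor_time_le (N : ℕ) (t : ℝ) :
    (⌊clampTime (T / 2) t / (meshRatio m M * η N ^ 2)⌋₊ : ℝ) * (meshRatio m M * η N ^ 2) ≤ T := by
  have h1 := D.meshRatio_pos
  have h2 := hη0 N
  have hT := D.T_pos
  exact (natFloor_mul_mem (clampTime_nonneg _ _) (by positivity)).1.trans
    ((clampTime_le (by positivity) t).trans (by linarith))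

variable (hη : Tendsto η l (𝓝 0))
  (hu : ∀ x t, Tendsto (fun N => gridFun (η N) (meshRatio m M * η N ^ 2) (T / 2)
    (regSol m p M L₀ a H g w (η N)) x t) l (𝓝 (u x t)))

include hη hu

lemma limit_initial [l.NeBot] (hw : Continuous w) (x : ℝ) : u x 0 = w x := by
  refine tendsto_nhds_unique (hu x 0) ?_
  have h1 := (hw.tendsto x).comp (tendsto_floor_mul hη0 hη x)
  refine h1.congr fun N => ?_
  have hT := D.T_pos
  rw [gridFun, clampTime_of_mem ⟨le_rfl, by positivity⟩, zero_div, Nat.floor_zero]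
  rfl

lemma limit_eq_zero [l.NeBot] (hη1 : ∀ N, η N ≤ 1) {x : ℝ} (hx : L₀ + M + 1 < |x|) (t : ℝ) :
    u x t = 0 := by
  refine tendsto_nhds_unique (hu x t) (tendsto_const_nhds.congr' ?_)
  filter_upwards [(tendsto_floor_mul hη0 hη x).abs.eventually_const_lt hx] with N hN
  exact (D.regSol_eq_zero (hη0 N) (hη1 N) (D.floor_time_le hη0 N t) hN.le).symm

lemma bump_le_limit [l.NeBot] {R₀ r : ℝ} (hr : 0 < r) {B E : ℝ → ℝ} (hBc : Continuous B)
    (hB0 : B 0 = 0) (hBnonneg : ∀ t ∈ Icc 0 T, 0 ≤ B t) (hB1 : ∀ t ∈ Icc 0 T, B t ≤ 1)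
    (hB : ∀ s ∈ Icc 0 T, ∀ t ∈ Icc 0 T, s ≤ t → B s ≤ B t ∧ B t - B s ≤ (t - s) * E t)
    (hE : ∀ t ∈ Icc 0 T, E t + 8 / r ^ 2 * (m / (m - p)) * B t ^ m ≤ B t ^ p)
    (hH : ∀ x, ∀ t ∈ Icc 0 T, H x t = (B t * max (bump R₀ r x) 0 ^ (1 / (m - p))) ^ p)
    (hL : ∀ x, 0 < bump R₀ r x → |x| < L₀) (x : ℝ) {t : ℝ} (ht : t ∈ Icc 0 (T / 2)) :
    B t * max (bump R₀ r x) 0 ^ (1 / (m - p)) ≤ u x t := by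
  have h1 := D.meshRatio_pos
  have hmp : 0 ≤ 1 / (m - p) := one_div_nonneg.2 (by linarith [D.one_lt_m, D.p_lt_one])
  have hk : Tendsto (fun N => meshRatio m M * η N ^ 2) l (𝓝 0) := by
    simpa using (hη.pow 2).const_mul (meshRatio m M)
  have hk0 : ∀ N, 0 < meshRatio m M * η N ^ 2 := fun N => by have := hη0 N; positivity
  have hβ : Continuous fun x => max (bump R₀ r x) 0 ^ (1 / (m - p)) := by
    refine (Real.continuous_rpow_const hmp).comp (Continuous.max ?_ continuous_const)
    unfold bump
    fun_prop
  have h2 := ((hBc.tendsto _).comp (tendsto_natFloor_mul hk0 hk (clampTime_nonneg (T / 2) t))).mul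
    ((hβ.tendsto x).comp (tendsto_floor_mul hη0 hη x))
  rw [clampTime_of_mem ht] at h2
  refine le_of_tendsto_of_tendsto' h2 (hu x t) fun N => ?_
  have := D.bump_le_regSol (hη0 N) hr hB0 hBnonneg hB1 hB hE hH hL (D.floor_time_le hη0 N t)
    ⌊x / η N⌋
  rw [clampTime_of_mem ht] at this
  simpa only [gridFun, clampTime_of_mem ht, Function.comp_apply] using this

end IsRegularData

end RegularLimit

/-! ### The growing bump -/

/-- The time exponent of the growing bump. -/
def bumpExp (p : ℝ) : ℝ := 2 / (p * (1 - p))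

/-- The obstacle: the `p`-th power of the growing bump, with time clamped to `[0, T]`. -/
def bumpSource (m p R₀ r T x t : ℝ) : ℝ :=
  (clampTime T t ^ bumpExp p * max (bump R₀ r x) 0 ^ (1 / (m - p))) ^ p

section BumpSource

variable {m p R₀ r T : ℝ}

lemma bumpExp_mul (hp0 : 0 < p) : bumpExp p * p = 2 / (1 - p) := by
  unfold bumpExp; field_simp

lemma two_lt_bumpExp_mul (hp0 : 0 < p) (hp1 : p < 1) : 2 < bumpExp p * p := by
  rw [bumpExp_mul hp0, lt_div_iff₀ (by linarith)]; linarith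

lemma two_lt_bumpExp_mul_sub (hp0 : 0 < p) (hp1 : p < 1) : 2 < bumpExp p * (1 - p) := by
  have h : (1 - p) ≠ 0 := by linarith
  have : bumpExp p * (1 - p) = 2 / p := by unfold bumpExp; field_simp
  rw [this, lt_div_iff₀ hp0]; linarith

lemma two_lt_bumpExp (hp0 : 0 < p) (hp1 : p < 1) : 2 < bumpExp p := by
  nlinarith [two_lt_bumpExp_mul hp0 hp1, two_lt_bumpExp_mul_sub hp0 hp1]

lemma bumpExp_inequality (hm : 1 < m) (hp0 : 0 < p) (hp1 : p < 1) {c t : ℝ} (hc : 0 ≤ c)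
    (ht : t ∈ Icc 0 T) (hT1 : T ≤ 1) (hT : (bumpExp p + c) * T ≤ 1) :
    bumpExp p * t ^ (bumpExp p - 1) + c * (t ^ bumpExp p) ^ m ≤ (t ^ bumpExp p) ^ p := by
  have h1 := two_lt_bumpExp_mul hp0 hp1
  have h2 := two_lt_bumpExp_mul_sub hp0 hp1
  have h3 := two_lt_bumpExp hp0 hp1
  rw [← Real.rpow_mul ht.1, ← Real.rpow_mul ht.1]
  rcases ht.1.eq_or_lt with rfl | ht0
  · rw [Real.zero_rpow (by linarith), Real.zero_rpow (by nlinarith), Real.zero_rpow (by linarith)]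
    simp
  have ht1 : t ≤ 1 := ht.2.trans hT1
  have e : t ^ (bumpExp p * p + 1) = t ^ (bumpExp p * p) * t := Real.rpow_add_one ht0.ne' _
  have h4 : t ^ (bumpExp p - 1) ≤ t ^ (bumpExp p * p) * t := by
    rw [← e]; exact Real.rpow_le_rpow_of_exponent_ge ht0 ht1 (by nlinarith)
  have h5 : t ^ (bumpExp p * m) ≤ t ^ (bumpExp p * p) * t := by
    rw [← e]; exact Real.rpow_le_rpow_of_exponent_ge ht0 ht1 (by nlinarith)
  have h6 : 0 < t ^ (bumpExp p * p) := by positivity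
  have h7 : (bumpExp p + c) * t ≤ 1 :=
    (mul_le_mul_of_nonneg_left ht.2 (by linarith)).trans hT
  calc _ ≤ bumpExp p * (t ^ (bumpExp p * p) * t) + c * (t ^ (bumpExp p * p) * t) := by gcongr
    _ = t ^ (bumpExp p * p) * ((bumpExp p + c) * t) := by ring
    _ ≤ _ := mul_le_of_le_one_right h6.le h7

lemma bumpSource_nonneg (x t : ℝ) : 0 ≤ bumpSource m p R₀ r T x t := by
  have := clampTime_nonneg T t
  unfold bumpSource
  positivity

lemma bumpProfile_le_one (hr : 0 < r) (hmp : p < m) (x : ℝ) :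
    max (bump R₀ r x) 0 ^ (1 / (m - p)) ≤ 1 :=
  Real.rpow_le_one (le_max_right _ _) (max_le (bump_le_one hr) zero_le_one)
    (one_div_nonneg.2 (by linarith))

lemma bumpSource_le_one (hr : 0 < r) (hp0 : 0 < p) (hp1 : p < 1) (hm : 1 < m) (hT0 : 0 ≤ T)
    (hT1 : T ≤ 1) (x t : ℝ) : bumpSource m p R₀ r T x t ≤ 1 := by
  have h1 := clampTime_nonneg T t
  have h2 := (clampTime_le hT0 t).trans hT1
  have h3 := two_lt_bumpExp hp0 hp1
  refine Real.rpow_le_one (by positivity) (mul_le_one₀ (Real.rpow_le_one h1 h2 (by linarith))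
    (by positivity) (bumpProfile_le_one hr (by linarith) x)) hp0.le

lemma bumpSource_eq_zero (hp0 : 0 < p) (hmp : p < m) {x : ℝ} (hx : bump R₀ r x ≤ 0) (t : ℝ) :
    bumpSource m p R₀ r T x t = 0 := by
  have : 1 / (m - p) ≠ 0 := one_div_ne_zero (by linarith)
  rw [bumpSource, max_eq_right hx, Real.zero_rpow this, mul_zero, Real.zero_rpow hp0.ne']

lemma continuous_bumpSource (hp0 : 0 < p) (hp1 : p < 1) (hmp : p < m) :
    Continuous (Function.uncurry (bumpSource m p R₀ r T)) := by
  have h3 := two_lt_bumpExp hp0 hp1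
  refine (Real.continuous_rpow_const hp0.le).comp (Continuous.mul
    ((Real.continuous_rpow_const (by linarith)).comp ?_)
    ((Real.continuous_rpow_const (one_div_nonneg.2 (by linarith))).comp ?_))
  · unfold clampTime; fun_prop
  · unfold bump; fun_prop

lemma abs_bumpSource_sub_le (hr : 0 < r) (hp0 : 0 < p) (hp1 : p < 1) (hm : 1 < m)
    (hT1 : T ≤ 1) (x : ℝ) {t s : ℝ} (ht : t ∈ Icc 0 T) (hs : s ∈ Icc 0 T) :
    |bumpSource m p R₀ r T x t - bumpSource m p R₀ r T x s| ≤ bumpExp p * p * |t - s| := by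
  wlog h : s ≤ t generalizing s t
  · rw [abs_sub_comm, abs_sub_comm t]
    exact this hs ht (le_of_not_ge h)
  have h1 := two_lt_bumpExp_mul hp0 hp1
  set β := max (bump R₀ r x) 0 ^ (1 / (m - p))
  have hβ0 : 0 ≤ β := by positivity
  have hβ1 : β ≤ 1 := bumpProfile_le_one hr (by linarith) x
  have e : ∀ t ∈ Icc 0 T, bumpSource m p R₀ r T x t = t ^ (bumpExp p * p) * β ^ p :=
    fun t ht => by
      rw [bumpSource, clampTime_of_mem ht, Real.mul_rpow (Real.rpow_nonneg ht.1 _) hβ0,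
        Real.rpow_mul ht.1]
  rw [e t ht, e s hs, ← sub_mul, abs_mul, abs_of_nonneg (Real.rpow_nonneg hβ0 p),
    abs_of_nonneg (sub_nonneg.2 (Real.rpow_le_rpow hs.1 h (by linarith))),
    abs_of_nonneg (sub_nonneg.2 h)]
  have h2 := rpow_sub_rpow_le (q := bumpExp p * p) (by linarith) hs.1 ht.1
  have h3 : t ^ (bumpExp p * p - 1) ≤ 1 := Real.rpow_le_one ht.1 (ht.2.trans hT1) (by linarith)
  have h4 : β ^ p ≤ 1 := Real.rpow_le_one hβ0 hβ1 hp0.le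
  have h5 : 0 ≤ t ^ (bumpExp p * p) - s ^ (bumpExp p * p) :=
    sub_nonneg.2 (Real.rpow_le_rpow hs.1 h (by linarith))
  refine (mul_le_of_le_one_right h5 h4).trans (h2.trans ?_)
  refine mul_le_mul_of_nonneg_right (mul_le_of_le_one_right (by linarith) h3) (sub_nonneg.2 h)

end BumpSource

/-! ### Existence of solutions above the growing bump -/

lemma IsRegularData.bumpSource_le_limit {m p M M₀ A L₀ T Lg CH κ R₀ r : ℝ} {a : ℝ → ℝ}
    {g w : ℝ → ℝ} {η : ℕ → ℝ} {l : Filter ℕ} [l.NeBot] {u : ℝ → ℝ → ℝ} (hr : 0 < r)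
    (D : IsRegularData m p M M₀ A L₀ T Lg CH κ a (bumpSource m p R₀ r T) g w)
    (hT : (bumpExp p + 8 / r ^ 2 * (m / (m - p))) * T ≤ 1)
    (hL : ∀ x ∈ Ioo R₀ (R₀ + r), |x| < L₀) (hη0 : ∀ N, 0 < η N) (hη : Tendsto η l (𝓝 0))
    (hu : ∀ x t, Tendsto (fun N => gridFun (η N) (meshRatio m M * η N ^ 2) (T / 2)
      (regSol m p M L₀ a (bumpSource m p R₀ r T) g w (η N)) x t) l (𝓝 (u x t)))
    (x : ℝ) {t : ℝ} (ht : t ∈ Icc 0 (T / 2)) :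
    t ^ bumpExp p * max (bump R₀ r x) 0 ^ (1 / (m - p)) ≤ u x t := by
  have h3 := two_lt_bumpExp D.p_pos D.p_lt_one
  have hmp : 0 < m - p := by linarith [D.one_lt_m, D.p_lt_one]
  have hm := D.m_pos
  refine D.bump_le_limit hη0 hη hu hr (B := fun t => t ^ bumpExp p)
    (E := fun t => bumpExp p * t ^ (bumpExp p - 1)) (Real.continuous_rpow_const (by linarith))
    (Real.zero_rpow (by linarith)) (fun t ht => Real.rpow_nonneg ht.1 _)
    (fun t ht => Real.rpow_le_one ht.1 (ht.2.trans D.T_le_one) (by linarith))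
    (fun s hs t ht hst => ⟨Real.rpow_le_rpow hs.1 hst (by linarith),
      (rpow_sub_rpow_le (by linarith) hs.1 ht.1).trans (le_of_eq (by ring))⟩)
    (fun t ht => bumpExp_inequality D.one_lt_m D.p_pos D.p_lt_one (by positivity) ht D.T_le_one hT)
    (fun x t ht => by rw [bumpSource, clampTime_of_mem ht])
    (fun x hx => hL x (mem_of_bump_pos hr hx)) x ht

theorem exists_isWeakSolution1_of_isRegularData {m p σ M M₀ A L₀ T CH R₀ r : ℝ} {Lg κ : ℕ → ℝ}
    {a : ℝ → ℝ} {g w : ℕ → ℝ → ℝ} {u₀ : ℝ → ℝ} (hr : 0 < r)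
    (D : ∀ i, IsRegularData m p M M₀ A L₀ T (Lg i) CH (κ i) a (bumpSource m p R₀ r T) (g i) (w i))
    (hT : (bumpExp p + 8 / r ^ 2 * (m / (m - p))) * T ≤ 1)
    (hL : ∀ x ∈ Ioo R₀ (R₀ + r), |x| < L₀) (ha : Continuous a)
    (haσ : ∀ x, |x| ≤ L₀ + M + 1 → a x = (1 + |x|) ^ σ)
    (hgc : ∀ i, Continuous (g i)) (hg : ∀ s, 0 ≤ s → Monotone fun i => g i s)
    (hgt : ∀ (v : ℕ → ℝ) (y : ℝ), Tendsto v atTop (𝓝 y) → 0 ≤ y →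
      Tendsto (fun i => g i (v i)) atTop (𝓝 (y ^ p)))
    (hwc : ∀ i, Continuous (w i)) (hw : ∀ x, Monotone fun i => w i x)
    (hwt : ∀ x, Tendsto (fun i => w i x) atTop (𝓝 (u₀ x))) :
    ∃ u : ℝ → ℝ → ℝ, IsWeakSolution1 m p σ (T / 2) u u₀ ∧ ∀ x, ∀ t ∈ Icc 0 (T / 2),
      t ^ bumpExp p * max (bump R₀ r x) 0 ^ (1 / (m - p)) ≤ u x t := by
  have D0 := D 0
  have hT0 := D0.T_pos
  have hT2 : 0 < T / 2 := by positivity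
  have hp := D0.p_pos
  have hp1 := D0.p_lt_one
  have hm := D0.one_lt_m
  have hM := D0.M_pos
  have hlam := D0.meshRatio_pos
  have hA : 1 ≤ A := D0.one_le_A
  set lam := meshRatio m M with hlam_def
  set η₀ : ℝ := min 1 (T / (2 * lam)) with hη₀
  have hη₀0 : 0 < η₀ := lt_min one_pos (by positivity)
  have hη₀1 : η₀ ≤ 1 := min_le_left _ _
  have hη₀T : lam * η₀ ^ 2 ≤ T / 2 := by
    have h1 : η₀ ^ 2 ≤ η₀ := by nlinarith
    have h2 : lam * η₀ ≤ lam * (T / (2 * lam)) :=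
      mul_le_mul_of_nonneg_left (min_le_right _ _) hlam.le
    have h3 : lam * (T / (2 * lam)) = T / 2 := by field_simp
    nlinarith
  set η : ℕ → ℝ := fun N => η₀ * (1 / ((N : ℝ) + 1)) with hη_def
  have hη0 : ∀ N, 0 < η N := fun N => by positivity
  have hηη : ∀ N, η N ≤ η₀ := fun N => mul_le_of_le_one_right hη₀0.le (by
    rw [div_le_one (by positivity)]; linarith [(Nat.cast_nonneg N : (0 : ℝ) ≤ N)])
  have hη : Tendsto η atTop (𝓝 0) := by
    simpa [hη_def] using (tendsto_one_div_add_atTop_nhds_zero_nat (𝕜 := ℝ)).const_mul η₀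
  have hηT : ∀ N, lam * η N ^ 2 ≤ T / 2 := fun N => by
    refine le_trans ?_ hη₀T
    have := hη0 N
    have := hηη N
    gcongr
  have h𝒰 : ((hyperfilter ℕ : Ultrafilter ℕ) : Filter ℕ) ≤ atTop := by
    rw [← Nat.cofinite_eq_atTop]; exact hyperfilter_le_cofinite
  have hη1 : ∀ N, η N ≤ 1 := fun N => (hηη N).trans hη₀1
  choose C₁ C₂ e hC₁ hC₂ S using fun i => (D i).exists_isConsistentScheme hη0 hη1 hη hηT
  choose v hv using fun i => (S i).exists_limit hT2.le (hyperfilter ℕ)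
  have hηU := hη.mono_left h𝒰
  have hHc : Continuous (Function.uncurry (bumpSource m p R₀ r T)) :=
    continuous_bumpSource hp hp1 (by linarith)
  have hmem : ∀ i x t, v i x t ∈ Icc 0 M := fun i x t => (S i).limit_mem hT2.le (hv i) x t
  have hfc : ∀ i, Continuous fun z : ℝ × ℝ × ℝ =>
      a z.1 * max (bumpSource m p R₀ r T z.1 z.2.1) (g i z.2.2) := fun i => by
    have h1 : Continuous fun z : ℝ × ℝ × ℝ => bumpSource m p R₀ r T z.1 z.2.1 :=
      hHc.comp (continuous_fst.prodMk (continuous_fst.comp continuous_snd))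
    have h2 := hgc i
    fun_prop
  have happ : IsMonotoneApprox m M (A * max 1 (M ^ p)) (T / 2)
      (fun i z => a z.1 * max (bumpSource m p R₀ r T z.1 z.2.1) (g i z.2.2)) v :=
    { continuous := fun i => (S i).continuous_limit (by linarith) hT2.le (hC₁ i) (hC₂ i) h𝒰 (hv i)
      mono := fun x t i i' hii => le_of_tendsto_of_tendsto' (hv i x t) (hv i' x t) fun N =>
        (D i).regSol_mono (hη0 N) (fun s hs => hg s hs hii) (fun x => hw x hii) _ _
      nonneg := fun i x t => (hmem i x t).1
      le_bound := fun i x t => (hmem i x t).2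
      source_continuous := hfc
      source_bound := fun i x t => by
        have h0 := bumpSource_nonneg (m := m) (p := p) (R₀ := R₀) (r := r) (T := T) x t
        have h1 := zero_le_one.trans (D0.one_le_a x)
        dsimp only
        rw [abs_of_nonneg (mul_nonneg h1 (h0.trans (le_max_left _ _)))]
        refine mul_le_mul (D0.a_le x) (max_le_max
          (bumpSource_le_one hr hp hp1 hm hT0.le D0.T_le_one x t) ?_)
          (h0.trans (le_max_left _ _)) (by linarith)
        exact ((D i).g_le _ (hmem i x t).1).trans
          (Real.rpow_le_rpow (hmem i x t).1 (hmem i x t).2 hp.le)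
      hasDerivAt := fun i ζ hζ hc t ht =>
        (S i).hasDerivAt_integral (by linarith) hM.le (hC₁ i) (hC₂ i) h𝒰 (hv i) (hfc i) hζ hc ht }
  have hlim : ∀ x t, Tendsto (fun i => v i x t) atTop (𝓝 (⨆ i, v i x t)) := fun x t =>
    tendsto_atTop_ciSup (happ.mono x t) ⟨M, by rintro _ ⟨i, rfl⟩; exact (hmem i x t).2⟩
  have hbump : ∀ x, ∀ t ∈ Icc 0 (T / 2),
      t ^ bumpExp p * max (bump R₀ r x) 0 ^ (1 / (m - p)) ≤ ⨆ i, v i x t := fun x t ht =>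
    (D0.bumpSource_le_limit hr hT hL hη0 hηU (hv 0) x ht).trans (happ.le_limit hlim 0 x t)
  refine ⟨fun x t => ⨆ i, v i x t, happ.isWeakSolution1 (by linarith) hT2 hlim ?_ ?_, hbump⟩
  · intro x t ht
    have hw0 : 0 ≤ ⨆ i, v i x t := ge_of_tendsto' (hlim x t) fun i => (hmem i x t).1
    have h1 := ((tendsto_const_nhds (x := bumpSource m p R₀ r T x t)).max
      (hgt _ _ (hlim x t) hw0)).const_mul (a x)
    convert h1 using 2
    have hle : bumpSource m p R₀ r T x t ≤ (⨆ i, v i x t) ^ p := by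
      have ht' : t ∈ Icc 0 T := ⟨ht.1.le, by linarith [ht.2]⟩
      rw [bumpSource, clampTime_of_mem ht']
      have := ht.1
      exact Real.rpow_le_rpow (by positivity) (hbump x t (Ioo_subset_Icc_self ht)) hp.le
    rw [max_eq_right hle]
    rcases le_or_gt |x| (L₀ + M + 1) with hx | hx
    · rw [haσ x hx]
    · have : ⨆ i, v i x t = 0 := by
        simp [fun i => (D i).limit_eq_zero hη0 hηU (hv i) hη1 hx t]
      rw [this, Real.zero_rpow hp.ne', mul_zero, mul_zero]
  · intro x
    refine tendsto_nhds_unique (hlim x 0) ((hwt x).congr fun i => ?_)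
    exact ((D i).limit_initial hη0 hηU (hv i) (hwc i) x).symm

lemma continuous_one_add_abs_rpow (σ : ℝ) : Continuous fun x : ℝ => (1 + |x|) ^ σ := by
  refine Continuous.rpow_const (by fun_prop) fun x => .inl ?_
  positivity

/-- Fundamental extension: a solution whose right interface jumps instantaneously
from R₀ to at least R₀ + r at time t = 0. -/
theorem interface_instantaneous_jump
    {m p σ : ℝ} (hm : 1 < m) (hp0 : 0 < p) (hp1 : p < 1)
    (hσ : 0 < σ) (hmp : 2 ≤ m + p)
    (u₀ : ℝ → ℝ)
    (hu₀cont : Continuous u₀) (hu₀bdd : ∃ C : ℝ, ∀ x, u₀ x ≤ C)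
    (hu₀nonneg : ∀ x, 0 ≤ u₀ x) (hu₀ne : u₀ ≠ 0)
    {r₀ R₀ : ℝ} (hu₀supp : tsupport u₀ = Icc r₀ R₀)
    (r : ℝ) (hr : 0 < r) :
    ∃ T > (0:ℝ), ∃ u : ℝ → ℝ → ℝ,
      IsWeakSolution1 m p σ T u u₀ ∧
      ∀ x ∈ Ioo R₀ (R₀ + r), ∀ t ∈ Ioo (0:ℝ) T, 0 < u x t := by
  obtain ⟨M₀, hM₀⟩ := hu₀bdd
  have hM₀0 : 0 ≤ M₀ := (hu₀nonneg 0).trans (hM₀ 0)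
  have hm0 : 0 < m := by linarith
  have hmp' : 0 < m - p := by linarith
  set M : ℝ := M₀ + 1 with hM
  set L₀ : ℝ := |r₀| + |R₀| + r + 1 with hL₀
  have hL₀0 : 0 ≤ L₀ := by positivity
  set A : ℝ := (1 + (L₀ + M + 1)) ^ σ with hA
  have hA1 : 1 ≤ A := Real.one_le_rpow (by linarith) hσ.le
  set c : ℝ := 8 / r ^ 2 * (m / (m - p)) with hc
  have hc0 : 0 ≤ c := by positivity
  have hν := two_lt_bumpExp hp0 hp1
  have hM1 : 1 ≤ M := by linarith
  have hwave : 0 ≤ waveSpeed m p M A := by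
    have := waveConst_pos hp0 hp1 hmp
    unfold waveSpeed
    positivity
  have hAM : 0 ≤ A * M ^ p := by positivity
  set S : ℝ := 1 + (bumpExp p + c) + waveSpeed m p M A + A * M ^ p with hS
  have hS0 : 0 < S := by linarith
  have hle : ∀ y, y ≤ S → y * (1 / S) ≤ 1 := fun y hy => by
    rwa [mul_one_div, div_le_one hS0]
  have hL : ∀ x ∈ Ioo R₀ (R₀ + r), |x| < L₀ := fun x hx => by
    rw [abs_lt]
    constructor <;> linarith [hx.1, hx.2, neg_abs_le R₀, le_abs_self R₀, abs_nonneg r₀]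
  have hu₀zero : ∀ x, L₀ ≤ |x| → u₀ x = 0 := fun x hx => by
    refine image_eq_zero_of_notMem_tsupport fun hx' => hx.not_gt ?_
    rw [hu₀supp] at hx'
    rw [abs_lt]
    constructor <;>
      linarith [hx'.1, hx'.2, neg_abs_le r₀, le_abs_self R₀, abs_nonneg r₀, abs_nonneg R₀]
  set V : ℝ → ℝ := fun x => u₀ x ^ m with hVdef
  have hV0 : ∀ x, 0 ≤ V x := fun x => Real.rpow_nonneg (hu₀nonneg x) m
  have hVc : Continuous V := hu₀cont.rpow_const fun _ => .inr hm0.le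
  have hVu : UniformContinuous V := by
    refine hVc.uniformContinuous_of_tendsto_cocompact (x := 0) ?_
    refine tendsto_const_nhds.congr' ?_
    filter_upwards [(tendsto_norm_cocompact_atTop (E := ℝ)).eventually_ge_atTop L₀] with x hx
    rw [hVdef]
    dsimp only
    rw [hu₀zero x hx, Real.zero_rpow hm0.ne']
  have hVi : ∀ (i : ℕ) x, 0 ≤ infConv V i x := fun i => infConv_nonneg hV0 i.cast_nonneg
  set w : ℕ → ℝ → ℝ := fun i x => infConv V i x ^ (1 / m) with hw
  have hwm : ∀ i x, w i x ^ m = infConv V i x := fun i x => by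
    rw [hw]
    dsimp only
    rw [← Real.rpow_mul (hVi i x), one_div_mul_cancel hm0.ne', Real.rpow_one]
  have hVu₀ : ∀ x, V x ^ (1 / m) = u₀ x := fun x => by
    rw [hVdef]
    dsimp only
    rw [← Real.rpow_mul (hu₀nonneg x), mul_one_div_cancel hm0.ne', Real.rpow_one]
  have hm' : 0 ≤ 1 / m := by positivity
  have hw0 : ∀ i x, 0 ≤ w i x := fun i x => Real.rpow_nonneg (hVi i x) _
  have hwu : ∀ i x, w i x ≤ u₀ x := fun i x => by
    rw [← hVu₀]
    exact Real.rpow_le_rpow (hVi i x) (infConv_le_self hV0 i.cast_nonneg x) hm'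
  have hδ : ∀ i : ℕ, 0 < 1 / ((i : ℝ) + 1) := fun i => by positivity
  have D : ∀ i : ℕ, IsRegularData m p M M₀ A L₀ (1 / S) ((1 / ((i : ℝ) + 1)) ^ (p - 1))
      (bumpExp p * p) (2 * i) (fun x => min ((1 + |x|) ^ σ) A) (bumpSource m p R₀ r (1 / S))
      (lipPow p (1 / ((i : ℝ) + 1))) (w i) := fun i =>
    have hS1 : 1 / S ≤ 1 := by simpa using hle 1 (by linarith)
    { one_lt_m := hm
      p_pos := hp0
      p_lt_one := hp1
      two_le := hmp
      one_le_M := hM1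
      T_pos := by positivity
      T_le_one := hS1
      bound_le := by linarith [hle (A * M ^ p) (by linarith)]
      speed_le := hle _ (by linarith)
      L₀_nonneg := hL₀0
      w_nonneg := hw0 i
      w_le := fun x => (hwu i x).trans (hM₀ x)
      w_eq_zero := fun x hx => le_antisymm ((hwu i x).trans (hu₀zero x hx).le) (hw0 i x)
      κ_nonneg := by positivity
      semiconcave := fun x h => by
        rw [hwm, hwm, hwm]; exact infConv_semiconcave hV0 i.cast_nonneg x h
      one_le_a := fun x =>
        le_min (Real.one_le_rpow (by linarith [abs_nonneg x]) hσ.le) hA1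
      a_le := fun x => min_le_right _ _
      H_nonneg := bumpSource_nonneg
      H_le_one := fun x t _ => bumpSource_le_one hr hp0 hp1 hm (by positivity) hS1 x t
      H_lipschitz := fun x t ht s hs => abs_bumpSource_sub_le hr hp0 hp1 hm hS1 x ht hs
      CH_nonneg := by positivity
      H_eq_zero := fun x t hx => bumpSource_eq_zero hp0 (by linarith)
        (not_lt.1 fun h => hx.not_gt (hL x (mem_of_bump_pos hr h))) t
      g_mono := lipPow_mono hp0 (hδ i)
      g_zero := lipPow_zero (hδ i)
      g_le := fun s hs => lipPow_le (hδ i) hs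
      Lg_nonneg := by positivity
      g_lipschitz := abs_lipPow_sub_le hp0 hp1.le (hδ i) }
  obtain ⟨u, hu, hbump⟩ := exists_isWeakSolution1_of_isRegularData (σ := σ) (u₀ := u₀) hr D
    (hle _ (by linarith)) hL ((continuous_one_add_abs_rpow σ).min continuous_const)
    (fun x hx => min_eq_left (Real.rpow_le_rpow (by positivity) (by linarith) hσ.le))
    (fun i => continuous_lipPow hp0)
    (fun s _ i i' hii => lipPow_anti hp0 (hδ i') (by gcongr) s)
    (fun v y hv hy => tendsto_lipPow hp0 tendsto_one_div_add_atTop_nhds_zero_nat hv hy)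
    (fun i => (continuous_infConv hV0 i.cast_nonneg hVu).rpow_const fun _ => .inr hm')
    (fun x i i' hii => Real.rpow_le_rpow (hVi i x)
      (infConv_mono hV0 i.cast_nonneg (by exact_mod_cast hii) x) hm')
    (fun x => by
      rw [← hVu₀]; exact (tendsto_infConv hV0 hVc x).rpow_const (.inr hm'))
  refine ⟨1 / S / 2, by positivity, u, hu, fun x hx t ht => ?_⟩
  refine lt_of_lt_of_le ?_ (hbump x t (Ioo_subset_Icc_self ht))
  exact mul_pos (Real.rpow_pos_of_pos ht.1 _)
    (Real.rpow_pos_of_pos (lt_max_of_lt_left (bump_pos hr hx)) _)
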